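/- For any invertible complex N×N matrix Q and any complex numbers z_1,…,z_n (not necessarily distinct), the kernel of the universal difference operator D_{Q,M}(u,τ) acting on M-valued functions is generated by quasi-exponentials. -/

import Mathlib

noncomputable section

namespace XXXModel

/-- A vector-valued quasi-exponential: a finite sum of functions
`Q₀^u p(u) = e^{(ln Q₀) u} p(u)` with `Q₀` a nonzero complex number with a fixed choice of
logarithm and `p` a vector-valued polynomial. -/
def IsQE {M : Type*} [AddCommGroup M] [Module ℂ M] (f : ℂ → M) : Prop :=
  ∃ (k d : ℕ) (lam : Fin k → ℂ) (v : Fin k → Fin d → M),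
    ∀ u : ℂ, f u = ∑ i : Fin k, ∑ j : Fin d,
      (Complex.exp (lam i * u) * u ^ (j : ℕ)) • v i j

/-- `g` is meromorphic at the point `x`. -/
def MeromAt (g : ℂ → ℂ) (x : ℂ) : Prop :=
  ∃ k : ℕ, AnalyticAt ℂ (fun z => (z - x) ^ k * g z) x

/-- Linear independence of a family of functions over the field of one-periodic
meromorphic functions on `ℂ`. -/
def IndepPeriodic {M : Type*} [AddCommGroup M] [Module ℂ M] {ι : Type*} [Fintype ι]
    (F : ι → ℂ → M) : Prop :=
  ∀ c : ι → ℂ → ℂ,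
    (∀ i x, MeromAt (c i) x) →
    (∀ i x, c i (x + 1) = c i x) →
    (∀ x : ℂ, (∀ i, AnalyticAt ℂ (c i) x) → ∑ i, c i x • F i x = 0) →
    ∀ i x, AnalyticAt ℂ (c i) x → c i x = 0

variable {N n : ℕ}

/-- Points where the universal difference operator (of order `N`) associated with the
evaluation points `z` is regular. -/
def Good (N : ℕ) {n : ℕ} (z : Fin n → ℂ) (u : ℂ) : Prop :=
  ∀ j : Fin n, ∀ k : ℕ, k < N → u - (k : ℂ) ≠ z j

section Setup

variable (V : Fin n → Type*) [∀ i, AddCommGroup (V i)] [∀ i, Module ℂ (V i)]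
  (M : Type*) [AddCommGroup M] [Module ℂ M]
  (E : ∀ i : Fin n, Fin N → Fin N → (V i →ₗ[ℂ] V i))
  (φ : M ≃ₗ[ℂ] PiTensorProduct ℂ V)

/-- The commutation relations of `gl_N`: `[e_{ab}, e_{cd}] = δ_{bc} e_{ad} − δ_{da} e_{cb}`,
for the operators `E i a b` (the action of `e_{ab}` on the `i`-th factor `V i`). -/
def GlRel : Prop :=
  ∀ (i : Fin n) (a b c d : Fin N),
    E i a b ∘ₗ E i c d - E i c d ∘ₗ E i a b =
      (if b = c then (1 : ℂ) else 0) • E i a d - (if d = a then (1 : ℂ) else 0) • E i c b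

/-- Each `V i` is the irreducible finite-dimensional `gl_N`-module with highest weight
`Λ i`: it is generated by a nonzero vector `v` with `e_{ab} v = 0` for `a < b` and
`e_{aa} v = Λ_a v`. -/
def IsHW (Λ : Fin n → Fin N → ℤ) : Prop :=
  ∀ i : Fin n, ∃ v : V i, v ≠ 0 ∧
    (∀ a b : Fin N, a < b → E i a b v = 0) ∧
    (∀ a : Fin N, E i a a v = (Λ i a : ℂ) • v) ∧
    ∀ W : Submodule ℂ (V i), (∀ a b : Fin N, ∀ x ∈ W, E i a b x ∈ W) → v ∈ W →
      ∀ x : V i, x ∈ W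

/-- `e_{ab}` acting in the `j`-th tensor factor of `M ≃ V 1 ⊗ ⋯ ⊗ V n`. -/
def EE (j : Fin n) (a b : Fin N) : Module.End ℂ M :=
  φ.symm.toLinearMap ∘ₗ
    (PiTensorProduct.map
      (Function.update (fun i : Fin n => (LinearMap.id : V i →ₗ[ℂ] V i)) j (E j a b))) ∘ₗ
    φ.toLinearMap

variable (z : Fin n → ℂ)

/-- The matrix `L^{(j)}(u - z_j)`, with entries `L_{ab} = δ_{ab} + e_{ba}^{(j)}/(u - z_j)`. -/
def Lmat (j : Fin n) (u : ℂ) : Matrix (Fin N) (Fin N) (Module.End ℂ M) :=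
  fun a b => (if a = b then 1 else 0) + (u - z j)⁻¹ • EE V M E φ j b a

/-- The Yangian generating series acting on the tensor product of evaluation modules:
`T(u) = L^{(n)}(u−z_n) ⋯ L^{(1)}(u−z_1)`. -/
def Tmat (u : ℂ) : Matrix (Fin N) (Fin N) (Module.End ℂ M) :=
  ((List.ofFn fun j : Fin n => Lmat V M E φ z j u).reverse).prod

variable (Q : Matrix (Fin N) (Fin N) ℂ)

/-- `X_{ab}(u,τ) = δ_{ab} − ∑_c Q_{ac} T_{cb}(u) τ^{−1}`, acting on `M`-valued functions. -/
def Xop (a b : Fin N) (f : ℂ → M) : ℂ → M :=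
  fun u => (if a = b then f u else 0)
    - ∑ c : Fin N, Q a c • (Tmat V M E φ z u c b) (f (u - 1))

/-- The universal difference operator
`D_{Q,M}(u,τ) = ∑_{σ ∈ S_N} sgn(σ) X_{1σ(1)}(u,τ) ⋯ X_{Nσ(N)}(u,τ)`. -/
def Dop (f : ℂ → M) : ℂ → M :=
  fun u => ∑ σ : Equiv.Perm (Fin N),
    ((Equiv.Perm.sign σ : ℤˣ) : ℤ) •
      (((List.ofFn fun a : Fin N => Xop V M E φ z Q a (σ a)).foldr (· ∘ ·) id) f u)

/-- The weight subspace `M[m]`. -/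
def Wt (m : Fin N → ℤ) : Submodule ℂ M :=
  ⨅ a : Fin N, LinearMap.ker
    ((∑ j : Fin n, EE V M E φ j a a) - (m a : ℂ) • (1 : Module.End ℂ M))

/-- The subspace `sing M[m]` of `gl_N`-singular vectors of weight `m`. -/
def SingWt (m : Fin N → ℤ) : Submodule ℂ M :=
  Wt V M E φ m ⊓ ⨅ a : Fin N, ⨅ b : Fin N, ⨅ _ : a < b,
    LinearMap.ker (∑ j : Fin n, EE V M E φ j a b)

end Setup

end XXXModel

namespace XXXModel

noncomputable def rdet {R : Type*} [Ring R] {N : ℕ} (v : Fin N → Fin N → R) : R :=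
  ∑ σ : Equiv.Perm (Fin N), ((Equiv.Perm.sign σ : ℤˣ) : ℤ) • (List.ofFn fun i => v i (σ i)).prod

/-- The `b`-th unit row. -/
def urow {R : Type*} [Ring R] {N : ℕ} (b : Fin N) : Fin N → R := fun j => if b = j then 1 else 0

lemma ofFn_update_prod {R : Type*} [Ring R] : ∀ {N : ℕ} (f : Fin N → R) (k : Fin N) (x : R),
    (∀ i, k < i → Commute (f i) x) →
    (List.ofFn (Function.update f k x)).prod = (List.ofFn (Function.update f k 1)).prod * x := by
  intro N
  induction N with
  | zero => intro f k; exact k.elim0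
  | succ N ih =>
    intro f k x h
    rw [List.ofFn_succ, List.ofFn_succ, List.prod_cons, List.prod_cons]
    induction k using Fin.cases with
    | zero =>
      simp only [Function.update_self, one_mul]
      have : ∀ y : R, (fun i : Fin N => Function.update f 0 y i.succ) = fun i => f i.succ := by
        intro y; ext i; simp [Function.update, Fin.succ_ne_zero]
      rw [this, this]
      refine (Commute.list_prod_left _ _ ?_).eq.symm
      intro y hy
      rw [List.mem_ofFn] at hy
      obtain ⟨i, rfl⟩ := hy
      exact h _ (Fin.succ_pos i)
    | succ k =>
      have : ∀ y : R, (fun i : Fin N => Function.update f k.succ y i.succ)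
          = Function.update (fun i => f i.succ) k y := by
        intro y; ext i; simp [Function.update]
      rw [this, this, ih (fun i => f i.succ) k x]
      · rw [mul_assoc]
        congr 1
      · intro i hi
        exact h _ (Fin.succ_lt_succ_iff.mpr hi)

lemma rdet_expand {R : Type*} [Ring R] {N : ℕ} (v : Fin N → Fin N → R) (k : Fin N)
    (hv : ∀ i, k < i → v i = urow i) (w : Fin N → R) :
    rdet (Function.update v k w) = ∑ b, rdet (Function.update v k (urow b)) * w b := by
  have e : ∀ (w : Fin N → R) (σ : Equiv.Perm (Fin N)),
      (fun i => Function.update v k w i (σ i))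
        = Function.update (fun i => v i (σ i)) k (w (σ k)) := by
    intro w σ; ext i
    by_cases h : i = k
    · subst h; simp
    · simp [h]
  have hc : ∀ (σ : Equiv.Perm (Fin N)) (x : R) i, k < i → Commute ((fun i => v i (σ i)) i) x := by
    intro σ x i hi
    simp only [hv i hi, urow]
    split_ifs
    · exact Commute.one_left _
    · exact Commute.zero_left _
  simp only [rdet, e]
  simp only [Finset.sum_mul]
  rw [Finset.sum_comm]
  refine Finset.sum_congr rfl fun σ _ => ?_
  rw [ofFn_update_prod _ _ _ (hc σ _)]
  rw [Finset.sum_eq_single (σ k)]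
  · simp [urow, mul_assoc]
  · intro b _ hb
    rw [ofFn_update_prod _ _ _ (hc σ _)]
    simp [urow, hb]
  · simp

/-- Antisymmetry of two rows. -/
def Anti {R : Type*} [Ring R] {N : ℕ} (v w : Fin N → R) : Prop :=
  ∀ i j, v i * w j - v j * w i + w i * v j - w j * v i = 0

lemma ofFn_adj {R : Type*} [Ring R] : ∀ {n : ℕ} (f : Fin (n + 1) → R) (k : Fin n),
    ∃ A B : R, ∀ g : Fin (n + 1) → R, (∀ i, i ≠ k.castSucc → i ≠ k.succ → g i = f i) →
      (List.ofFn g).prod = A * (g k.castSucc * g k.succ) * B := by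
  intro n
  induction n with
  | zero => intro f k; exact k.elim0
  | succ n ih =>
    intro f k
    induction k using Fin.cases with
    | zero =>
      refine ⟨1, (List.ofFn fun i : Fin n => f i.succ.succ).prod, fun g hg => ?_⟩
      rw [List.ofFn_succ, List.ofFn_succ]
      have : (fun i : Fin n => g i.succ.succ) = fun i => f i.succ.succ := by
        ext i; apply hg
        · simp [Fin.ext_iff]
        · simp [Fin.ext_iff]
      simp [this, mul_assoc]
    | succ k =>
      obtain ⟨A, B, h⟩ := ih (fun i => f i.succ) k
      refine ⟨f 0 * A, B, fun g hg => ?_⟩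
      rw [List.ofFn_succ, List.prod_cons, h (fun i => g i.succ)]
      · rw [hg 0 (by simp [Fin.ext_iff]) (by simp [Fin.ext_iff])]
        simp [mul_assoc]
      · intro i h1 h2
        apply hg
        · intro h; apply h1; simpa [Fin.ext_iff] using h
        · intro h; apply h2; simpa [Fin.ext_iff] using h

lemma rdet_adj {R : Type*} [Ring R] {n : ℕ} (v : Fin (n + 1) → Fin (n + 1) → R) (k : Fin n)
    (h : Anti (v k.castSucc) (v k.succ)) :
    rdet (v ∘ Equiv.swap k.castSucc k.succ) = - rdet v := by
  rw [eq_neg_iff_add_eq_zero]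
  unfold rdet
  rw [← Finset.sum_add_distrib]
  have hne : k.castSucc ≠ k.succ := by simp [Fin.ext_iff]
  set s := Equiv.swap k.castSucc k.succ with hs
  refine Finset.sum_involution (fun σ _ => σ * s) ?_ ?_ ?_ ?_
  · intro σ _
    obtain ⟨A, B, hAB⟩ := ofFn_adj (fun i => v i (σ i)) k
    have h0 : ∀ i, i ≠ k.castSucc → i ≠ k.succ → s i = i := fun i h1 h2 =>
      Equiv.swap_apply_of_ne_of_ne h1 h2
    have s1 : s k.castSucc = k.succ := Equiv.swap_apply_left _ _
    have s2 : s k.succ = k.castSucc := Equiv.swap_apply_right _ _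
    rw [hAB (fun i => (v ∘ s) i (σ i)) (by intro i h1 h2; simp [h0 i h1 h2]),
      hAB (fun i => v i (σ i)) (by intros; rfl),
      hAB (fun i => (v ∘ s) i ((σ * s) i)) (by intro i h1 h2; simp [h0 i h1 h2]),
      hAB (fun i => v i ((σ * s) i)) (by intro i h1 h2; simp [h0 i h1 h2])]
    simp only [Function.comp, s1, s2, Equiv.Perm.mul_apply, Equiv.Perm.sign_mul, hs,
      Equiv.Perm.sign_swap hne]
    rw [← hs]
    simp only [s1, s2, mul_neg, mul_one, Units.val_neg, neg_smul]
    have := h (σ k.castSucc) (σ k.succ)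
    have h2 : A * (v k.castSucc (σ k.castSucc) * v k.succ (σ k.succ) -
      v k.castSucc (σ k.succ) * v k.succ (σ k.castSucc) +
      v k.succ (σ k.castSucc) * v k.castSucc (σ k.succ) -
      v k.succ (σ k.succ) * v k.castSucc (σ k.castSucc)) * B = 0 := by rw [this]; simp
    rw [← smul_neg, ← smul_neg, ← smul_add, ← smul_add, ← smul_add]
    convert smul_zero _
    rw [← h2]
    noncomm_ring
  · intro σ _ _ h
    have : s = 1 := by simpa using h
    have := congrArg (fun t => t k.castSucc) this
    simp [hs] at this
    exact hne this.symm
  · intros; simp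
  · intro σ _; simp [hs, mul_assoc]

lemma rdet_perm {R : Type*} [Ring R] {N : ℕ} (v : Fin N → Fin N → R)
    (h : ∀ i j, Anti (v i) (v j)) (π : Equiv.Perm (Fin N)) :
    rdet (v ∘ π) = ((Equiv.Perm.sign π : ℤˣ) : ℤ) • rdet v := by
  cases N with
  | zero => 
    have : π = 1 := Subsingleton.elim _ _
    simp [this]
  | succ n =>
    have hm : π ∈ Submonoid.closure (Set.range fun i : Fin n => Equiv.swap i.castSucc i.succ) := by
      rw [Equiv.Perm.mclosure_swap_castSucc_succ]; trivial
    induction hm using Submonoid.closure_induction generalizing v with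
    | mem x hx =>
      obtain ⟨i, rfl⟩ := hx
      rw [rdet_adj _ _ (h _ _)]
      rw [Equiv.Perm.sign_swap (by simp [Fin.ext_iff])]
      simp
    | one => simp
    | mul x y _ _ ihx ihy =>
      have : v ∘ (x * y : Equiv.Perm _) = (v ∘ x) ∘ y := rfl
      rw [this, ihy (v ∘ x) (fun i j => h _ _), ihx v h]
      simp only [Equiv.Perm.sign_mul, Units.val_mul, smul_smul, mul_comm]

lemma rdet_eq_zero {R : Type*} [Ring R] [Algebra ℂ R] {N : ℕ} (v : Fin N → Fin N → R)
    (h : ∀ i j, Anti (v i) (v j)) {k l : Fin N} (hkl : k ≠ l) (he : v k = v l) : rdet v = 0 := by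
  have h1 := rdet_perm v h (Equiv.swap k l)
  have h2 : v ∘ Equiv.swap k l = v := by
    ext i j
    simp only [Function.comp, Equiv.swap_apply_def]
    split_ifs <;> simp_all
  rw [h2, Equiv.Perm.sign_swap hkl] at h1
  simp only [Units.val_neg, Units.val_one, neg_smul, one_smul] at h1
  have h3 : (2 : ℂ) • rdet v = 0 := by
    rw [two_smul]; nth_rewrite 1 [h1]; simp
  exact (smul_eq_zero.mp h3).resolve_left two_ne_zero

lemma anti_urow {R : Type*} [Ring R] {N : ℕ} (v : Fin N → R) (b : Fin N) : Anti v (urow b) := by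
  intro i j
  simp only [urow]; split_ifs <;> simp

lemma Anti.symm {R : Type*} [Ring R] {N : ℕ} {v w : Fin N → R} (h : Anti v w) : Anti w v := by
  intro i j
  have := h j i
  rw [← neg_eq_zero, ← this]; abel

end XXXModel

namespace XXXModel

/-- difference operators on sequences -/
noncomputable def Yop {𝓜 : Type*} [AddCommGroup 𝓜] [Module ℂ 𝓜] {N : ℕ}
    (X : ℕ → (Fin N → Fin N → (Module.End ℂ 𝓜))) (a b : Fin N) :
    Module.End ℂ (ℕ → 𝓜) where
  toFun f n := (if a = b then f n else 0) - (match n with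
    | 0 => 0
    | n + 1 => X (n + 1) a b (f n))
  map_add' f g := by
    ext n
    cases n <;> by_cases h : a = b <;> simp [h] <;> abel
  map_smul' c f := by
    ext n
    cases n <;> by_cases h : a = b <;> simp [h, smul_sub]

section
variable {𝓜 : Type*} [AddCommGroup 𝓜] [Module ℂ 𝓜] {N : ℕ}
  (X : ℕ → (Fin N → Fin N → (Module.End ℂ 𝓜)))

lemma Yop_zero (a b : Fin N) (f : ℕ → 𝓜) : Yop X a b f 0 = if a = b then f 0 else 0 := by
  simp [Yop]

lemma Yop_succ (a b : Fin N) (f : ℕ → 𝓜) (n : ℕ) :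
    Yop X a b f (n + 1) = (if a = b then f (n + 1) else 0) - X (n + 1) a b (f n) := by
  simp [Yop]

/-- quadratic (RTT-type) relation -/
def RM {R : Type*} [Ring R] {N : ℕ} (A B : (Fin N → Fin N → R)) : Prop :=
  ∀ a c i j, A a i * B c j - A a j * B c i + A c i * B a j - A c j * B a i = 0

lemma anti_Yop (h : ∀ n, RM (X (n + 2)) (X (n + 1))) (a c : Fin N) :
    Anti (Yop X a) (Yop X c) := by
  intro i j
  ext f n
  match n with
  | 0 =>
    simp only [LinearMap.sub_apply, LinearMap.add_apply, Module.End.mul_apply, LinearMap.zero_apply,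
      Pi.sub_apply, Pi.add_apply, Pi.zero_apply, Yop_zero]
    split_ifs <;> simp
  | 1 =>
    simp only [LinearMap.sub_apply, LinearMap.add_apply, Module.End.mul_apply, LinearMap.zero_apply,
      Pi.sub_apply, Pi.add_apply, Pi.zero_apply, Yop_succ, Yop_zero, apply_ite, map_zero]
    split_ifs <;> simp <;> abel
  | n + 2 =>
    have hh := congrArg (fun T : Module.End ℂ 𝓜 => T (f n)) (h n a c i j)
    simp only [LinearMap.sub_apply, LinearMap.add_apply, Module.End.mul_apply,
      LinearMap.zero_apply] at hh
    simp only [LinearMap.sub_apply, LinearMap.add_apply, Module.End.mul_apply, LinearMap.zero_apply,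
      Pi.sub_apply, Pi.add_apply, Pi.zero_apply, Yop_succ (n := n + 1), Yop_succ (n := n),
      map_sub]
    refine Eq.trans ?_ hh
    simp only [show n + 2 = n + 1 + 1 from rfl]
    split_ifs <;> (try simp only [map_zero]) <;> abel

/-- index set -/
def AA (N k n : ℕ) : Finset (Fin N → ℕ) :=
  (Finset.Nat.antidiagonalTuple N n).filter fun r => ∀ i : Fin N, k ≤ i → r i = 0

lemma mem_AA {k n : ℕ} {r : Fin N → ℕ} :
    r ∈ AA N k n ↔ ∑ i, r i = n ∧ ∀ i : Fin N, k ≤ i → r i = 0 := by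
  simp [AA, Finset.Nat.mem_antidiagonalTuple]

lemma sum_single_add (r : Fin N → ℕ) (b : Fin N) :
    ∑ i, (r + Pi.single b 1 : Fin N → ℕ) i = ∑ i, r i + 1 := by
  simp [Finset.sum_add_distrib]

lemma single_le_of_ne {r : Fin N → ℕ} {b : Fin N} (h : r b ≠ 0) : Pi.single b 1 ≤ r := by
  intro i
  by_cases hi : i = b
  · subst hi; simp; omega
  · simp [hi]

lemma sum_shift {k n : ℕ} (b : Fin N) (hb : (b : ℕ) < k) (g : (Fin N → ℕ) → 𝓜) :
    ∑ s ∈ AA N k n, g (s + Pi.single b 1) = ∑ r ∈ (AA N k (n + 1)).filter (fun r => r b ≠ 0), g r := by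
  refine Finset.sum_nbij' (fun s => s + Pi.single b 1) (fun r => r - Pi.single b 1) ?_ ?_ ?_ ?_ ?_
  · intro s hs
    rw [mem_AA] at hs
    rw [Finset.mem_filter, mem_AA, sum_single_add, hs.1]
    refine ⟨⟨rfl, fun i hi => ?_⟩, by simp⟩
    have : i ≠ b := by rintro rfl; omega
    simp [this, hs.2 i hi]
  · intro r hr
    rw [Finset.mem_filter, mem_AA] at hr
    obtain ⟨⟨h1, h2⟩, h3⟩ := hr
    have := tsub_add_cancel_of_le (single_le_of_ne h3)
    rw [mem_AA]
    constructor
    · have h4 := sum_single_add (r - Pi.single b 1) b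
      rw [this, h1] at h4
      omega
    · intro i hi
      simp [h2 i hi]
  · intro s _; simp
  · intro r hr
    rw [Finset.mem_filter] at hr
    exact tsub_add_cancel_of_le (single_le_of_ne hr.2)
  · intro s _; rfl

/-- columns relation -/
def Col (K : (Fin N → ℕ) → (Fin N → ℕ) → 𝓜) : Prop :=
  ∀ r' r c, K r' (r + Pi.single c 1) =
    ∑ a, if r' a = 0 then 0 else X (∑ i, r i + 1) a c (K (r' - Pi.single a 1) r)

noncomputable def vk (k : ℕ) : Fin N → Fin N → Module.End ℂ (ℕ → 𝓜) :=
  fun i => if (i : ℕ) < k then Yop X i else urow i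

lemma anti_self_urow (b c : Fin N) {R : Type*} [Ring R] :
    Anti (urow b : Fin N → R) (urow c) := anti_urow _ _

lemma anti_vk (h : ∀ n, RM (X (n + 2)) (X (n + 1))) (k : ℕ) (i j : Fin N) :
    Anti (vk X k i) (vk X k j) := by
  unfold vk
  split_ifs
  · exact anti_Yop X h _ _
  · exact anti_urow _ _
  · exact (anti_urow _ _).symm
  · exact anti_urow _ _

lemma rdet_urow {R : Type*} [Ring R] : rdet (fun i : Fin N => (urow i : Fin N → R)) = 1 := by
  unfold rdet
  rw [Finset.sum_eq_single 1]
  · have : (List.ofFn fun i : Fin N => (urow i ((1 : Equiv.Perm (Fin N)) i) : R)).prod = 1 := by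
      apply List.prod_eq_one
      intro x hx
      rw [List.mem_ofFn] at hx
      obtain ⟨i, rfl⟩ := hx
      simp [urow]
    rw [this]; simp
  · intro σ _ hσ
    have : ∃ i, σ i ≠ i := by
      by_contra hc; push Not at hc
      exact hσ (Equiv.ext hc)
    obtain ⟨i, hi⟩ := this
    rw [List.prod_eq_zero]
    · simp
    · rw [List.mem_ofFn]
      exact ⟨i, by simp [urow, hi.symm]⟩
  · simp

lemma anti_update {k : Fin N} {v : Fin N → Fin N → Module.End ℂ (ℕ → 𝓜)}
    (hv : ∀ i j, Anti (v i) (v j)) (w : Fin N → Module.End ℂ (ℕ → 𝓜)) (hw : Anti w w)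
    (hvw : ∀ i, Anti (v i) w) (i j : Fin N) :
    Anti (Function.update v k w i) (Function.update v k w j) := by
  by_cases hi : i = k
  · subst hi
    by_cases hj : j = i
    · subst hj; simpa using hw
    · simpa [hj] using (hvw j).symm
  · by_cases hj : j = k
    · subst hj; simpa [hi] using hvw i
    · simpa [hi, hj] using hv i j

lemma macmahon_step (h : ∀ n, RM (X (n + 2)) (X (n + 1)))
    (K : (Fin N → ℕ) → (Fin N → ℕ) → 𝓜) (hK : Col X K) (k : ℕ) (hk : k < N) :
    rdet (vk X (k + 1)) (fun n => ∑ r ∈ AA N (k + 1) n, K r r) =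
      rdet (vk X k) (fun n => ∑ r ∈ AA N k n, K r r) := by
  set κ : Fin N := ⟨k, hk⟩ with hκ
  let Vf : Fin N → ℕ → 𝓜 := fun a n => ∑ r ∈ AA N (k + 1) n,
    if (r + Pi.single κ 1 : Fin N → ℕ) a = 0 then 0 else K (r + Pi.single κ 1 - Pi.single a 1) r
  have e1 : ∀ w, Function.update (vk X (k + 1)) κ w = Function.update (vk X k) κ w := by
    intro w; ext1 i
    by_cases hi : i = κ
    · subst hi; simp
    · have : (i : ℕ) ≠ k := fun hh => hi (Fin.ext hh)
      simp only [Function.update_of_ne hi, vk]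
      have : ((i : ℕ) < k + 1) = ((i : ℕ) < k) := by apply propext; omega
      simp only [this]
  have hexp : ∀ w, rdet (Function.update (vk X k) κ w)
      = ∑ b, rdet (Function.update (vk X k) κ (urow b)) * w b := by
    intro w
    apply rdet_expand
    intro i hi
    have : ¬ ((i : ℕ) < k) := by have : k < (i : ℕ) := hi; omega
    simp [vk, this]
  have hY1 : rdet (Function.update (vk X k) κ (Yop X κ)) = rdet (vk X (k + 1)) := by
    rw [← e1]; congr 1
    apply Function.update_eq_self_iff.mpr
    simp [vk, hκ]
  have hU1 : rdet (Function.update (vk X k) κ (urow κ)) = rdet (vk X k) := by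
    congr 1
    apply Function.update_eq_self_iff.mpr
    simp [vk, hκ]
  have hYY : ∀ a : Fin N, (a : ℕ) < k → rdet (Function.update (vk X k) κ (Yop X a)) = 0 := by
    intro a ha
    have hne : a ≠ κ := by intro hh; rw [hh] at ha; simp [hκ] at ha
    refine rdet_eq_zero _ (anti_update (anti_vk X h k) _ (anti_Yop X h _ _) ?_) hne ?_
    · intro i; unfold vk; split_ifs
      · exact anti_Yop X h _ _
      · exact (anti_urow _ _).symm
    · simp [hne, vk, ha]
  have hUU : ∀ b : Fin N, k < (b : ℕ) → rdet (Function.update (vk X k) κ (urow b)) = 0 := by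
    intro b hb
    have hne : b ≠ κ := by intro hh; rw [hh] at hb; simp [hκ] at hb
    refine rdet_eq_zero _ (anti_update (anti_vk X h k) _ (anti_urow _ _) ?_) hne ?_
    · intro i; exact anti_urow _ _
    · have : ¬ ((b : ℕ) < k) := by omega
      simp [hne, vk, this]
  have hVκ : Vf κ = fun n => ∑ r ∈ AA N (k + 1) n, K r r := by
    ext n
    refine Finset.sum_congr rfl fun r _ => ?_
    simp
  have hVbig : ∀ a : Fin N, k < (a : ℕ) → Vf a = 0 := by
    intro a ha
    ext n
    refine Finset.sum_eq_zero fun r hr => ?_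
    rw [mem_AA] at hr
    have hne : a ≠ κ := by intro hh; rw [hh] at ha; simp [hκ] at ha
    simp [hne, hr.2 a ha]
  have hsum : ∀ b, (∑ a, Yop X a b (Vf a)) 0 = Vf b 0 := by
    intro b
    simp only [Finset.sum_apply, Yop_zero]
    simp
  have hsum2 : ∀ b n, (∑ a, Yop X a b (Vf a)) (n + 1) = Vf b (n + 1) -
      ∑ r ∈ AA N (k + 1) n, K (r + Pi.single κ 1) (r + Pi.single b 1) := by
    intro b n
    simp only [Finset.sum_apply, Yop_succ, Finset.sum_sub_distrib]
    congr 1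
    · simp
    · simp only [Vf, map_sum]
      rw [Finset.sum_comm]
      refine Finset.sum_congr rfl fun r hr => ?_
      rw [mem_AA] at hr
      rw [hK, hr.1]
      refine Finset.sum_congr rfl fun a _ => ?_
      split_ifs <;> simp
  have hW : ∀ b : Fin N, (b : ℕ) ≤ k → ∀ n,
      ∑ r ∈ AA N (k + 1) n, K (r + Pi.single κ 1) (r + Pi.single b 1) =
      ∑ r ∈ AA N (k + 1) (n + 1), if r b = 0 then 0 else
        K (r + Pi.single κ 1 - Pi.single b 1) r := by
    intro b hb n
    have := sum_shift (N := N) (k := k + 1) (n := n) b (by omega)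
      (fun r => K (r - Pi.single b 1 + Pi.single κ 1) r)
    simp only [add_tsub_cancel_right] at this
    rw [this, Finset.sum_filter]
    refine Finset.sum_congr rfl fun r _ => ?_
    by_cases hr : r b = 0
    · simp [hr]
    · simp only [hr, if_false, ne_eq, not_false_eq_true, if_true]
      rw [tsub_add_eq_add_tsub (single_le_of_ne hr)]
  have hlt : ∀ b : Fin N, (b : ℕ) < k → ∑ a, Yop X a b (Vf a) = 0 := by
    intro b hb
    have hne : b ≠ κ := by intro hh; rw [hh] at hb; simp [hκ] at hb
    ext n
    cases n with
    | zero =>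
      rw [hsum]
      refine Finset.sum_eq_zero fun r hr => ?_
      rw [mem_AA] at hr
      have : r b = 0 := by
        have := hr.1
        rw [Finset.sum_eq_zero_iff] at this
        exact this b (Finset.mem_univ _)
      simp [hne, this]
    | succ n =>
      rw [hsum2, hW b hb.le, Pi.zero_apply, sub_eq_zero]
      refine Finset.sum_congr rfl fun r _ => ?_
      simp [hne]
  have heq : ∑ a, Yop X a κ (Vf a) = fun n => ∑ r ∈ AA N k n, K r r := by
    have hA : ∀ n, AA N k n = (AA N (k + 1) n).filter (fun r => r κ = 0) := by
      intro n; ext r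
      rw [Finset.mem_filter, mem_AA, mem_AA]
      constructor
      · rintro ⟨h1, h2⟩
        exact ⟨⟨h1, fun i hi => h2 i (by omega)⟩, h2 κ le_rfl⟩
      · rintro ⟨⟨h1, h2⟩, h3⟩
        refine ⟨h1, fun i hi => ?_⟩
        by_cases hik : (i : ℕ) = k
        · have : i = κ := Fin.ext hik
          rw [this, h3]
        · exact h2 i (by omega)
    ext n
    cases n with
    | zero =>
      rw [hsum, hVκ, hA, Finset.sum_filter]
      refine Finset.sum_congr rfl fun r hr => ?_
      rw [mem_AA] at hr
      have : r κ = 0 := by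
        have := hr.1
        rw [Finset.sum_eq_zero_iff] at this
        exact this κ (Finset.mem_univ _)
      simp [this]
    | succ n =>
      rw [hsum2, hW κ le_rfl, hVκ, hA, Finset.sum_filter, ← Finset.sum_sub_distrib]
      refine Finset.sum_congr rfl fun r hr => ?_
      split_ifs <;> simp
  have main : ∑ a, rdet (Function.update (vk X k) κ (Yop X a)) (Vf a)
      = ∑ b, rdet (Function.update (vk X k) κ (urow b)) (∑ a, Yop X a b (Vf a)) := by
    simp only [hexp (Yop X _), LinearMap.sum_apply, map_sum, Module.End.mul_apply]
    exact Finset.sum_comm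
  rw [Finset.sum_eq_single κ, Finset.sum_eq_single κ, hY1, hU1, heq, hVκ] at main
  · exact main
  · intro b _ hb
    rcases lt_or_gt_of_ne (fun hh => hb (Fin.ext hh) : (b : ℕ) ≠ k) with hh | hh
    · rw [hlt b hh, map_zero]
    · rw [hUU b hh]; rfl
  · simp
  · intro a _ ha
    rcases lt_or_gt_of_ne (fun hh => ha (Fin.ext hh) : (a : ℕ) ≠ k) with hh | hh
    · rw [hYY a hh]; rfl
    · rw [hVbig a hh, map_zero]
  · simp

theorem macmahon (h : ∀ n, RM (X (n + 2)) (X (n + 1)))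
    (K : (Fin N → ℕ) → (Fin N → ℕ) → 𝓜) (hK : Col X K) :
    rdet (Yop X) (fun n => ∑ r ∈ Finset.Nat.antidiagonalTuple N n, K r r)
      = Pi.single 0 (K 0 0) := by
  have key : ∀ k, k ≤ N → rdet (vk X k) (fun n => ∑ r ∈ AA N k n, K r r)
      = Pi.single 0 (K 0 0) := by
    intro k
    induction k with
    | zero =>
      intro _
      have : vk X 0 = fun i => urow i := by ext1 i; simp [vk]
      rw [this, rdet_urow, Module.End.one_apply]
      ext n
      by_cases hn : n = 0
      · subst hn
        have : AA N 0 0 = {0} := by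
          ext r; rw [mem_AA, Finset.mem_singleton]
          constructor
          · rintro ⟨_, h⟩; ext i; exact h i (Nat.zero_le _)
          · rintro rfl; simp
        rw [this]; simp
      · rw [Pi.single_eq_of_ne hn]
        refine Finset.sum_eq_zero fun r hr => ?_
        rw [mem_AA] at hr
        exfalso; apply hn; rw [← hr.1]
        exact Finset.sum_eq_zero fun i _ => hr.2 i (Nat.zero_le _)
    | succ k ih =>
      intro hk
      rw [macmahon_step X h K hK k (by omega), ih (by omega)]
  have h1 : vk X N = Yop X := by ext1 i; simp [vk]
  have h2 : ∀ n, AA N N n = Finset.Nat.antidiagonalTuple N n := by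
    intro n; ext r
    rw [mem_AA, Finset.Nat.mem_antidiagonalTuple]
    constructor
    · exact fun h => h.1
    · intro h; exact ⟨h, fun i hi => by have := i.2; omega⟩
  have := key N le_rfl
  simp only [h1, h2] at this
  exact this
end

end XXXModel

namespace XXXModel

noncomputable def mmul {R : Type*} [Ring R] {N : ℕ} (A B : Fin N → Fin N → R) : Fin N → Fin N → R :=
  fun a b => ∑ c, A a c * B c b

lemma RM_mul {R : Type*} [Ring R] [Algebra ℂ R] {N : ℕ} {A1 A2 B1 B2 : Fin N → Fin N → R}
    (h1 : RM A1 B1) (h2 : RM A2 B2) (hc : ∀ a b c d, Commute (A2 a b) (B1 c d)) :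
    RM (mmul A1 A2) (mmul B1 B2) := by
  intro a c i j
  have e : ∀ a c i j, mmul A1 A2 a i * mmul B1 B2 c j =
      ∑ p, ∑ q, (A1 a p * B1 c q) * (A2 p i * B2 q j) := by
    intro a c i j
    simp only [mmul, Finset.sum_mul, Finset.mul_sum]
    rw [Finset.sum_comm]
    refine Finset.sum_congr rfl fun p _ => Finset.sum_congr rfl fun q _ => ?_
    have := (hc p i c q).eq
    rw [mul_assoc, ← mul_assoc (A2 p i), this]
    simp only [mul_assoc]
  simp only [e, ← Finset.sum_sub_distrib, ← Finset.sum_add_distrib]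
  set f : Fin N → Fin N → R := fun p q => (A1 a p * B1 c q + A1 c p * B1 a q) *
    (A2 p i * B2 q j - A2 p j * B2 q i) with hf
  have e1 : ∀ p q, A1 a p * B1 c q * (A2 p i * B2 q j) - A1 a p * B1 c q * (A2 p j * B2 q i) +
      A1 c p * B1 a q * (A2 p i * B2 q j) - A1 c p * B1 a q * (A2 p j * B2 q i) = f p q := by
    intro p q; simp only [hf]; noncomm_ring
  simp only [e1]
  have e2 : ∀ p q, f p q = - f q p := by
    intro p q
    have a1 : A1 a p * B1 c q + A1 c p * B1 a q = A1 a q * B1 c p + A1 c q * B1 a p := by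
      have := h1 a c p q
      rw [← sub_eq_zero, ← this]; abel
    have a2 : A2 p i * B2 q j - A2 p j * B2 q i = -(A2 q i * B2 p j - A2 q j * B2 p i) := by
      have := h2 p q i j
      rw [← sub_eq_zero, ← this]; abel
    simp only [hf]
    rw [a1, a2, mul_neg]
  have e3 : ∑ p, ∑ q, f p q = - ∑ p, ∑ q, f p q := by
    conv_lhs => rw [Finset.sum_comm]
    rw [← Finset.sum_neg_distrib]
    refine Finset.sum_congr rfl fun p _ => ?_
    rw [← Finset.sum_neg_distrib]
    exact Finset.sum_congr rfl fun q _ => e2 _ _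
  have h3 : (2 : ℂ) • ∑ p, ∑ q, f p q = 0 := by
    rw [two_smul]; nth_rewrite 1 [e3]; simp
  exact (smul_eq_zero.mp h3).resolve_left two_ne_zero

/-- A site: matrix units together with an evaluation parameter. -/
abbrev Site (N : ℕ) (R : Type*) := (Fin N → Fin N → R) × ℂ

section
variable {R : Type*} [Ring R] [Algebra ℂ R] {N : ℕ}

noncomputable def Lsite (s : Site N R) (u : ℂ) : Fin N → Fin N → R :=
  fun a b => (if a = b then 1 else 0) + (u - s.2)⁻¹ • s.1 b a

def MU (s : Site N R) : Prop := ∀ a b c d, s.1 a b * s.1 c d = if b = c then s.1 a d else 0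

def SComm (s t : Site N R) : Prop := ∀ a b c d, Commute (s.1 a b) (t.1 c d)

lemma RM_site (s : Site N R) (hs : MU s) (u : ℂ) (h1 : u - s.2 ≠ 0) (h2 : u - 1 - s.2 ≠ 0) :
    RM (Lsite s u) (Lsite s (u - 1)) := by
  intro a c i j
  have hk : (u - s.2)⁻¹ - (u - 1 - s.2)⁻¹ + (u - s.2)⁻¹ * (u - 1 - s.2)⁻¹ = 0 := by
    field_simp; ring
  set α := (u - s.2)⁻¹ with hα
  set β := (u - 1 - s.2)⁻¹ with hβ
  have hs2 : ∀ a b c d (x y : ℂ), (x • s.1 a b) * (y • s.1 c d) =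
      if b = c then (x * y) • s.1 a d else 0 := by
    intro a b c d x y
    rw [smul_mul_smul_comm, hs]; split_ifs <;> simp
  have e : (α - β + α * β) • ((if a = j then s.1 i c else 0) - (if a = i then s.1 j c else 0)
      + (if c = j then s.1 i a else 0) - (if c = i then s.1 j a else 0)) = 0 := by
    rw [hk, zero_smul]
  rw [← e]
  simp only [Lsite, ← hα, ← hβ, add_mul, mul_add, hs2]
  split_ifs <;>
    simp only [one_mul, mul_one, zero_mul, mul_zero, add_zero,
      zero_add, smul_zero, sub_zero] <;> 
    simp only [smul_add, smul_sub, add_smul, sub_smul, smul_zero, add_zero, zero_add, sub_zero] <;> 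
    abel

noncomputable def XL (Q : Fin N → Fin N → ℂ) (u : ℂ) : List (Site N R) → Fin N → Fin N → R
  | [] => fun a b => algebraMap ℂ R (Q a b)
  | s :: l => mmul (XL Q u l) (Lsite s u)

lemma commute_Lsite {s : Site N R} {x : R} (h : ∀ a b, Commute x (s.1 a b)) (u : ℂ) (a b) :
    Commute x (Lsite s u a b) := by
  unfold Lsite
  refine Commute.add_right ?_ ((h b a).smul_right _)
  split_ifs
  · exact Commute.one_right _
  · exact Commute.zero_right _

lemma commute_XL (Q : Fin N → Fin N → ℂ) (l : List (Site N R)) (u : ℂ) {x : R}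
    (h : ∀ s ∈ l, ∀ a b, Commute x (s.1 a b)) (a b) :
    Commute x (XL Q u l a b) := by
  induction l generalizing a b with
  | nil => exact (Algebra.commutes _ _).symm
  | cons s l ih =>
    show Commute x (∑ c : Fin N, XL Q u l a c * Lsite s u c b)
    refine Commute.sum_right _ _ _ fun c _ => ?_
    refine Commute.mul_right ?_ ?_
    · exact ih (fun t ht => h t (List.mem_cons_of_mem _ ht)) _ _
    · exact commute_Lsite (fun a b => h s List.mem_cons_self a b) _ _ _

lemma RM_XL (Q : Fin N → Fin N → ℂ) (l : List (Site N R)) (u : ℂ)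
    (hmu : ∀ s ∈ l, MU s) (hc : l.Pairwise SComm)
    (h1 : ∀ s ∈ l, u - s.2 ≠ 0) (h2 : ∀ s ∈ l, u - 1 - s.2 ≠ 0) :
    RM (XL Q u l) (XL Q (u - 1) l) := by
  induction l with
  | nil =>
    intro a c i j
    simp only [XL, ← map_mul, ← map_sub, ← map_add]
    rw [show Q a i * Q c j - Q a j * Q c i + Q c i * Q a j - Q c j * Q a i = 0 by ring, map_zero]
  | cons s l ih =>
    rw [List.pairwise_cons] at hc
    refine RM_mul (ih (fun t ht => hmu t (List.mem_cons_of_mem _ ht)) hc.2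
      (fun t ht => h1 t (List.mem_cons_of_mem _ ht))
      (fun t ht => h2 t (List.mem_cons_of_mem _ ht)))
      (RM_site s (hmu s List.mem_cons_self) u (h1 s List.mem_cons_self) (h2 s List.mem_cons_self)) ?_
    intro a b c d
    refine commute_XL Q l (u - 1) (fun t ht a' b' => ?_) _ _
    refine (commute_Lsite (fun c d => ?_) _ _ _).symm
    exact (hc.1 t ht _ _ _ _).symm

lemma shift_succ {A : Type*} [AddCommGroup A] (g : (Fin N → ℕ) → A) (r : Fin N → ℕ) (a b c : Fin N) :
    ((r + Pi.single c 1 : Fin N → ℕ) b) • g (r + Pi.single c 1 - Pi.single b 1 + Pi.single a 1) =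
      r b • g (r - Pi.single b 1 + Pi.single a 1 + Pi.single c 1) +
        if b = c then g (r + Pi.single a 1) else 0 := by
  have e : r b • g (r + Pi.single c 1 - Pi.single b 1 + Pi.single a 1) =
      r b • g (r - Pi.single b 1 + Pi.single a 1 + Pi.single c 1) := by
    by_cases hr : r b = 0
    · simp [hr]
    · rw [← tsub_add_eq_add_tsub (single_le_of_ne hr), add_right_comm]
  rw [Pi.add_apply, add_smul, e]
  congr 1
  by_cases h : b = c
  · subst h; simp
  · simp [h]

def ColA (X : ℕ → Fin N → Fin N → R) (K : (Fin N → ℕ) → (Fin N → ℕ) → R) : Prop :=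
  ∀ r' r c, K r' (r + Pi.single c 1) =
    ∑ a, if r' a = 0 then 0 else X (∑ i, r i + 1) a c * (K (r' - Pi.single a 1) r)

/-- right action of a site on kernels -/
noncomputable def actK (u0 : ℂ) (s : Site N R) (K : (Fin N → ℕ) → (Fin N → ℕ) → R) :
    (Fin N → ℕ) → (Fin N → ℕ) → R :=
  fun r' r => K r' r + (u0 + 1 - s.2)⁻¹ • ∑ b, ∑ a,
    (r b • K r' (r - Pi.single b 1 + Pi.single a 1)) * s.1 b a

lemma sum_shift_single {r : Fin N → ℕ} {b : Fin N} (h : r b ≠ 0) (a : Fin N) :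
    ∑ i, (r - Pi.single b 1 + Pi.single a 1 : Fin N → ℕ) i = ∑ i, r i := by
  rw [sum_single_add]
  have := sum_single_add (r - Pi.single b 1) b
  rw [tsub_add_cancel_of_le (single_le_of_ne h)] at this
  exact this.symm

lemma sum_ite_mul_aux (r' : Fin N → ℕ) (F : Fin N → Fin N → R) (G : Fin N → R) :
    (∑ d, (∑ a, if r' a = 0 then 0 else F d a) * G d) =
      ∑ a, if r' a = 0 then 0 else ∑ d, F d a * G d := by
  simp only [Finset.sum_mul]
  rw [Finset.sum_comm]
  refine Finset.sum_congr rfl fun a _ => ?_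
  split_ifs <;> simp

lemma sum_ite_aux (r' : Fin N → ℕ) (F : Fin N → Fin N → R) :
    (∑ d, (∑ a, if r' a = 0 then 0 else F d a)) =
      ∑ a, if r' a = 0 then 0 else ∑ d, F d a := by
  rw [Finset.sum_comm]
  refine Finset.sum_congr rfl fun a _ => ?_
  split_ifs <;> simp

lemma colA_act (X : ℕ → Fin N → Fin N → R) (K : (Fin N → ℕ) → (Fin N → ℕ) → R)
    (hK : ColA X K) (u0 : ℂ) (s : Site N R) (hs : MU s)
    (hcK : ∀ r' r a b, Commute (K r' r) (s.1 a b))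
    (hw : ∀ n : ℕ, u0 + 1 - s.2 + n ≠ 0) :
    ColA (fun n => mmul (X n) (Lsite s (u0 + n))) (actK u0 s K) := by
  have hs' : ∀ a b c d, s.1 a b * s.1 c d = if b = c then s.1 a d else 0 := hs
  intro r' r c
  set ρ := ∑ i, r i with hρ
  set w := u0 + 1 - s.2 with hwdef
  have hw0 : w ≠ 0 := by have := hw 0; simpa using this
  have hwr : w + ρ ≠ 0 := hw ρ
  have hu : u0 + ((ρ + 1 : ℕ) : ℂ) - s.2 = w + ρ := by push_cast; rw [hwdef]; ring
  -- LHS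
  have hL : actK u0 s K r' (r + Pi.single c 1) = K r' (r + Pi.single c 1) +
      w⁻¹ • ((∑ b, ∑ a, (r b • K r' (r - Pi.single b 1 + Pi.single a 1 + Pi.single c 1)) * s.1 b a)
        + ∑ a, K r' (r + Pi.single a 1) * s.1 c a) := by
    unfold actK
    rw [← hwdef]
    congr 2
    simp only [shift_succ (fun r => K r' r), add_mul, Finset.sum_add_distrib]
    congr 1
    rw [Finset.sum_comm]
    refine Finset.sum_congr rfl fun a _ => ?_
    simp
  -- one summand of RHS
  have hR : ∀ a, mmul (X (ρ + 1)) (Lsite s (u0 + ((ρ + 1 : ℕ) : ℂ))) a c *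
        actK u0 s K (r' - Pi.single a 1) r =
      X (ρ + 1) a c * K (r' - Pi.single a 1) r
      + (w + ρ)⁻¹ • ∑ d, X (ρ + 1) a d * K (r' - Pi.single a 1) r * s.1 c d
      + w⁻¹ • (∑ q, ∑ p, (r q • (X (ρ + 1) a c *
          K (r' - Pi.single a 1) (r - Pi.single q 1 + Pi.single p 1))) * s.1 q p)
      + (w⁻¹ * (w + ρ)⁻¹) • ∑ q, ∑ p, (r q • (X (ρ + 1) a q *
          K (r' - Pi.single a 1) (r - Pi.single q 1 + Pi.single p 1))) * s.1 c p := by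
    intro a
    have t1 : mmul (X (ρ + 1)) (Lsite s (u0 + ((ρ + 1 : ℕ) : ℂ))) a c =
        X (ρ + 1) a c + (w + ρ)⁻¹ • ∑ d, X (ρ + 1) a d * s.1 c d := by
      simp only [mmul, Lsite, hu, mul_add, Finset.sum_add_distrib, mul_smul_comm, Finset.smul_sum]
      congr 1
      simp
    rw [t1]
    unfold actK
    rw [← hwdef, add_mul, mul_add, mul_add]
    have t2 : ((w + ρ)⁻¹ • ∑ d, X (ρ + 1) a d * s.1 c d) * K (r' - Pi.single a 1) r
        = (w + ρ)⁻¹ • ∑ d, X (ρ + 1) a d * K (r' - Pi.single a 1) r * s.1 c d := by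
      rw [smul_mul_assoc, Finset.sum_mul]
      congr 1
      refine Finset.sum_congr rfl fun d _ => ?_
      rw [mul_assoc, ← (hcK _ _ _ _).eq, mul_assoc]
    have t3 : X (ρ + 1) a c * (w⁻¹ • ∑ b, ∑ p,
        (r b • K (r' - Pi.single a 1) (r - Pi.single b 1 + Pi.single p 1)) * s.1 b p)
        = w⁻¹ • (∑ q, ∑ p, (r q • (X (ρ + 1) a c *
          K (r' - Pi.single a 1) (r - Pi.single q 1 + Pi.single p 1))) * s.1 q p) := by
      rw [mul_smul_comm]
      simp only [Finset.mul_sum]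
      congr 1
      refine Finset.sum_congr rfl fun q _ => Finset.sum_congr rfl fun p _ => ?_
      rw [← mul_assoc, mul_smul_comm]
    have t4 : ((w + ρ)⁻¹ • ∑ d, X (ρ + 1) a d * s.1 c d) * (w⁻¹ • ∑ b, ∑ p,
        (r b • K (r' - Pi.single a 1) (r - Pi.single b 1 + Pi.single p 1)) * s.1 b p)
        = (w⁻¹ * (w + ρ)⁻¹) • ∑ q, ∑ p, (r q • (X (ρ + 1) a q *
          K (r' - Pi.single a 1) (r - Pi.single q 1 + Pi.single p 1))) * s.1 c p := by
      rw [smul_mul_smul_comm, mul_comm (w + ρ)⁻¹]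
      congr 1
      rw [Finset.mul_sum]
      refine Finset.sum_congr rfl fun q _ => ?_
      rw [Finset.mul_sum]
      refine Finset.sum_congr rfl fun p _ => ?_
      rw [Finset.sum_mul, Finset.sum_eq_single q]
      · rw [mul_assoc, ← mul_assoc (s.1 c q), smul_mul_assoc, mul_smul_comm,
          ← (hcK _ _ _ _).eq]
        simp only [smul_mul_assoc, mul_smul_comm, mul_assoc, hs', if_true]
      · intro d _ hd
        rw [mul_assoc, ← mul_assoc (s.1 c d), mul_smul_comm, ← (hcK _ _ _ _).eq]
        simp only [smul_mul_assoc, mul_smul_comm, mul_assoc, hs', hd, if_false, mul_zero, smul_zero]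
      · simp
    rw [t2, t3, t4]; abel
  have hKK : ∀ r d, K r' (r + Pi.single d 1) = ∑ a, if r' a = 0 then 0 else
      X (∑ i, r i + 1) a d * (K (r' - Pi.single a 1) r) := hK r'
  rw [hL]
  simp only [hR]
  -- split sums
  have s0 : (∑ a, if r' a = 0 then 0 else
      (X (ρ + 1) a c * K (r' - Pi.single a 1) r
      + (w + ρ)⁻¹ • ∑ d, X (ρ + 1) a d * K (r' - Pi.single a 1) r * s.1 c d
      + w⁻¹ • (∑ q, ∑ p, (r q • (X (ρ + 1) a c *
          K (r' - Pi.single a 1) (r - Pi.single q 1 + Pi.single p 1))) * s.1 q p)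
      + (w⁻¹ * (w + ρ)⁻¹) • ∑ q, ∑ p, (r q • (X (ρ + 1) a q *
          K (r' - Pi.single a 1) (r - Pi.single q 1 + Pi.single p 1))) * s.1 c p)) =
      K r' (r + Pi.single c 1) + (w + ρ)⁻¹ • (∑ d, K r' (r + Pi.single d 1) * s.1 c d)
      + w⁻¹ • (∑ b, ∑ a, (r b • K r' (r - Pi.single b 1 + Pi.single a 1 + Pi.single c 1)) * s.1 b a)
      + (w⁻¹ * (w + ρ)⁻¹) • ∑ q, ∑ p, (r q • K r' (r + Pi.single p 1)) * s.1 c p := by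
    have ex : ∀ q p d, r q • K r' (r - Pi.single q 1 + Pi.single p 1 + Pi.single d 1) =
        ∑ a, if r' a = 0 then 0 else r q • (X (ρ + 1) a d *
          K (r' - Pi.single a 1) (r - Pi.single q 1 + Pi.single p 1)) := by
      intro q p d
      by_cases hq : r q = 0
      · simp [hq]
      · rw [hKK, sum_shift_single hq, Finset.smul_sum]
        refine Finset.sum_congr rfl fun a _ => ?_
        split_ifs <;> simp [hρ]
    have ex2 : ∀ q p, r q • K r' (r + Pi.single p 1) =
        ∑ a, if r' a = 0 then 0 else r q • (X (ρ + 1) a q *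
          K (r' - Pi.single a 1) (r - Pi.single q 1 + Pi.single p 1)) := by
      intro q p
      rw [← ex]
      by_cases hq : r q = 0
      · simp [hq]
      · rw [add_right_comm, tsub_add_cancel_of_le (single_le_of_ne hq)]
    simp only [ex, ex2]
    simp only [hKK, ← hρ]
    simp only [sum_ite_mul_aux, sum_ite_aux]
    simp only [Finset.smul_sum, ← Finset.sum_add_distrib]
    refine Finset.sum_congr rfl fun a _ => ?_
    split_ifs
    · simp
    · simp only [Finset.smul_sum]
  rw [s0]
  have s1 : ∑ q, ∑ p, (r q • K r' (r + Pi.single p 1)) * s.1 c p =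
      (ρ : ℂ) • ∑ d, K r' (r + Pi.single d 1) * s.1 c d := by
    rw [Finset.sum_comm, Finset.smul_sum]
    refine Finset.sum_congr rfl fun p _ => ?_
    rw [← Finset.sum_mul, ← Finset.sum_smul, ← hρ, smul_mul_assoc, Nat.cast_smul_eq_nsmul]
  rw [s1, smul_smul, smul_add]
  have s2 : w⁻¹ = (w + ρ)⁻¹ + w⁻¹ * (w + ρ)⁻¹ * ρ := by field_simp
  have s3 : w⁻¹ • ∑ a, K r' (r + Pi.single a 1) * s.1 c a =
    (w + ρ)⁻¹ • (∑ d, K r' (r + Pi.single d 1) * s.1 c d) +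
    (w⁻¹ * (w + ρ)⁻¹ * ρ) • (∑ d, K r' (r + Pi.single d 1) * s.1 c d) := by
    rw [← add_smul, ← s2]
  rw [s3]; abel

noncomputable def KL (K0 : (Fin N → ℕ) → (Fin N → ℕ) → ℂ) (u0 : ℂ) :
    List (Site N R) → (Fin N → ℕ) → (Fin N → ℕ) → R
  | [] => fun r' r => algebraMap ℂ R (K0 r' r)
  | s :: l => actK u0 s (KL K0 u0 l)

lemma commute_KL (K0 : (Fin N → ℕ) → (Fin N → ℕ) → ℂ) (u0 : ℂ) (l : List (Site N R)) {x : R}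
    (h : ∀ s ∈ l, ∀ a b, Commute x (s.1 a b)) (r' r) :
    Commute x (KL K0 u0 l r' r) := by
  induction l generalizing r' r with
  | nil => exact (Algebra.commutes _ _).symm
  | cons s l ih =>
    have ih' := ih (fun t ht => h t (List.mem_cons_of_mem _ ht))
    refine Commute.add_right (ih' _ _) (Commute.smul_right ?_ _)
    refine Commute.sum_right _ _ _ fun b _ => Commute.sum_right _ _ _ fun a _ => 
      Commute.mul_right ?_ (h s List.mem_cons_self _ _)
    exact (ih' _ _).smul_right _

lemma colA_KL (Q : Fin N → Fin N → ℂ) (K0 : (Fin N → ℕ) → (Fin N → ℕ) → ℂ)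
    (hK0 : ColA (fun _ => Q) K0) (u0 : ℂ) (l : List (Site N R))
    (hmu : ∀ s ∈ l, MU s) (hc : l.Pairwise SComm)
    (hw : ∀ s ∈ l, ∀ n : ℕ, u0 + 1 - s.2 + n ≠ 0) :
    ColA (fun n => XL Q (u0 + n) l) (KL K0 u0 l) := by
  induction l with
  | nil =>
    intro r' r c
    simp only [KL, XL, hK0 r' r c, map_sum, apply_ite (algebraMap ℂ R), map_zero, map_mul]
  | cons s l ih =>
    rw [List.pairwise_cons] at hc
    refine colA_act _ _ (ih (fun t ht => hmu t (List.mem_cons_of_mem _ ht)) hc.2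
      (fun t ht => hw t (List.mem_cons_of_mem _ ht))) u0 s (hmu s List.mem_cons_self) ?_
      (hw s List.mem_cons_self)
    intro r' r a b
    exact (commute_KL K0 u0 l (fun t ht c d => hc.1 t ht _ _ _ _) _ _).symm

lemma KL_zero (K0 : (Fin N → ℕ) → (Fin N → ℕ) → ℂ) (u0 : ℂ) (l : List (Site N R)) :
    KL K0 u0 l 0 0 = algebraMap ℂ R (K0 0 0) := by
  induction l with
  | nil => rfl
  | cons s l ih => simp [KL, actK, ih]

end
end XXXModel

namespace XXXModel
open Polynomial

/-- forward shift of sequences -/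
def Sh (A W : Type*) [CommRing A] [AddCommGroup W] [Module A W] : Module.End A (ℕ → W) where
  toFun f n := f (n + 1)
  map_add' _ _ := rfl
  map_smul' _ _ := rfl

section
variable {A W : Type*} [CommRing A] [AddCommGroup W] [Module A W]

lemma Sh_apply (f : ℕ → W) (n : ℕ) : Sh A W f n = f (n + 1) := rfl

lemma Sh_pow_apply (i : ℕ) (f : ℕ → W) (n : ℕ) : (Sh A W ^ i) f n = f (n + i) := by
  induction i generalizing n with
  | zero => simp
  | succ i ih => rw [pow_succ', Module.End.mul_apply, Sh_apply, ih]; congr 1; omega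

lemma aeval_Sh_apply (p : A[X]) (f : ℕ → W) (n : ℕ) :
    aeval (Sh A W) p f n = ∑ i ∈ Finset.range (p.natDegree + 1), p.coeff i • f (n + i) := by
  rw [aeval_eq_sum_range]
  simp [LinearMap.sum_apply, Finset.sum_apply, Sh_pow_apply]

lemma aeval_Sh_apply' (p : A[X]) (f : ℕ → W) (n : ℕ) {d : ℕ} (hd : p.natDegree < d) :
    aeval (Sh A W) p f n = ∑ i ∈ Finset.range d, p.coeff i • f (n + i) := by
  rw [aeval_eq_sum_range' hd]
  simp [LinearMap.sum_apply, Finset.sum_apply, Sh_pow_apply]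

def Rec (χ : A[X]) (f : ℕ → W) : Prop := ∃ k : ℕ, aeval (Sh A W) (χ ^ k) f = 0

lemma Rec.mono {χ : A[X]} {f : ℕ → W} {k l : ℕ} (h : aeval (Sh A W) (χ ^ k) f = 0) (hl : k ≤ l) :
    aeval (Sh A W) (χ ^ l) f = 0 := by
  obtain ⟨m, rfl⟩ := Nat.exists_eq_add_of_le' hl
  rw [pow_add, map_mul, Module.End.mul_apply, h, map_zero]

lemma Rec.add {χ : A[X]} {f g : ℕ → W} (hf : Rec χ f) (hg : Rec χ g) : Rec χ (f + g) := by
  obtain ⟨k, hk⟩ := hf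
  obtain ⟨l, hl⟩ := hg
  refine ⟨max k l, ?_⟩
  rw [map_add, Rec.mono hk (le_max_left _ _), Rec.mono hl (le_max_right _ _), add_zero]

lemma Rec.zero {χ : A[X]} : Rec χ (0 : ℕ → W) := ⟨0, by simp⟩

lemma Rec.smul {χ : A[X]} {f : ℕ → W} (hf : Rec χ f) (c : A) : Rec χ (c • f) := by
  obtain ⟨k, hk⟩ := hf
  exact ⟨k, by rw [map_smul, hk, smul_zero]⟩

end

lemma Rec.deriv {A : Type*} [CommRing A] [Algebra ℂ A] (D : Derivation ℂ A A) {χ : A[X]} {f : ℕ → A}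
    (hf : Rec χ f) : Rec χ (fun n => D (f n)) := by
  obtain ⟨k, hk⟩ := hf
  set p := χ ^ k with hp
  set d := p.natDegree + 1 with hd
  let p' : A[X] := ∑ i ∈ Finset.range d, monomial i (D (p.coeff i))
  have hp'd : p'.natDegree < d := by
    have : p'.natDegree ≤ p.natDegree := by
      apply natDegree_sum_le_of_forall_le
      intro i hi
      refine (natDegree_monomial_le _).trans ?_
      rw [Finset.mem_range] at hi; omega
    omega
  have hc : ∀ i ∈ Finset.range d, p'.coeff i = D (p.coeff i) := by
    intro i hi
    simp only [p', finsetSum_coeff, coeff_monomial]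
    rw [Finset.sum_ite_eq' ]
    simp only [hi, if_true]
  have key : aeval (Sh A A) p' f + aeval (Sh A A) p (fun n => D (f n)) = 0 := by
    ext n
    have h1 := congrArg D (congrFun hk n)
    rw [aeval_Sh_apply] at h1
    simp only [Pi.zero_apply, map_zero, map_sum, smul_eq_mul, Derivation.leibniz] at h1
    rw [Pi.add_apply, aeval_Sh_apply' p' f n hp'd, aeval_Sh_apply, ← Finset.sum_add_distrib,
      Pi.zero_apply, ← h1]
    refine Finset.sum_congr rfl fun i hi => ?_
    rw [hc i hi, smul_eq_mul, smul_eq_mul]; ring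
  refine ⟨k + k, ?_⟩
  rw [pow_add, ← hp, map_mul, Module.End.mul_apply, eq_neg_of_add_eq_zero_right key, map_neg,
    ← Module.End.mul_apply, ← map_mul, mul_comm, map_mul, Module.End.mul_apply, hk, map_zero, neg_zero]

lemma Rec.map {A B : Type*} [CommRing A] [CommRing B] (φ : A →+* B) {χ : A[X]} {f : ℕ → A}
    (hf : Rec χ f) : Rec (χ.map φ) (fun n => φ (f n)) := by
  obtain ⟨k, hk⟩ := hf
  refine ⟨k, ?_⟩
  ext n
  have h1 := congrArg φ (congrFun hk n)
  rw [aeval_Sh_apply] at h1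
  rw [← Polynomial.map_pow, aeval_Sh_apply' _ _ _ (Nat.lt_succ_of_le natDegree_map_le)]
  simpa only [map_sum, coeff_map, smul_eq_mul, map_mul, Pi.zero_apply, map_zero] using h1

lemma Rec.smul_const {W : Type*} [AddCommGroup W] [Module ℂ W] {χ : ℂ[X]} {f : ℕ → ℂ}
    (hf : Rec χ f) (x : W) : Rec χ (fun n => f n • x) := by
  obtain ⟨k, hk⟩ := hf
  refine ⟨k, ?_⟩
  ext n
  have h1 := congrArg (fun c : ℂ => c • x) (congrFun hk n)
  simp only [aeval_Sh_apply, Finset.sum_smul] at h1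
  rw [aeval_Sh_apply]
  simpa [smul_smul] using h1

lemma Rec.linmap {W W' : Type*} [AddCommGroup W] [Module ℂ W] [AddCommGroup W'] [Module ℂ W']
    {χ : ℂ[X]} {f : ℕ → W}
    (hf : Rec χ f) (x : W →ₗ[ℂ] W') : Rec χ (fun n => x (f n)) := by
  obtain ⟨k, hk⟩ := hf
  refine ⟨k, ?_⟩
  ext n
  have h1 := congrArg x (congrFun hk n)
  simp only [aeval_Sh_apply, map_sum, map_smul] at h1
  rw [aeval_Sh_apply]
  simpa using h1

section
variable (N : ℕ)

abbrev PP := MvPolynomial (Fin N × Fin N) ℂ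

variable {N}

noncomputable def gam (r' r : Fin N → ℕ) : PP N :=
  MvPolynomial.coeff (Finsupp.equivFunOnFinite.symm r')
    (∏ b, (∑ a, MvPolynomial.C (MvPolynomial.X (a, b) : PP N) *
      (MvPolynomial.X a : MvPolynomial (Fin N) (PP N))) ^ (r b))

lemma gam_zero (r' : Fin N → ℕ) : gam r' 0 = if r' = 0 then 1 else 0 := by
  unfold gam
  simp only [Pi.zero_apply, pow_zero, Finset.prod_const_one, MvPolynomial.coeff_one]
  by_cases h : r' = 0
  · subst h
    rw [if_pos rfl, if_pos]
    ext i; rfl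
  · rw [if_neg h, if_neg]
    intro hh; apply h
    have := congrArg (fun t : Fin N →₀ ℕ => (t : Fin N → ℕ)) hh
    simpa using this.symm

lemma gam_col (r' r : Fin N → ℕ) (c : Fin N) : gam r' (r + Pi.single c 1) =
    ∑ a, if r' a = 0 then 0 else (MvPolynomial.X (a, c)) * gam (r' - Pi.single a 1) r := by
  unfold gam
  have h1 : ∀ F : Fin N → MvPolynomial (Fin N) (PP N),
      ∏ b, F b ^ ((r + Pi.single c 1 : Fin N → ℕ) b) = (∏ b, F b ^ (r b)) * F c := by
    intro F
    simp only [Pi.add_apply, pow_add, Finset.prod_mul_distrib]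
    congr 1
    rw [Finset.prod_eq_single c]
    · simp
    · intro b _ hb; simp [hb]
    · simp
  rw [h1, Finset.mul_sum, MvPolynomial.coeff_sum]
  refine Finset.sum_congr rfl fun a _ => ?_
  rw [← mul_assoc, MvPolynomial.coeff_mul_X']
  have hm : (a ∈ (Finsupp.equivFunOnFinite.symm r').support) ↔ ¬ (r' a = 0) := by simp
  by_cases h : r' a = 0
  · rw [if_neg (by rw [hm]; simpa using h), if_pos h]
  · rw [if_pos (hm.mpr h), if_neg h, mul_comm _ (MvPolynomial.C _), MvPolynomial.coeff_C_mul]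
    congr 2
    ext i
    by_cases hi : i = a
    · subst hi; simp
    · simp [hi, Finsupp.single_apply, Ne.symm hi]

noncomputable def der (a b : Fin N) : Derivation ℂ (PP N) (PP N) :=
  MvPolynomial.mkDerivation ℂ fun p => if p.2 = b then MvPolynomial.X (p.1, a) else 0

lemma exists_succ_of_sum {r : Fin N → ℕ} {n : ℕ} (h : ∑ i, r i = n + 1) :
    ∃ (s : Fin N → ℕ) (c : Fin N), r = s + Pi.single c 1 ∧ ∑ i, s i = n := by
  have : ∃ c, r c ≠ 0 := by
    by_contra hc; push Not at hc
    rw [Finset.sum_eq_zero (fun i _ => hc i)] at h; omega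
  obtain ⟨c, hc⟩ := this
  have e := tsub_add_cancel_of_le (single_le_of_ne hc)
  refine ⟨r - Pi.single c 1, c, e.symm, ?_⟩
  have := sum_single_add (r - Pi.single c 1) c
  rw [e, h] at this; omega

lemma der_gam (a b : Fin N) : ∀ (n : ℕ) (r r' : Fin N → ℕ), ∑ i, r i = n →
    der a b (gam r' r) = r b • gam r' (r - Pi.single b 1 + Pi.single a 1) := by
  intro n
  induction n with
  | zero =>
    intro r r' hr
    have : r = 0 := by
      rw [Finset.sum_eq_zero_iff] at hr
      ext i; exact hr i (Finset.mem_univ _)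
    subst this
    rw [gam_zero]; split_ifs <;> simp
  | succ n ih =>
    intro r r' hr
    obtain ⟨s, c, rfl, hs⟩ := exists_succ_of_sum hr
    rw [shift_succ (fun r => gam r' r), gam_col, map_sum, gam_col r' (s - _ + _) c, gam_col r' s a,
      Finset.smul_sum]
    have : ∀ d, der a b (if r' d = 0 then 0 else MvPolynomial.X (d, c) * gam (r' - Pi.single d 1) s) =
      (s b • if r' d = 0 then 0 else MvPolynomial.X (d, c) *
        gam (r' - Pi.single d 1) (s - Pi.single b 1 + Pi.single a 1)) + 
      if b = c then (if r' d = 0 then 0 else MvPolynomial.X (d, a) * gam (r' - Pi.single d 1) s) else 0 := by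
      intro d
      by_cases hd : r' d = 0
      · simp [hd]
      · simp only [hd, if_false, Derivation.leibniz, ih s _ hs]
        have : der a b (MvPolynomial.X (d, c) : PP N) = if b = c then MvPolynomial.X (d, a) else 0 := by
          rw [der, MvPolynomial.mkDerivation_X]
          simp only [eq_comm]
        rw [this]
        split_ifs
        · simp only [smul_eq_mul, nsmul_eq_mul]; ring
        · simp only [smul_eq_mul, nsmul_eq_mul]; ring
    simp only [this, Finset.sum_add_distrib]
    congr 1
    split_ifs <;> simp

noncomputable def genM (N : ℕ) : Matrix (Fin N) (Fin N) (PP N) :=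
  Matrix.of fun a b => MvPolynomial.X (a, b)

noncomputable def HH (N : ℕ) : ℕ → PP N :=
  fun n => ∑ r ∈ Finset.Nat.antidiagonalTuple N n, gam r r

noncomputable def Zop (a b : Fin N) : Module.End ℂ (ℕ → PP N) :=
  (Sh ℂ (PP N)) * Yop (fun _ a b => LinearMap.mulLeft ℂ (MvPolynomial.X (a, b) : PP N)) a b

lemma Zop_apply (a b : Fin N) (f : ℕ → PP N) (n : ℕ) : Zop a b f n =
    (if a = b then f (n + 1) else 0) - MvPolynomial.X (a, b) * f n := by
  simp [Zop, Sh_apply, Yop_succ]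

lemma Zop_eq_aeval (a b : Fin N) (f : ℕ → PP N) : Zop a b f =
    aeval (Sh (PP N) (PP N)) ((genM N).charmatrix a b) f := by
  ext n : 1
  rw [Zop_apply, Matrix.charmatrix_apply, map_sub, LinearMap.sub_apply, Pi.sub_apply]
  by_cases h : a = b
  · subst h; simp [Sh_apply, genM, Module.algebraMap_end_apply]
  · simp [h, genM, Module.algebraMap_end_apply]

lemma commute_Sh_Zop (a b : Fin N) : Commute (Sh ℂ (PP N)) (Zop a b) := by
  ext f n : 2
  simp only [Module.End.mul_apply, Sh_apply, Zop_apply]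

lemma Sh_list : ∀ (m : ℕ) (f : Fin m → Fin N × Fin N),
    (Sh ℂ (PP N)) ^ m * (List.ofFn fun i =>
      Yop (fun _ a b => LinearMap.mulLeft ℂ (MvPolynomial.X (a, b) : PP N)) (f i).1 (f i).2).prod
    = (List.ofFn fun i => Zop (f i).1 (f i).2).prod := by
  intro m
  induction m with
  | zero => intro f; simp
  | succ m ih =>
    intro f
    rw [List.ofFn_succ, List.ofFn_succ, List.prod_cons, List.prod_cons, ← ih, pow_succ, ← mul_assoc,
      ← mul_assoc]
    congr 1
    rw [mul_assoc]
    exact ((commute_Sh_Zop _ _).pow_left m).eq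

lemma Zop_list (h : ℕ → PP N) : ∀ (m : ℕ) (f : Fin m → Fin N × Fin N),
    (List.ofFn fun i => Zop (f i).1 (f i).2).prod h =
    aeval (Sh (PP N) (PP N)) (List.ofFn fun i => (genM N).charmatrix (f i).1 (f i).2).prod h := by
  intro m
  induction m with
  | zero => intro f; simp
  | succ m ih =>
    intro f
    rw [List.ofFn_succ, List.ofFn_succ, List.prod_cons, List.prod_cons, Module.End.mul_apply, ih,
      Zop_eq_aeval, map_mul, Module.End.mul_apply]

lemma rec_HH (hN : 0 < N) : Rec (genM N).charpoly (HH N) := by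
  refine ⟨1, ?_⟩
  rw [pow_one]
  set X : ℕ → Fin N → Fin N → Module.End ℂ (PP N) :=
    (fun _ a b => LinearMap.mulLeft ℂ (MvPolynomial.X (a, b) : PP N)) with hX
  have h1 : rdet (Yop X) (HH N) = (Pi.single 0 (gam 0 0) : ℕ → PP N) := by
    refine macmahon X ?_ gam ?_
    · intro n a c i j
      refine LinearMap.ext fun p => ?_
      simp only [hX, LinearMap.sub_apply, LinearMap.add_apply, Module.End.mul_apply,
        LinearMap.mulLeft_apply, LinearMap.zero_apply]
      ring
    · intro r' r c
      rw [gam_col]; rfl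
  have h2 : ((Sh ℂ (PP N)) ^ N) (rdet (Yop X) (HH N)) = 0 := by
    rw [h1]; ext n : 1
    rw [Sh_pow_apply, Pi.single_eq_of_ne (by omega)]; rfl
  rw [← h2, ← Module.End.mul_apply, rdet, Finset.mul_sum, Matrix.charpoly, ← Matrix.det_transpose,
    Matrix.det_apply, map_sum, LinearMap.sum_apply, LinearMap.sum_apply]
  refine Finset.sum_congr rfl fun σ _ => ?_
  rw [mul_smul_comm, LinearMap.smul_apply]
  have h3 := Sh_list N (fun i => (i, σ i))
  have h4 := Zop_list (HH N) N (fun i => (i, σ i))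
  simp only at h3 h4
  rw [h3, h4, List.prod_ofFn, Units.smul_def, map_zsmul, LinearMap.smul_apply]
  rfl

noncomputable def dw : List (Fin N × Fin N) → PP N →ₗ[ℂ] PP N
  | [] => LinearMap.id
  | p :: l => dw l ∘ₗ (der p.1 p.2 : PP N →ₗ[ℂ] PP N)

lemma Rec.dw {χ : (PP N)[X]} (l : List (Fin N × Fin N)) {f : ℕ → PP N} (hf : Rec χ f) :
    Rec χ (fun n => dw l (f n)) := by
  induction l generalizing f with
  | nil => exact hf
  | cons p l ih => exact ih (hf.deriv (der p.1 p.2))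

noncomputable def evQ (Q : Matrix (Fin N) (Fin N) ℂ) : PP N →ₐ[ℂ] ℂ :=
  MvPolynomial.aeval fun p => Q p.1 p.2

lemma map_genM (Q : Matrix (Fin N) (Fin N) ℂ) :
    (genM N).charpoly.map (evQ Q : PP N →+* ℂ) = Q.charpoly := by
  rw [← Matrix.charpoly_map]
  congr 1
  ext a b
  simp [genM, evQ]

noncomputable def wordK {R : Type*} [Ring R] [Algebra ℂ R] (Q : Matrix (Fin N) (Fin N) ℂ) :
    Submodule ℂ ((Fin N → ℕ) → (Fin N → ℕ) → R) :=
  Submodule.span ℂ {K | ∃ (l : List (Fin N × Fin N)) (x : R),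
    K = fun r' r => evQ Q (dw l (gam r' r)) • x}

lemma wordK_shift {R : Type*} [Ring R] [Algebra ℂ R] (Q : Matrix (Fin N) (Fin N) ℂ)
    {K : (Fin N → ℕ) → (Fin N → ℕ) → R} (hK : K ∈ wordK Q) (a b : Fin N) (y : R) :
    (fun r' r => (r b • K r' (r - Pi.single b 1 + Pi.single a 1)) * y) ∈ wordK (R := R) Q := by
  induction hK using Submodule.span_induction with
  | mem K h =>
    obtain ⟨l, x, rfl⟩ := h
    apply Submodule.subset_span
    refine ⟨(a, b) :: l, x * y, ?_⟩
    ext r' r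
    simp only [dw, LinearMap.comp_apply]
    have := der_gam a b _ r r' rfl
    erw [this]
    rw [map_nsmul, map_nsmul]
    simp only [smul_mul_assoc, smul_assoc]
  | zero =>
    convert Submodule.zero_mem (wordK (R := R) Q) using 1
    ext r' r; simp
  | add K K' _ _ h h' =>
    convert Submodule.add_mem _ h h' using 1
    ext r' r
    simp [add_mul, mul_add]
  | smul c K _ h =>
    convert Submodule.smul_mem _ c h using 1
    ext r' r
    simp only [Pi.smul_apply, smul_mul_assoc]
    rw [smul_comm]

lemma KL_mem_wordK {R : Type*} [Ring R] [Algebra ℂ R] (Q : Matrix (Fin N) (Fin N) ℂ) (u0 : ℂ)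
    (l : List (Site N R)) : KL (fun r' r => evQ Q (gam r' r)) u0 l ∈ wordK (R := R) Q := by
  induction l with
  | nil =>
    apply Submodule.subset_span
    refine ⟨[], 1, ?_⟩
    ext r' r
    simp [KL, dw, Algebra.algebraMap_eq_smul_one]
  | cons s l ih =>
    have : KL (fun r' r => evQ Q (gam r' r)) u0 (s :: l) = KL (fun r' r => evQ Q (gam r' r)) u0 l +
      (u0 + 1 - s.2)⁻¹ • ∑ b : Fin N, ∑ a : Fin N, (fun r' r : Fin N → ℕ =>
        (r b • KL (fun r' r => evQ Q (gam r' r)) u0 l r' (r - Pi.single b 1 + Pi.single a 1)) * s.1 b a) := by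
      ext r' r
      simp [KL, actK, Finset.sum_apply]
    rw [this]
    refine Submodule.add_mem _ ih (Submodule.smul_mem _ _ ?_)
    exact Submodule.sum_mem _ fun b _ => Submodule.sum_mem _ fun a _ => wordK_shift Q ih a b _

lemma rec_wordK {R : Type*} [Ring R] [Algebra ℂ R] (hN : 0 < N) (Q : Matrix (Fin N) (Fin N) ℂ)
    {K : (Fin N → ℕ) → (Fin N → ℕ) → R} (hK : K ∈ wordK Q) :
    Rec Q.charpoly (fun n => ∑ r ∈ Finset.Nat.antidiagonalTuple N n, K r r) := by
  induction hK using Submodule.span_induction with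
  | mem K h =>
    obtain ⟨l, x, rfl⟩ := h
    have h1 := (((rec_HH hN).dw l).map (evQ Q : PP N →+* ℂ)).smul_const x
    rw [map_genM] at h1
    convert h1 using 2 with n
    simp [HH, Finset.sum_smul]
  | zero =>
    convert Rec.zero (χ := Q.charpoly) (W := R) using 1
    ext n; simp
  | add K K' _ _ h h' =>
    convert h.add h' using 1
    ext n
    simp [Finset.sum_add_distrib]
  | smul c K _ h =>
    convert h.smul c using 1
    ext n
    simp [Finset.smul_sum]

/-- Existence of impulse responses satisfying a linear recurrence. -/
theorem impulse {M' : Type*} [AddCommGroup M'] [Module ℂ M'] (hN : 0 < N)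
    (Q : Matrix (Fin N) (Fin N) ℂ) (l : List (Site N (Module.End ℂ M')))
    (hmu : ∀ s ∈ l, MU s) (hc : l.Pairwise SComm) (u0 : ℂ)
    (hw : ∀ s ∈ l, ∀ n : ℕ, u0 + 1 - s.2 + n ≠ 0) (v : M') :
    ∃ f : ℕ → M', rdet (Yop (fun n => XL Q (u0 + n) l)) f = Pi.single 0 v ∧ Rec Q.charpoly f := by
  set K := KL (R := Module.End ℂ M') (fun r' r => evQ Q (gam r' r)) u0 l with hKdef
  have hcol : ColA (fun n : ℕ => XL Q (u0 + n) l) K := by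
    refine colA_KL Q _ ?_ u0 l hmu hc hw
    intro r' r c
    simp only [gam_col, map_sum, apply_ite (evQ Q), map_zero, map_mul]
    simp [evQ]
  refine ⟨fun n => ∑ r ∈ Finset.Nat.antidiagonalTuple N n, K r r v, ?_, ?_⟩
  · have h0 : K 0 0 v = v := by
      rw [hKdef, KL_zero, gam_zero]; simp
    have := macmahon (fun n : ℕ => XL Q (u0 + n) l) ?_ (fun r' r => K r' r v) ?_
    · simp only [h0] at this; exact this
    · intro n
      have := RM_XL Q l (u0 + ((n + 2 : ℕ) : ℂ)) hmu hc ?_ ?_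
      · convert this using 2
        push_cast; ring
      · intro s hs
        convert hw s hs (n + 1) using 1; push_cast; ring
      · intro s hs
        convert hw s hs n using 1; push_cast; ring
    · intro r' r c
      simp only
      rw [hcol r' r c, LinearMap.sum_apply]
      refine Finset.sum_congr rfl fun a _ => ?_
      split_ifs <;> simp
  · have := (rec_wordK hN Q (KL_mem_wordK Q u0 l)).linmap (LinearMap.applyₗ v)
    simpa [LinearMap.sum_apply] using this
end
end XXXModel

namespace XXXModel
open Polynomial

section QE
variable {M : Type*} [AddCommGroup M] [Module ℂ M]

/-- quasi-exponentials with exponents in `S` -/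
def QES (M : Type*) [AddCommGroup M] [Module ℂ M] (S : Set ℂ) : Submodule ℂ (ℂ → M) :=
  Submodule.span ℂ {f | ∃ l ∈ S, ∃ p : ℂ[X], ∃ v : M, f = fun u => (Complex.exp (l * u) * p.eval u) • v}

lemma QES.gen {S : Set ℂ} {l : ℂ} (hl : l ∈ S) (p : ℂ[X]) (v : M) :
    (fun u => (Complex.exp (l * u) * p.eval u) • v) ∈ QES M S :=
  Submodule.subset_span ⟨l, hl, p, v, rfl⟩

lemma QES.induct {S : Set ℂ} {P : (ℂ → M) → Prop}
    (hg : ∀ l ∈ S, ∀ (p : ℂ[X]) (v : M), P (fun u => (Complex.exp (l * u) * p.eval u) • v))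
    (h0 : P 0) (ha : ∀ f g, P f → P g → P (f + g)) (f : ℂ → M) (hf : f ∈ QES M S) : P f := by
  unfold QES at hf
  induction hf using Submodule.closure_induction with
  | zero => exact h0
  | add f g _ _ h1 h2 => exact ha f g h1 h2
  | smul_mem r f hf =>
    obtain ⟨l, hl, p, v, rfl⟩ := hf
    have := hg l hl p (r • v)
    convert this using 1
    funext u
    simp only [Pi.smul_apply, smul_smul]
    congr 1; ring

lemma QES.mulPoly {S : Set ℂ} (q : ℂ[X]) (f : ℂ → M) (hf : f ∈ QES M S) :
    (fun u => q.eval u • f u) ∈ QES M S := by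
  refine QES.induct (P := fun f => (fun u => q.eval u • f u) ∈ QES M S) ?_ ?_ ?_ f hf
  · intro l hl p v
    convert QES.gen hl (q * p) v using 1
    funext u; simp only [smul_smul, eval_mul]; congr 1; ring
  · simp only [Pi.zero_apply, smul_zero]; exact Submodule.zero_mem _
  · intro f g hf hg
    convert Submodule.add_mem _ hf hg using 1
    funext u; simp

lemma QES.shift {S : Set ℂ} (c : ℂ) (f : ℂ → M) (hf : f ∈ QES M S) :
    (fun u => f (u + c)) ∈ QES M S := by
  refine QES.induct (P := fun f => (fun u => f (u + c)) ∈ QES M S) ?_ ?_ ?_ f hf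
  · intro l hl p v
    convert QES.gen hl (p.comp (X + C c)) (Complex.exp (l * c) • v) using 1
    funext u; simp only [smul_smul, eval_comp, eval_add, eval_X, eval_C, mul_add, Complex.exp_add]
    congr 1; ring
  · exact Submodule.zero_mem _
  · intro f g hf hg
    exact Submodule.add_mem _ hf hg

lemma QES.lin {M' : Type*} [AddCommGroup M'] [Module ℂ M'] {S : Set ℂ} (A : M →ₗ[ℂ] M')
    (f : ℂ → M) (hf : f ∈ QES M S) :
    (fun u => A (f u)) ∈ QES M' S := by
  refine QES.induct (P := fun f => (fun u => A (f u)) ∈ QES M' S) ?_ ?_ ?_ f hf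
  · intro l hl p v
    simp only [map_smul]
    exact QES.gen hl p (A v)
  · simp only [Pi.zero_apply, map_zero]; exact Submodule.zero_mem _
  · intro f g hf hg
    convert Submodule.add_mem _ hf hg using 1
    funext u; simp

lemma QES.isQE {S : Set ℂ} (f : ℂ → M) (hf : f ∈ QES M S) : IsQE f := by
  unfold QES at hf
  rw [Submodule.mem_span_set'] at hf
  obtain ⟨k, c, g, rfl⟩ := hf
  have hg := fun i => (g i).2
  simp only [Set.mem_setOf_eq] at hg
  choose l hl p v hv using hg
  refine ⟨k, (Finset.univ.sup fun i => (p i).natDegree) + 1, l, fun i j => (c i * (p i).coeff j) • v i, ?_⟩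
  intro u
  rw [Finset.sum_apply]
  refine Finset.sum_congr rfl fun i _ => ?_
  rw [Pi.smul_apply, hv i]
  have hd : (p i).natDegree < (Finset.univ.sup fun i => (p i).natDegree) + 1 :=
    Nat.lt_succ_of_le (Finset.le_sup (f := fun i => (p i).natDegree) (Finset.mem_univ i))
  simp only
  rw [eval_eq_sum_range' hd, Finset.sum_range, Finset.mul_sum, Finset.sum_smul, Finset.smul_sum]
  refine Finset.sum_congr rfl fun j _ => ?_
  simp only [smul_smul]
  congr 1; ring

/-- the operator `p ↦ a p(X+1) - q p` is onto. -/
lemma diff_surj (a q : ℂ) (ha : a ≠ 0) (p : ℂ[X]) : ∃ r : ℂ[X], C a * r.comp (X + 1) - C q * r = p := by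
  let A : ℂ[X] →ₗ[ℂ] ℂ[X] :=
    { toFun := fun r => C a * r.comp (X + 1) - C q * r
      map_add' := fun r s => by simp only [add_comp]; ring
      map_smul' := fun c r => by simp only [smul_comp, RingHom.id_apply]; simp only [smul_eq_C_mul]; ring }
  have hA : ∀ r, A r = C a * r.comp (X + 1) - C q * r := fun r => rfl
  have key : ∀ n : ℕ, (X : ℂ[X]) ^ n ∈ LinearMap.range A := by
    intro n
    induction n using Nat.strong_induction_on with
    | _ n ih =>
      have hs : ∀ (m : ℕ) (c : ℕ → ℂ), m ≤ n → ∑ i ∈ Finset.range m, c i • (X : ℂ[X]) ^ i ∈ LinearMap.range A :=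
        fun m c hm => Submodule.sum_mem _ fun i hi =>
          Submodule.smul_mem _ _ (ih i (lt_of_lt_of_le (Finset.mem_range.1 hi) hm))
      by_cases hq : a = q
      · have h1 : A (X ^ (n + 1)) = a • (∑ i ∈ Finset.range n, (((n + 1).choose i : ℕ) : ℂ) • (X : ℂ[X]) ^ i)
            + (a * (n + 1)) • X ^ n := by
          rw [hA, pow_comp, X_comp, add_pow, Finset.sum_range_succ, Finset.sum_range_succ, ← hq]
          simp only [smul_eq_C_mul, Nat.choose_self, Nat.choose_succ_self_right, one_pow, mul_one, map_mul,
            map_add, map_natCast, map_one, Nat.cast_add, Nat.cast_one]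
          have : ∑ x ∈ Finset.range n, (X : ℂ[X]) ^ x * (((n + 1).choose x : ℕ) : ℂ[X])
            = ∑ x ∈ Finset.range n, (((n + 1).choose x : ℕ) : ℂ[X]) * X ^ x :=
            Finset.sum_congr rfl fun _ _ => mul_comm _ _
          rw [this]; ring
        have h2 : (a * (n + 1)) • (X : ℂ[X]) ^ n ∈ LinearMap.range A := by
          rw [← sub_eq_iff_eq_add'.2 h1]
          exact Submodule.sub_mem _ ⟨_, rfl⟩ (Submodule.smul_mem _ _ (hs n _ le_rfl))
        exact (Submodule.smul_mem_iff _ (mul_ne_zero ha (by exact_mod_cast n.succ_ne_zero))).1 h2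
      · have h1 : A (X ^ n) = a • (∑ i ∈ Finset.range n, ((n.choose i : ℕ) : ℂ) • (X : ℂ[X]) ^ i)
            + (a - q) • X ^ n := by
          rw [hA, pow_comp, X_comp, add_pow, Finset.sum_range_succ]
          simp only [smul_eq_C_mul, Nat.choose_self, one_pow, mul_one, 
            map_sub, map_natCast, Nat.cast_one]
          have : ∑ x ∈ Finset.range n, (X : ℂ[X]) ^ x * ((n.choose x : ℕ) : ℂ[X])
            = ∑ x ∈ Finset.range n, ((n.choose x : ℕ) : ℂ[X]) * X ^ x :=
            Finset.sum_congr rfl fun _ _ => mul_comm _ _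
          rw [this]; ring
        have h2 : (a - q) • (X : ℂ[X]) ^ n ∈ LinearMap.range A := by
          rw [← sub_eq_iff_eq_add'.2 h1]
          exact Submodule.sub_mem _ ⟨_, rfl⟩ (Submodule.smul_mem _ _ (hs n _ le_rfl))
        exact (Submodule.smul_mem_iff _ (sub_ne_zero.2 hq)).1 h2
  have : p ∈ LinearMap.range A := by
    rw [p.as_sum_range]
    refine Submodule.sum_mem _ fun i _ => ?_
    rw [← C_mul_X_pow_eq_monomial, ← smul_eq_C_mul]
    exact Submodule.smul_mem _ _ (key i)
  exact this

lemma QES.surj {S : Set ℂ} (q : ℂ) (f : ℂ → M) (hf : f ∈ QES M S) :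
    ∃ g ∈ QES M S, ∀ u, f u = g (u + 1) - q • g u := by
  refine QES.induct (P := fun f => ∃ g ∈ QES M S, ∀ u, f u = g (u + 1) - q • g u) ?_ ?_ ?_ f hf
  · intro l hl p v
    obtain ⟨r, hr⟩ := diff_surj (Complex.exp l) q (Complex.exp_ne_zero _) p
    refine ⟨_, QES.gen hl r v, fun u => ?_⟩
    rw [← hr]
    simp only [smul_smul, ← sub_smul, eval_sub, eval_mul, eval_C, eval_comp, eval_add, eval_X, eval_one, mul_add,
      Complex.exp_add, mul_one]
    congr 1; ring
  · exact ⟨0, Submodule.zero_mem _, by simp⟩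
  · rintro f g ⟨f', h1, h2⟩ ⟨g', h3, h4⟩
    refine ⟨f' + g', Submodule.add_mem _ h1 h3, fun u => ?_⟩
    simp only [Pi.add_apply, h2, h4, smul_add]; abel

lemma QES.interp {S : Set ℂ} (x : ℂ) (s : Multiset ℂ) : (∀ q ∈ s, ∃ l ∈ S, Complex.exp l = q) →
    ∀ f : ℕ → M, aeval (Sh ℂ M) (s.map fun q => X - C q).prod f = 0 →
    ∃ w ∈ QES M S, ∀ n : ℕ, f n = w (x + n) := by
  induction s using Multiset.induction_on with
  | empty =>
    intro _ f hf
    simp only [Multiset.map_zero, Multiset.prod_zero, map_one, Module.End.one_apply] at hf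
    exact ⟨0, Submodule.zero_mem _, fun n => by rw [hf]; rfl⟩
  | cons q s ih =>
    intro hs f hf
    rw [Multiset.map_cons, Multiset.prod_cons, mul_comm, map_mul, Module.End.mul_apply] at hf
    obtain ⟨w, hw, hw2⟩ := ih (fun q hq => hs q (Multiset.mem_cons_of_mem hq)) _ hf
    obtain ⟨g, hg, hg2⟩ := QES.surj q w hw
    obtain ⟨l, hl, hlq⟩ := hs q (Multiset.mem_cons_self _ _)
    have hst : ∀ n : ℕ, f (n + 1) - q • f n = g (x + n + 1) - q • g (x + n) := by
      intro n
      rw [← hg2, ← hw2 n]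
      simp [Sh_apply, Algebra.algebraMap_eq_smul_one]
    have hh : ∀ n : ℕ, f n - g (x + n) = q ^ n • (f 0 - g x) := by
      intro n
      induction n with
      | zero => simp
      | succ n ihn =>
        rw [pow_succ', mul_smul, ← ihn, smul_sub]
        have := hst n
        push_cast
        rw [← add_assoc]
        rw [sub_eq_sub_iff_add_eq_add] at this ⊢
        rw [this]; abel
    refine ⟨g + _, Submodule.add_mem _ hg (QES.gen hl 1 (Complex.exp (- (l * x)) • (f 0 - g x))), fun n => ?_⟩
    simp only [Pi.add_apply]
    rw [← sub_eq_iff_eq_add', hh n, ← hlq, smul_smul, ← Complex.exp_nat_mul, eval_one, mul_one,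
      ← Complex.exp_add]
    congr 2; ring

lemma QES.of_rec {S : Set ℂ} {χ : ℂ[X]} (hm : χ.Monic) (hS : ∀ q ∈ χ.roots, ∃ l ∈ S, Complex.exp l = q)
    (x : ℂ) (f : ℕ → M) (hf : Rec χ f) : ∃ w ∈ QES M S, ∀ n : ℕ, f n = w (x + n) := by
  obtain ⟨k, hk⟩ := hf
  refine QES.interp x (k • χ.roots) ?_ f ?_
  · intro q hq
    exact hS q (Multiset.mem_of_mem_nsmul hq)
  · rw [Multiset.map_nsmul, Multiset.prod_nsmul]
    have : (χ.roots.map fun q => X - C q).prod = χ :=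
      prod_multiset_X_sub_C_of_monic_of_roots_card_eq hm (splits_iff_card_roots.1 (IsAlgClosed.splits χ))
    rw [this]; exact hk

lemma QES.decomp {S : Finset ℂ} (f : ℂ → M) (hf : f ∈ QES M (S : Set ℂ)) :
    ∃ g : ℂ → ℂ → M, (∀ l, g l ∈ QES M {l}) ∧ f = ∑ l ∈ S, g l := by
  classical
  refine QES.induct (P := fun f => ∃ g : ℂ → ℂ → M, (∀ l, g l ∈ QES M {l}) ∧ f = ∑ l ∈ S, g l) ?_ ?_ ?_ f hf
  · intro l hl p v
    refine ⟨Pi.single l (fun u => (Complex.exp (l * u) * p.eval u) • v), ?_, ?_⟩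
    swap
    · funext u
      rw [Finset.sum_apply, Finset.sum_eq_single_of_mem l hl, Pi.single_eq_same]
      intro b _ hb
      rw [Pi.single_eq_of_ne hb]; rfl
    intro l'
    by_cases h : l' = l
    · subst h; rw [Pi.single_eq_same]; exact QES.gen (Set.mem_singleton _) p v
    · rw [Pi.single_eq_of_ne h]; exact Submodule.zero_mem _
  · exact ⟨0, fun _ => Submodule.zero_mem _, by simp⟩
  · rintro f g ⟨f', h1, h2⟩ ⟨g', h3, h4⟩
    exact ⟨f' + g', fun l => Submodule.add_mem _ (h1 l) (h3 l), by simp [h2, h4, Finset.sum_add_distrib]⟩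

lemma QES.gen_eig (l x : ℂ) (f : ℂ → M) (hf : f ∈ QES M {l}) :
    (fun n : ℕ => f (x + n)) ∈ (Sh ℂ M).maxGenEigenspace (Complex.exp l) := by
  refine QES.induct (P := fun f => (fun n : ℕ => f (x + n)) ∈ (Sh ℂ M).maxGenEigenspace (Complex.exp l)) ?_ ?_ ?_ f hf
  · intro l' hl p v
    rw [Set.mem_singleton_iff] at hl
    subst hl
    suffices h : ∀ k : ℕ, ∀ p : ℂ[X], p.degree < k →
        ((Sh ℂ M - algebraMap ℂ _ (Complex.exp l')) ^ k) (fun n : ℕ => (Complex.exp (l' * (x + n)) * p.eval (x + n)) • v) = 0 by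
      rw [Module.End.mem_maxGenEigenspace]
      exact ⟨_, h (p.natDegree + 1) p (lt_of_le_of_lt degree_le_natDegree (by exact_mod_cast Nat.lt_succ_self _))⟩
    intro k
    induction k with
    | zero =>
      intro p hp
      have : p = 0 := by rw [← degree_eq_bot]; simpa [Nat.WithBot.lt_zero_iff] using hp
      subst this
      funext n; simp
    | succ k ih =>
      intro p hp
      rw [pow_succ, Module.End.mul_apply]
      have h2 : (Sh ℂ M - algebraMap ℂ _ (Complex.exp l')) (fun n : ℕ => (Complex.exp (l' * (x + n)) * p.eval (x + n)) • v)
          = Complex.exp l' • (fun n : ℕ => (Complex.exp (l' * (x + n)) * (taylor 1 p - p).eval (x + n)) • v) := by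
        funext n
        simp only [LinearMap.sub_apply, Sh_apply, Pi.sub_apply, Algebra.algebraMap_eq_smul_one, LinearMap.smul_apply,
          Module.End.one_apply, Pi.smul_apply, smul_smul, ← sub_smul, eval_sub, taylor_eval]
        push_cast
        rw [show l' * (x + (n + 1)) = l' + l' * (x + n) by ring, Complex.exp_add,
          show x + ((n : ℂ) + 1) = x + n + 1 by ring]
        congr 1; ring
      rw [h2, map_smul, ih, smul_zero]
      by_cases hp0 : p = 0
      · subst hp0; simp
      have h3 : (taylor 1 p - p).degree < (taylor 1 p).degree :=
        degree_sub_lt (degree_taylor p 1) (by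
          intro h0; apply hp0; rw [← degree_eq_bot, ← degree_taylor p 1, h0, degree_zero]) (leadingCoeff_taylor 1 p)
      rw [degree_taylor] at h3
      exact lt_of_lt_of_le h3 (Order.le_of_lt_succ (by exact_mod_cast hp))
  · exact Submodule.zero_mem _
  · intro f g hf hg
    exact Submodule.add_mem _ hf hg

lemma QES.vanish1 (l x : ℂ) (f : ℂ → M) (hf : f ∈ QES M {l}) (h : ∀ n : ℕ, f (x + n) = 0) : f = 0 := by
  funext u
  have hb := Module.forall_dual_apply_eq_zero_iff ℂ (f u)
  refine hb.1 fun A => ?_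
  obtain ⟨p, hp⟩ : ∃ p : ℂ[X], ∀ u, A (f u) = Complex.exp (l * u) * p.eval u := by
    refine QES.induct (P := fun f => ∃ p : ℂ[X], ∀ u, A (f u) = Complex.exp (l * u) * p.eval u) ?_ ?_ ?_ f hf
    · intro l' hl p v
      rw [Set.mem_singleton_iff] at hl
      subst hl
      refine ⟨C (A v) * p, fun u => ?_⟩
      rw [map_smul, smul_eq_mul, eval_mul, eval_C]; ring
    · exact ⟨0, by simp⟩
    · rintro f g ⟨p, hp⟩ ⟨q, hq⟩
      exact ⟨p + q, fun u => by rw [Pi.add_apply, map_add, hp, hq, eval_add]; ring⟩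
  have : p = 0 := by
    refine eq_zero_of_infinite_isRoot p (Set.Infinite.mono (s := Set.range fun n : ℕ => x + n) ?_ 
      (Set.infinite_range_of_injective fun a b hab => by simpa using hab))
    rintro _ ⟨n, rfl⟩
    have := hp (x + n)
    rw [h n, map_zero] at this
    simpa [Complex.exp_ne_zero] using this.symm
  rw [hp, this]; simp

lemma QES.vanish {S : Finset ℂ} (hS : Set.InjOn Complex.exp (S : Set ℂ)) (x : ℂ) (f : ℂ → M)
    (hf : f ∈ QES M (S : Set ℂ)) (h : ∃ n0 : ℕ, ∀ n : ℕ, n0 ≤ n → f (x + n) = 0) : f = 0 := by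
  classical
  obtain ⟨n0, h⟩ := h
  obtain ⟨g, hg, rfl⟩ := QES.decomp f hf
  have h1 : ∀ l ∈ S, (fun n : ℕ => g l (x + n0 + n)) = 0 := by
    have hi := (Module.End.independent_maxGenEigenspace (Sh ℂ M))
    have hi2 : iSupIndep fun l : S => (Sh ℂ M).maxGenEigenspace (Complex.exp l) :=
      hi.comp (f := fun l : S => Complex.exp l) (fun a b hab => Subtype.ext (hS a.2 b.2 hab))
    rw [iSupIndep_iff_finset_sum_eq_zero_imp_eq_zero] at hi2
    have := hi2 Finset.univ (fun l => fun n : ℕ => g l (x + n0 + n)) (fun l _ => QES.gen_eig l _ _ (hg l)) ?_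
    · intro l hl
      exact this ⟨l, hl⟩ (Finset.mem_univ _)
    · funext n
      rw [Finset.sum_apply, Pi.zero_apply]
      have := h (n0 + n) (by omega)
      rw [Finset.sum_apply] at this
      rw [← Finset.sum_coe_sort S] at this
      rw [← this]
      push_cast
      simp only [add_assoc]
  refine Finset.sum_eq_zero fun l hl => QES.vanish1 l (x + n0) _ (hg l) fun n => congrFun (h1 l hl) n
end QE
end XXXModel

namespace XXXModel
open Polynomial

section Core
variable {N n : ℕ} {M : Type*} [AddCommGroup M] [Module ℂ M]

def XXop (X : ℂ → Fin N → Fin N → Module.End ℂ M) (a b : Fin N) (f : ℂ → M) : ℂ → M :=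
  fun u => (if a = b then f u else 0) - X u a b (f (u - 1))

def DD (X : ℂ → Fin N → Fin N → Module.End ℂ M) (f : ℂ → M) : ℂ → M :=
  fun u => ∑ σ : Equiv.Perm (Fin N),
    ((Equiv.Perm.sign σ : ℤˣ) : ℤ) •
      (((List.ofFn fun a : Fin N => XXop X a (σ a)).foldr (· ∘ ·) id) f u)

def Theta (X : ℂ → Fin N → Fin N → Module.End ℂ M) (u : ℂ) : Module.End ℂ M :=
  ∑ σ : Equiv.Perm (Fin N), ((Equiv.Perm.sign σ : ℤˣ) : ℤ) •
      (List.ofFn fun a : Fin N => X (u - (a : ℕ)) a (σ a)).prod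

/-! ### Locality -/
lemma local_step (X : ℂ → Fin N → Fin N → Module.End ℂ M) (u0 : ℂ) (w : ℂ → M) (s : ℕ → M) (k : ℕ)
    (h : ∀ n, k ≤ n → s n = w (u0 + n)) (a b : Fin N) :
    ∀ n, k + 1 ≤ n → Yop (fun n => X (u0 + n)) a b s n = XXop X a b w (u0 + n) := by
  intro n hn
  obtain ⟨n, rfl⟩ : ∃ m, n = m + 1 := ⟨n - 1, by omega⟩
  rw [Yop_succ, XXop, h (n + 1) (by omega), h n (by omega)]
  push_cast
  rw [show u0 + ((n : ℂ) + 1) - 1 = u0 + n by ring]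

lemma local_list (X : ℂ → Fin N → Fin N → Module.End ℂ M) (u0 : ℂ) (w : ℂ → M) (s : ℕ → M) (k : ℕ)
    (h : ∀ n, k ≤ n → s n = w (u0 + n)) : ∀ (m : ℕ) (f : Fin m → Fin N × Fin N),
    ∀ n, k + m ≤ n → (List.ofFn fun i => Yop (fun n => X (u0 + n)) (f i).1 (f i).2).prod s n =
      ((List.ofFn fun i => XXop X (f i).1 (f i).2).foldr (· ∘ ·) id) w (u0 + n) := by
  intro m
  induction m with
  | zero => intro f n hn; simpa using h n (by omega)
  | succ m ih =>
    intro f n hn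
    rw [List.ofFn_succ, List.ofFn_succ, List.prod_cons, List.foldr_cons, Module.End.mul_apply]
    exact local_step X u0 _ _ (k + m) (ih _) _ _ n (by omega)

lemma local_DD (X : ℂ → Fin N → Fin N → Module.End ℂ M) (u0 : ℂ) (w : ℂ → M) (s : ℕ → M) (k : ℕ)
    (h : ∀ n, k ≤ n → s n = w (u0 + n)) (n : ℕ) (hn : k + N ≤ n) :
    rdet (Yop (fun n => X (u0 + n))) s n = DD X w (u0 + n) := by
  rw [rdet, DD, LinearMap.sum_apply, Finset.sum_apply]
  refine Finset.sum_congr rfl fun σ _ => ?_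
  rw [← local_list X u0 w s k h N (fun i => (i, σ i)) n hn]
  first | rfl | (rw [LinearMap.smul_apply]; rfl)

/-! ### Rationality -/
def RQ (z : Fin n → ℂ) (S : Set ℂ) (k : ℕ) (f : ℂ → M) : Prop :=
  ∃ q : ℂ[X], (∀ u, Good k z u → q.eval u ≠ 0) ∧ ∃ g ∈ QES M S, ∀ u, Good k z u → q.eval u • f u = g u

lemma RQ.add {z : Fin n → ℂ} {S : Set ℂ} {k : ℕ} {f g : ℂ → M} (hf : RQ z S k f) (hg : RQ z S k g) :
    RQ z S k (f + g) := by
  obtain ⟨q, hq, f', hf', hqf⟩ := hf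
  obtain ⟨r, hr, g', hg', hrg⟩ := hg
  refine ⟨q * r, fun u hu => ?_, _, Submodule.add_mem _ (QES.mulPoly r _ hf') (QES.mulPoly q _ hg'), fun u hu => ?_⟩
  · rw [eval_mul]; exact mul_ne_zero (hq u hu) (hr u hu)
  · simp only [Pi.add_apply]
    rw [← hqf u hu, ← hrg u hu, eval_mul, smul_add, smul_smul, smul_smul, mul_comm (eval u r)]

lemma RQ.zsmul {z : Fin n → ℂ} {S : Set ℂ} {k : ℕ} {f : ℂ → M} (c : ℤ) (hf : RQ z S k f) :
    RQ z S k (fun u => c • f u) := by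
  obtain ⟨q, hq, f', hf', hqf⟩ := hf
  refine ⟨q, hq, c • f', Submodule.smul_of_tower_mem _ c hf', fun u hu => ?_⟩
  rw [Pi.smul_apply, ← hqf u hu, smul_comm]

lemma RQ.sum {z : Fin n → ℂ} {S : Set ℂ} {k : ℕ} {ι : Type*} (s : Finset ι) (f : ι → ℂ → M)
    (hf : ∀ i ∈ s, RQ z S k (f i)) : RQ z S k (fun u => ∑ i ∈ s, f i u) := by
  classical
  induction s using Finset.induction_on with
  | empty => exact ⟨1, by simp, 0, Submodule.zero_mem _, by simp⟩
  | insert a s ha ih =>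
    have := (hf a (Finset.mem_insert_self _ _)).add (ih fun i hi => hf i (Finset.mem_insert_of_mem hi))
    convert this using 1
    funext u
    rw [Finset.sum_insert ha]; rfl

def IsRat (z : Fin n → ℂ) (X : ℂ → Fin N → Fin N → Module.End ℂ M) : Prop :=
  ∃ P : ℂ[X], (∀ u, (∀ j, u ≠ z j) → P.eval u ≠ 0) ∧ ∀ a b, ∃ (d : ℕ) (B : ℕ → Module.End ℂ M),
    ∀ u, (∀ j, u ≠ z j) → P.eval u • X u a b = ∑ k ∈ Finset.range d, u ^ k • B k

lemma RQ.step {z : Fin n → ℂ} {S : Set ℂ} {k : ℕ} {X : ℂ → Fin N → Fin N → Module.End ℂ M}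
    (hX : IsRat z X) (a b : Fin N) {f : ℂ → M} (hf : RQ z S k f) : RQ z S (k + 1) (XXop X a b f) := by
  obtain ⟨P, hP, hX⟩ := hX
  obtain ⟨d, B, hB⟩ := hX a b
  obtain ⟨q, hq, g, hg, hqg⟩ := hf
  have hz : ∀ u, Good (k + 1) z u → ∀ j, u ≠ z j := fun u hu j => by simpa using hu j 0 (by omega)
  have h1 : ∀ u, Good (k + 1) z u → Good k z u := fun u hu j i hi => hu j i (by omega)
  have h2 : ∀ u, Good (k + 1) z u → Good k z (u - 1) := fun u hu j i hi => by
    have := hu j (i + 1) (by omega)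
    push_cast at this
    rwa [sub_sub, add_comm 1]
  have hg2 : (fun u => ∑ k ∈ Finset.range d, u ^ k • B k (g (u - 1))) ∈ QES M S := by
    have : (fun u => ∑ k ∈ Finset.range d, u ^ k • B k (g (u - 1))) = 
        ∑ k ∈ Finset.range d, fun u => ((Polynomial.X : ℂ[X]) ^ k).eval u • B k (g (u + (-1))) := by
      funext u; rw [Finset.sum_apply]; simp [sub_eq_add_neg]
    rw [this]
    exact Submodule.sum_mem _ fun i _ => QES.mulPoly _ _ (QES.lin (B i) _ (QES.shift (-1) _ hg))
  have hg1 : (fun u => if a = b then g u else 0) ∈ QES M S := by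
    split_ifs
    · exact hg
    · exact Submodule.zero_mem _
  refine ⟨P * q.comp (Polynomial.X - 1) * q, fun u hu => ?_, _,
    Submodule.sub_mem _ (QES.mulPoly (P * q.comp (Polynomial.X - 1)) _ hg1) (QES.mulPoly q _ hg2), fun u hu => ?_⟩
  · simp only [eval_mul, eval_comp, eval_sub, eval_X, eval_one]
    exact mul_ne_zero (mul_ne_zero (hP u (hz u hu)) (hq _ (h2 u hu))) (hq _ (h1 u hu))
  · simp only [Pi.sub_apply, eval_mul, eval_comp, eval_sub, eval_X, eval_one, XXop]
    rw [smul_sub]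
    congr 1
    · split_ifs
      · rw [mul_smul, hqg u (h1 u hu)]
      · simp
    · rw [← hqg _ (h2 u hu), mul_comm, mul_smul]
      congr 1
      have := congrArg (fun A : Module.End ℂ M => A (q.eval (u - 1) • f (u - 1))) (hB u (hz u hu))
      simp only [LinearMap.sum_apply, LinearMap.smul_apply] at this
      rw [← this, map_smul, smul_smul]

lemma RQ.list {z : Fin n → ℂ} {S : Set ℂ} {X : ℂ → Fin N → Fin N → Module.End ℂ M}
    (hX : IsRat z X) {w : ℂ → M} (hw : w ∈ QES M S) : ∀ (m : ℕ) (f : Fin m → Fin N × Fin N),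
    RQ z S m (((List.ofFn fun i => XXop X (f i).1 (f i).2).foldr (· ∘ ·) id) w) := by
  intro m
  induction m with
  | zero => intro f; exact ⟨1, by simp, w, hw, by simp⟩
  | succ m ih =>
    intro f
    rw [List.ofFn_succ, List.foldr_cons]
    exact RQ.step hX _ _ (ih _)

lemma RQ.DD {z : Fin n → ℂ} {S : Set ℂ} {X : ℂ → Fin N → Fin N → Module.End ℂ M}
    (hX : IsRat z X) {w : ℂ → M} (hw : w ∈ QES M S) : RQ z S N (DD X w) :=
  RQ.sum _ _ fun σ _ => RQ.zsmul _ (RQ.list hX hw N (fun i => (i, σ i)))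

lemma good_large (z : Fin n → ℂ) (k : ℕ) (u0 : ℂ) : ∃ m0 : ℕ, ∀ m : ℕ, m0 ≤ m → Good k z (u0 + m) := by
  obtain ⟨m0, hm0⟩ := exists_nat_gt (∑ j, ‖z j‖ + k + ‖u0‖)
  refine ⟨m0, fun m hm j i hi h => ?_⟩
  have h1 : ‖z j‖ ≤ ∑ j, ‖z j‖ := Finset.single_le_sum (f := fun j => ‖z j‖) (fun _ _ => norm_nonneg _) (Finset.mem_univ j)
  have h2 : (m : ℂ) = z j + i - u0 := by rw [← h]; ring
  have h3 : (m : ℝ) = ‖(m : ℂ)‖ := by simp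
  have h4 : ‖z j + i - u0‖ ≤ ‖z j‖ + i + ‖u0‖ := by
    refine (norm_sub_le _ _).trans ?_
    have := norm_add_le (z j) (i : ℂ)
    rw [Complex.norm_natCast] at this
    linarith
  have h5 : (i : ℝ) < k := by exact_mod_cast hi
  have h6 : (m0 : ℝ) ≤ m := by exact_mod_cast hm
  rw [h2] at h3
  linarith

lemma DD_zero {z : Fin n → ℂ} {S : Finset ℂ} (hS : Set.InjOn Complex.exp (S : Set ℂ))
    {X : ℂ → Fin N → Fin N → Module.End ℂ M}
    (hX : IsRat z X) {w : ℂ → M} (hw : w ∈ QES M (S : Set ℂ)) (u0 : ℂ)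
    (h : ∃ m0 : ℕ, ∀ m, m0 ≤ m → DD X w (u0 + m) = 0) (u : ℂ) (hu : Good N z u) : DD X w u = 0 := by
  obtain ⟨q, hq, g, hg, hqg⟩ := RQ.DD hX hw
  obtain ⟨m0, h⟩ := h
  obtain ⟨m1, hm1⟩ := good_large z N u0
  have hg0 : g = 0 := QES.vanish hS u0 g hg ⟨max m0 m1, fun m hm => by
    rw [← hqg _ (hm1 m (le_trans (le_max_right _ _) hm)), h m (le_trans (le_max_left _ _) hm), smul_zero]⟩
  have := hqg u hu
  rw [hg0, Pi.zero_apply] at this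
  exact (smul_eq_zero.1 this).resolve_left (hq u hu)

/-! ### Delay -/
def Dly (M : Type*) [AddCommGroup M] [Module ℂ M] : Module.End ℂ (ℕ → M) where
  toFun f n := match n with
    | 0 => 0
    | n + 1 => f n
  map_add' f g := by funext n; cases n <;> simp
  map_smul' c f := by funext n; cases n <;> simp

lemma Dly_zero (f : ℕ → M) : Dly M f 0 = 0 := rfl
lemma Dly_succ (f : ℕ → M) (n : ℕ) : Dly M f (n + 1) = f n := rfl

lemma Yop_Dly (X : ℕ → Fin N → Fin N → Module.End ℂ M) (a b : Fin N) (f : ℕ → M) :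
    Yop X a b (Dly M f) = Dly M (Yop (fun n => X (n + 1)) a b f) := by
  funext n
  cases n with
  | zero => rw [Yop_zero, Dly_zero, Dly_zero]; simp
  | succ n =>
    rw [Yop_succ, Dly_succ, Dly_succ]
    cases n with
    | zero => rw [Dly_zero, Yop_zero, map_zero, sub_zero]
    | succ n => rw [Yop_succ, Dly_succ]

lemma Yop_Dly_list (X : ℕ → Fin N → Fin N → Module.End ℂ M) (f : ℕ → M) :
    ∀ (m : ℕ) (p : Fin m → Fin N × Fin N),
    (List.ofFn fun i => Yop X (p i).1 (p i).2).prod (Dly M f) =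
      Dly M ((List.ofFn fun i => Yop (fun n => X (n + 1)) (p i).1 (p i).2).prod f) := by
  intro m
  induction m with
  | zero => intro p; simp
  | succ m ih =>
    intro p
    rw [List.ofFn_succ, List.ofFn_succ, List.prod_cons, List.prod_cons, Module.End.mul_apply,
      Module.End.mul_apply, ih, Yop_Dly]

lemma rdet_Dly (X : ℕ → Fin N → Fin N → Module.End ℂ M) (f : ℕ → M) :
    rdet (Yop X) (Dly M f) = Dly M (rdet (Yop (fun n => X (n + 1))) f) := by
  rw [rdet, rdet, LinearMap.sum_apply, LinearMap.sum_apply, map_sum]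
  refine Finset.sum_congr rfl fun σ _ => ?_
  have := Yop_Dly_list X f N (fun i => (i, σ i))
  simp only at this
  rw [LinearMap.smul_apply, LinearMap.smul_apply, this]
  first | rw [map_zsmul] | rw [Units.smul_def, Units.smul_def, map_zsmul]

lemma delayed (j : ℕ) : ∀ (X : ℕ → Fin N → Fin N → Module.End ℂ M) (f : ℕ → M) (v : M),
    rdet (Yop (fun n => X (n + j))) f = Pi.single 0 v →
    ∃ s : ℕ → M, rdet (Yop X) s = Pi.single j v ∧ ∀ n, s (n + j) = f n := by
  induction j with
  | zero => intro X f v h; exact ⟨f, h, fun n => rfl⟩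
  | succ j ih =>
    intro X f v h
    obtain ⟨s, hs, hs2⟩ := ih (fun n => X (n + 1)) f v (by
      rw [← h]; congr 2)
    refine ⟨Dly M s, ?_, fun n => ?_⟩
    · rw [rdet_Dly, hs]
      funext n
      cases n with
      | zero => simp [Dly_zero]
      | succ n => rw [Dly_succ]; simp [Pi.single_apply]
    · rw [← add_assoc, Dly_succ, hs2]

/-! ### leading term -/
lemma lead_list (X : ℂ → Fin N → Fin N → Module.End ℂ M) (u0 : ℂ) (p : ℕ) (g : ℕ → M) (hg : ∀ n, p < n → g n = 0) :
    ∀ (m : ℕ) (f : Fin m → Fin N × Fin N),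
    (∀ n, p + m < n → (List.ofFn fun i => Yop (fun n => X (u0 + n)) (f i).1 (f i).2).prod g n = 0) ∧
    (List.ofFn fun i => Yop (fun n => X (u0 + n)) (f i).1 (f i).2).prod g (p + m) =
      (-1 : ℤ) ^ m • (List.ofFn fun i : Fin m => X (u0 + p + m - (i : ℕ)) (f i).1 (f i).2).prod (g p) := by
  intro m
  induction m with
  | zero => intro f; simpa using hg
  | succ m ih =>
    intro f
    obtain ⟨h1, h2⟩ := ih (fun i => f i.succ)
    rw [List.ofFn_succ, List.ofFn_succ, List.prod_cons, List.prod_cons, Module.End.mul_apply, Module.End.mul_apply]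
    constructor
    · intro n hn
      obtain ⟨n, rfl⟩ : ∃ k, n = k + 1 := ⟨n - 1, by omega⟩
      rw [Yop_succ, h1 _ (by omega), h1 _ (by omega)]; simp
    · rw [← add_assoc, Yop_succ, h1 _ (by omega), h2]
      simp only [Fin.val_zero, Fin.val_succ]
      push_cast
      have e : (fun i : Fin m => X (u0 + p + (m + 1) - ((i : ℕ) + 1)) (f i.succ).1 (f i.succ).2) =
        fun i : Fin m => X (u0 + p + m - (i : ℕ)) (f i.succ).1 (f i.succ).2 := by
        funext i
        rw [show u0 + (p : ℂ) + (m + 1) - ((i : ℕ) + 1) = u0 + p + m - (i : ℕ) by ring]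
      rw [e, ite_self, zero_sub, map_zsmul, pow_succ, mul_neg_one, neg_smul]
      congr 4; ring_nf

lemma lead (X : ℂ → Fin N → Fin N → Module.End ℂ M) (u0 : ℂ) (p : ℕ) (g : ℕ → M) (hg : ∀ n, p < n → g n = 0) :
    rdet (Yop (fun n => X (u0 + n))) g (p + N) = (-1 : ℤ) ^ N • Theta X (u0 + p + N) (g p) := by
  rw [rdet, Theta, LinearMap.sum_apply, LinearMap.sum_apply, Finset.sum_apply, Finset.smul_sum]
  refine Finset.sum_congr rfl fun σ _ => ?_
  have := (lead_list X u0 p g hg N (fun i => (i, σ i))).2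
  simp only at this
  rw [LinearMap.smul_apply, LinearMap.smul_apply, Pi.smul_apply, this, smul_comm]
end Core
end XXXModel

namespace XXXModel
open Polynomial

lemma merom_eventually {c : ℂ → ℂ} {x : ℂ} (h : MeromAt c x) : ∀ᶠ y in nhdsWithin x {x}ᶜ, AnalyticAt ℂ c y := by
  obtain ⟨k, hk⟩ := h
  have h1 := hk.eventually_analyticAt
  filter_upwards [h1.filter_mono nhdsWithin_le_nhds, self_mem_nhdsWithin] with y hy hyx
  have h2 : AnalyticAt ℂ (fun z => ((z - x) ^ k)⁻¹) y := by
    refine AnalyticAt.inv ?_ (pow_ne_zero _ (sub_ne_zero.2 hyx))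
    fun_prop
  refine (h2.mul hy).congr ?_
  have : ∀ᶠ z in nhds y, z ≠ x := isOpen_ne.mem_nhds hyx
  filter_upwards [this] with z hz
  have := pow_ne_zero k (sub_ne_zero.2 hz)
  simp only [Pi.mul_apply]
  field_simp

lemma analytic_shift {c : ℂ → ℂ} (hp : ∀ x, c (x + 1) = c x) {x : ℂ} (h : AnalyticAt ℂ c x) (m : ℕ) :
    AnalyticAt ℂ c (x + m) := by
  induction m with
  | zero => simpa using h
  | succ m ih =>
    have h2 : AnalyticAt ℂ (fun y => c (y - 1)) (x + m + 1) := by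
      have : AnalyticAt ℂ c ((fun y : ℂ => y - 1) (x + m + 1)) := by simpa using ih
      exact this.comp_of_eq (by fun_prop) rfl
    have h3 : (fun y => c (y - 1)) = c := by
      funext y
      have := hp (y - 1)
      rw [sub_add_cancel] at this; exact this.symm
    rw [h3] at h2
    push_cast
    rwa [← add_assoc]

lemma periodic_nat {c : ℂ → ℂ} (hp : ∀ x, c (x + 1) = c x) (x : ℂ) (m : ℕ) : c (x + m) = c x := by
  induction m with
  | zero => simp
  | succ m ih => push_cast; rw [← add_assoc, hp, ih]

section
variable {N n : ℕ} {M : Type*} [AddCommGroup M] [Module ℂ M]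

lemma indep_of_lin {S : Finset ℂ} (hS : Set.InjOn Complex.exp (S : Set ℂ)) {ι : Type*} [Fintype ι]
    (F : ι → ℂ → M) (hF : ∀ i, F i ∈ QES M (S : Set ℂ)) (hlin : LinearIndependent ℂ F) : IndepPeriodic F := by
  intro c hm hp hsum
  have h1 : ∀ x, (∀ i, AnalyticAt ℂ (c i) x) → ∀ i, c i x = 0 := by
    intro x hx
    have : ∑ i, c i x • F i = 0 := by
      refine QES.vanish hS x _ (Submodule.sum_mem _ fun i _ => Submodule.smul_mem _ _ (hF i)) ⟨0, fun m _ => ?_⟩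
      have := hsum (x + m) (fun i => analytic_shift (hp i) (hx i) m)
      rw [← this, Finset.sum_apply]
      refine Finset.sum_congr rfl fun i _ => ?_
      rw [periodic_nat (hp i)]; rfl
    exact Fintype.linearIndependent_iff.1 hlin _ this
  intro i x hx
  have h2 : ∀ᶠ y in nhdsWithin x {x}ᶜ, c i y = 0 := by
    have : ∀ᶠ y in nhdsWithin x {x}ᶜ, ∀ i, AnalyticAt ℂ (c i) y :=
      Filter.eventually_all.2 fun i => merom_eventually (hm i x)
    filter_upwards [this] with y hy using h1 y hy i
  have h3 : Filter.Tendsto (c i) (nhdsWithin x {x}ᶜ) (nhds (c i x)) := hx.continuousAt.tendsto.mono_left nhdsWithin_le_nhds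
  have h4 : Filter.Tendsto (c i) (nhdsWithin x {x}ᶜ) (nhds 0) :=
    tendsto_const_nhds.congr' (h2.mono fun y hy => hy.symm)
  exact tendsto_nhds_unique h3 h4

theorem core [FiniteDimensional ℂ M] (z : Fin n → ℂ) (X : ℂ → Fin N → Fin N → Module.End ℂ M)
    (Q : Matrix (Fin N) (Fin N) ℂ) (hQ : IsUnit Q.det) (hX : IsRat z X)
    (hinj : ∃ R : ℝ, ∀ u : ℝ, R ≤ u → Function.Injective (Theta X (u : ℂ)))
    (hH : ∃ R : ℝ, ∀ u0 : ℝ, R ≤ u0 → ∀ v : M, ∃ f : ℕ → M,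
      rdet (Yop (fun n => X ((u0 : ℂ) + n))) f = Pi.single 0 v ∧ Rec Q.charpoly f) :
    ∃ F : Fin (N * Module.finrank ℂ M) → ℂ → M, (∀ i, IsQE (F i)) ∧
      (∀ i u, Good N z u → DD X (F i) u = 0) ∧ IndepPeriodic F := by
  classical
  obtain ⟨R1, hinj⟩ := hinj
  obtain ⟨R2, hH⟩ := hH
  set u0 : ℝ := max R1 R2 with hu0
  set S : Finset ℂ := Q.charpoly.roots.toFinset.image Complex.log with hSdef
  have hr0 : ∀ q ∈ Q.charpoly.roots, q ≠ 0 := by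
    rintro q hq rfl
    rw [mem_roots Q.charpoly_monic.ne_zero, IsRoot.def] at hq
    have := Q.det_eq_sign_charpoly_coeff
    rw [coeff_zero_eq_eval_zero, hq, mul_zero] at this
    rw [this] at hQ
    exact not_isUnit_zero hQ
  have hSr : ∀ q ∈ Q.charpoly.roots, ∃ l ∈ (S : Set ℂ), Complex.exp l = q := by
    intro q hq
    refine ⟨Complex.log q, ?_, Complex.exp_log (hr0 q hq)⟩
    rw [hSdef, Finset.mem_coe, Finset.mem_image]
    exact ⟨q, Multiset.mem_toFinset.2 hq, rfl⟩
  have hS : Set.InjOn Complex.exp (S : Set ℂ) := by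
    intro a ha b hb hab
    rw [hSdef, Finset.mem_coe, Finset.mem_image] at ha hb
    obtain ⟨p, hp, rfl⟩ := ha
    obtain ⟨q, hq, rfl⟩ := hb
    rw [Multiset.mem_toFinset] at hp hq
    rw [Complex.exp_log (hr0 p hp), Complex.exp_log (hr0 q hq)] at hab
    rw [hab]
  have step : ∀ (j : Fin N) (v : M), ∃ s : ℕ → M, ∃ w ∈ QES M (S : Set ℂ),
      rdet (Yop (fun n => X ((u0 : ℂ) + n))) s = Pi.single (j : ℕ) v ∧ ∀ n, (j : ℕ) ≤ n → s n = w (u0 + n) := by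
    intro j v
    obtain ⟨f, hf, hrec⟩ := hH (u0 + (j : ℕ)) ((le_max_right R1 R2).trans (by simp [hu0])) v
    obtain ⟨s, hs, hsf⟩ := delayed (j : ℕ) (fun n => X ((u0 : ℂ) + n)) f v (by
      rw [← hf]
      have : (fun n : ℕ => X ((u0 : ℂ) + ((n + (j : ℕ) : ℕ) : ℂ))) = fun n : ℕ => X (((u0 + (j : ℕ) : ℝ) : ℂ) + n) := by
        funext n; congr 1; push_cast; ring
      rw [this])
    obtain ⟨w, hw, hwf⟩ := QES.of_rec Q.charpoly_monic hSr ((u0 : ℂ) + (j : ℕ)) f hrec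
    refine ⟨s, w, hw, hs, fun n hn => ?_⟩
    obtain ⟨m, rfl⟩ := Nat.exists_eq_add_of_le' hn
    rw [hsf, hwf]; congr 1; push_cast; ring
  choose s w hw hs hsw using step
  let b := Module.finBasis ℂ M
  have hlin : LinearIndependent ℂ (fun p : Fin N × Fin (Module.finrank ℂ M) => w p.1 (b p.2)) := by
    rw [Fintype.linearIndependent_iff]
    intro c hc
    set g : ℕ → M := ∑ p : Fin N × Fin (Module.finrank ℂ M), c p • s p.1 (b p.2) with hg
    have hDg : rdet (Yop (fun n => X ((u0 : ℂ) + n))) g =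
        ∑ p : Fin N × Fin (Module.finrank ℂ M), c p • (Pi.single (p.1 : ℕ) (b p.2) : ℕ → M) := by
      rw [hg, map_sum]
      refine Finset.sum_congr rfl fun p _ => ?_
      rw [map_smul, hs]
    have hgN : ∀ n, N ≤ n → g n = 0 := by
      intro n hn
      have := congrFun hc (u0 + n)
      rw [Finset.sum_apply] at this
      rw [hg, Finset.sum_apply]
      simp only [Pi.smul_apply, Pi.zero_apply] at this ⊢
      rw [← this]
      refine Finset.sum_congr rfl fun p _ => ?_
      rw [hsw _ _ n (by omega)]
    have hdesc : ∀ k : ℕ, ∀ n, N ≤ n + k → g n = 0 := by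
      intro k
      induction k with
      | zero => intro n hn; exact hgN n hn
      | succ k ih =>
        intro n hn
        have h1 := lead X (u0 : ℂ) n g (fun m hm => ih m (by omega))
        have h2 : rdet (Yop (fun n => X ((u0 : ℂ) + n))) g (n + N) = 0 := by
          rw [hDg, Finset.sum_apply]
          refine Finset.sum_eq_zero fun p _ => ?_
          rw [Pi.smul_apply, Pi.single_eq_of_ne (by omega), smul_zero]
        rw [h2] at h1
        have h3 : Theta X ((u0 : ℂ) + n + N) (g n) = 0 := by
          rcases Nat.even_or_odd N with h | h
          · rw [h.neg_one_pow, one_smul] at h1; exact h1.symm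
          · rw [h.neg_one_pow, neg_smul, one_smul, eq_comm, neg_eq_zero] at h1; exact h1
        have h4 := hinj (u0 + n + N) ((le_max_left R1 R2).trans (by
          rw [← hu0]; have : (0:ℝ) ≤ n := Nat.cast_nonneg _; have : (0:ℝ) ≤ N := Nat.cast_nonneg _; linarith))
        push_cast at h4
        exact h4 (by rw [h3, map_zero])
    have hg0 : g = 0 := by funext n; exact hdesc N n (by omega)
    rw [hg0, map_zero] at hDg
    rintro ⟨j, i⟩
    have h5 := congrFun hDg (j : ℕ)
    rw [Finset.sum_apply, Fintype.sum_prod_type, Finset.sum_eq_single_of_mem j (Finset.mem_univ _)] at h5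
    · simp only [Pi.smul_apply, Pi.single_eq_same, Pi.zero_apply] at h5
      exact Fintype.linearIndependent_iff.1 b.linearIndependent (fun i => c (j, i)) h5.symm i
    · intro j' _ hj
      refine Finset.sum_eq_zero fun i _ => ?_
      rw [Pi.smul_apply, Pi.single_eq_of_ne (fun h => hj (Fin.ext h.symm)), smul_zero]
  let e := (finProdFinEquiv (m := N) (n := Module.finrank ℂ M)).symm
  refine ⟨fun i => w (e i).1 (b (e i).2), fun i => QES.isQE _ (hw _ _), fun i => ?_, ?_⟩
  · refine DD_zero hS hX (hw _ _) (u0 : ℂ) ⟨N + N, fun m hm => ?_⟩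
    rw [← local_DD X u0 _ (s (e i).1 (b (e i).2)) N (fun n hn => hsw _ _ n (by omega)) m hm, hs,
      Pi.single_eq_of_ne (by omega)]
  · exact indep_of_lin hS _ (fun i => hw _ _) (hlin.comp e e.injective)
end
end XXXModel

namespace XXXModel
open Polynomial

section Rat
variable {N n : ℕ} {M : Type*} [AddCommGroup M] [Module ℂ M]

lemma QES.poly_repr {V : Type*} [AddCommGroup V] [Module ℂ V] (A : ℂ → V) (hA : A ∈ QES V {0}) :
    ∃ (d : ℕ) (B : ℕ → V), ∀ u, A u = ∑ k ∈ Finset.range d, u ^ k • B k := by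
  suffices h : ∃ p : ℕ →₀ V, ∀ u, A u = p.sum fun k B => u ^ k • B by
    obtain ⟨p, hp⟩ := h
    refine ⟨p.support.sup id + 1, p, fun u => ?_⟩
    rw [hp u]
    refine Finsupp.sum_of_support_subset _ ?_ _ (by simp)
    intro k hk
    exact Finset.mem_range.2 (Nat.lt_succ_of_le (Finset.le_sup (f := id) hk))
  refine QES.induct (P := fun A => ∃ p : ℕ →₀ V, ∀ u, A u = p.sum fun k B => u ^ k • B) ?_ ?_ ?_ A hA
  · intro l hl p v
    rw [Set.mem_singleton_iff] at hl
    subst hl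
    refine ⟨∑ i ∈ Finset.range (p.natDegree + 1), Finsupp.single i (p.coeff i • v), fun u => ?_⟩
    rw [← Finsupp.sum_finset_sum_index (by simp) (by simp)]
    simp only [zero_mul, Complex.exp_zero, one_mul]
    rw [eval_eq_sum_range, Finset.sum_smul]
    refine Finset.sum_congr rfl fun i _ => ?_
    rw [Finsupp.sum_single_index (by simp), smul_smul, mul_comm]
  · exact ⟨0, by simp⟩
  · rintro f g ⟨p, hp⟩ ⟨q, hq⟩
    refine ⟨p + q, fun u => ?_⟩
    rw [Pi.add_apply, hp, hq, Finsupp.sum_add_index' (by simp) (by simp)]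

lemma XL_rat (Q : Matrix (Fin N) (Fin N) ℂ) (z : Fin n → ℂ) (l : List (Site N (Module.End ℂ M)))
    (hz : ∀ s ∈ l, ∃ j, s.2 = z j) :
    ∃ P : ℂ[X], (∀ u, (∀ j, u ≠ z j) → P.eval u ≠ 0) ∧ ∀ a b, ∃ A ∈ QES (Module.End ℂ M) {0},
      ∀ u, (∀ j, u ≠ z j) → P.eval u • XL Q u l a b = A u := by
  induction l with
  | nil =>
    refine ⟨1, by simp, fun a b => ⟨_, QES.gen (Set.mem_singleton 0) (C 1) (algebraMap ℂ (Module.End ℂ M) (Q a b)), ?_⟩⟩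
    intro u _
    simp [XL]
  | cons s l ih =>
    obtain ⟨P, hP, h⟩ := ih fun s hs => hz s (List.mem_cons_of_mem _ hs)
    obtain ⟨j, hj⟩ := hz s List.mem_cons_self
    choose A hA hAe using h
    refine ⟨P * (X - C (s.2)), fun u hu => ?_, fun a b => ?_⟩
    · rw [eval_mul, eval_sub, eval_X, eval_C, hj]
      exact mul_ne_zero (hP u hu) (sub_ne_zero.2 (hu j))
    · refine ⟨(fun u => (X - C (s.2)).eval u • A a b u) + ∑ c, fun u => (LinearMap.mulRight ℂ (s.1 b c)) (A a c u),
        Submodule.add_mem _ (QES.mulPoly _ _ (hA a b)) (Submodule.sum_mem _ fun c _ => QES.lin _ _ (hA a c)), ?_⟩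
      intro u hu
      have hu' : u - s.2 ≠ 0 := by rw [hj]; exact sub_ne_zero.2 (hu j)
      rw [Pi.add_apply, Finset.sum_apply]
      simp only [XL, mmul, Lsite, eval_mul, eval_sub, eval_X, eval_C, LinearMap.mulRight_apply, ← hAe _ _ u hu,
        mul_add, Finset.sum_add_distrib, smul_add, mul_ite, mul_one, mul_zero, Finset.sum_ite_eq', Finset.mem_univ, if_true]
      congr 1
      · rw [smul_smul, mul_comm]
      · rw [Finset.smul_sum]
        refine Finset.sum_congr rfl fun c _ => ?_
        rw [mul_smul_comm, smul_smul, mul_assoc, mul_inv_cancel₀ hu', mul_one, smul_mul_assoc]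

lemma XL_isRat (Q : Matrix (Fin N) (Fin N) ℂ) (z : Fin n → ℂ) (l : List (Site N (Module.End ℂ M)))
    (hz : ∀ s ∈ l, ∃ j, s.2 = z j) : IsRat z (fun u => XL Q u l) := by
  obtain ⟨P, hP, h⟩ := XL_rat Q z l hz
  refine ⟨P, hP, fun a b => ?_⟩
  obtain ⟨A, hA, hAe⟩ := h a b
  obtain ⟨d, B, hB⟩ := QES.poly_repr A hA
  exact ⟨d, B, fun u hu => by rw [hAe u hu, hB]⟩

lemma XL_tendsto {d : ℕ} (β : Module.End ℂ M ≃ₐ[ℂ] Matrix (Fin d) (Fin d) ℂ)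
    (Q : Matrix (Fin N) (Fin N) ℂ) (l : List (Site N (Module.End ℂ M))) (k : ℝ) (a b : Fin N) :
    Filter.Tendsto (fun u : ℝ => β (XL Q (u - k) l a b)) Filter.atTop
      (nhds (algebraMap ℂ (Matrix (Fin d) (Fin d) ℂ) (Q a b))) := by
  induction l generalizing a b with
  | nil => simp only [XL]; rw [AlgEquiv.commutes]; exact tendsto_const_nhds
  | cons s l ih =>
    have hinv : Filter.Tendsto (fun u : ℝ => ((u : ℂ) - k - s.2)⁻¹) Filter.atTop (nhds 0) := by
      refine Filter.tendsto_inv₀_cobounded.comp ?_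
      rw [← tendsto_norm_atTop_iff_cobounded]
      refine Filter.tendsto_atTop_mono (f := fun u : ℝ => u + (-k - s.2.re)) (fun u => ?_)
        (Filter.tendsto_atTop_add_const_right _ _ Filter.tendsto_id)
      refine le_trans (le_of_eq ?_) (Complex.re_le_norm _)
      simp; ring
    have hL : ∀ c, Filter.Tendsto (fun u : ℝ => β (Lsite s (u - k) c b)) Filter.atTop
        (nhds (if c = b then 1 else 0)) := by
      intro c
      have h2 := (tendsto_const_nhds (x := (if c = b then (1 : Matrix (Fin d) (Fin d) ℂ) else 0))
        (f := (Filter.atTop : Filter ℝ))).add (hinv.smul_const (β (s.1 b c)))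
      rw [zero_smul, add_zero] at h2
      refine h2.congr fun u => ?_
      simp only [Lsite, map_add, map_smul]
      congr 1
      split_ifs <;> simp
    simp only [XL, mmul, map_sum, map_mul]
    have := tendsto_finset_sum Finset.univ fun c (_ : c ∈ Finset.univ) => (ih a c).mul (hL c)
    refine this.trans (le_of_eq ?_)
    congr 1
    simp

lemma Theta_inj [FiniteDimensional ℂ M] (Q : Matrix (Fin N) (Fin N) ℂ) (hQ : IsUnit Q.det)
    (l : List (Site N (Module.End ℂ M))) :
    ∃ R : ℝ, ∀ u : ℝ, R ≤ u → Function.Injective (Theta (fun u => XL Q u l) (u : ℂ)) := by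
  let β := LinearMap.toMatrixAlgEquiv (Module.finBasis ℂ M)
  have h1 : Filter.Tendsto (fun u : ℝ => β (Theta (fun u => XL Q u l) (u : ℂ))) Filter.atTop
      (nhds (algebraMap ℂ _ Q.det)) := by
    have e : (algebraMap ℂ (Matrix (Fin (Module.finrank ℂ M)) (Fin (Module.finrank ℂ M)) ℂ) Q.det) =
      ∑ σ : Equiv.Perm (Fin N), ((Equiv.Perm.sign σ : ℤˣ) : ℤ) •
      (List.ofFn fun a : Fin N => algebraMap ℂ (Matrix (Fin (Module.finrank ℂ M)) (Fin (Module.finrank ℂ M)) ℂ) (Q a (σ a))).prod := by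
      rw [← Matrix.det_transpose, Matrix.det_apply, map_sum]
      refine Finset.sum_congr rfl fun σ _ => ?_
      rw [Units.smul_def, map_zsmul]
      congr 1
      rw [← List.prod_ofFn, map_list_prod, List.map_ofFn]
      rfl
    rw [e]
    simp only [Theta, map_sum, map_zsmul]
    refine tendsto_finset_sum _ fun σ _ => Filter.Tendsto.const_smul ?_ _
    have gen : ∀ (m : ℕ) (p : Fin m → Fin N × Fin N),
        Filter.Tendsto (fun u : ℝ => β (List.ofFn fun a : Fin m => XL Q ((u : ℂ) - (a : ℕ)) l (p a).1 (p a).2).prod)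
        Filter.atTop (nhds (List.ofFn fun a : Fin m => algebraMap ℂ _ (Q (p a).1 (p a).2)).prod) := by
      intro m p
      simp only [map_list_prod, List.map_ofFn]
      have : ∀ (m : ℕ) (f : Fin m → ℝ → Matrix (Fin (Module.finrank ℂ M)) (Fin (Module.finrank ℂ M)) ℂ) (g : Fin m → _),
        (∀ i, Filter.Tendsto (f i) Filter.atTop (nhds (g i))) →
        Filter.Tendsto (fun u => (List.ofFn fun i => f i u).prod) Filter.atTop (nhds (List.ofFn g).prod) := by
        intro m
        induction m with
        | zero => intro f g _; simpa using tendsto_const_nhds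
        | succ m ih =>
          intro f g h
          simp only [List.ofFn_succ, List.prod_cons]
          exact (h 0).mul (ih _ _ fun i => h i.succ)
      refine this m (fun a u => β (XL Q ((u : ℂ) - (a : ℕ)) l (p a).1 (p a).2)) _ fun a => ?_
      have := XL_tendsto β Q l ((a : ℕ) : ℝ) (p a).1 (p a).2
      simpa using this
    exact gen N (fun i => (i, σ i))
  have h2 := (Continuous.matrix_det continuous_id).continuousAt.tendsto.comp h1
  have h3 : (algebraMap ℂ (Matrix (Fin (Module.finrank ℂ M)) (Fin (Module.finrank ℂ M)) ℂ) Q.det).det ≠ 0 := by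
    rw [Matrix.algebraMap_eq_diagonal, Matrix.det_diagonal]
    simp [hQ.ne_zero]
  have h4 := h2.eventually_ne h3
  rw [Filter.eventually_atTop] at h4
  obtain ⟨R, hR⟩ := h4
  refine ⟨R, fun u hu => ?_⟩
  have h5 := hR u hu
  simp only [Function.comp] at h5
  have h6 : IsUnit (β (Theta (fun u => XL Q u l) (u : ℂ))) := (Matrix.isUnit_iff_isUnit_det _).2 (isUnit_iff_ne_zero.2 h5)
  have h7 : IsUnit (Theta (fun u => XL Q u l) (u : ℂ)) := by simpa using h6.map β.symm
  exact ((Module.End.isUnit_iff _).1 h7).injective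
end Rat

section Transport
variable {N n : ℕ} {M M' : Type*} [AddCommGroup M] [Module ℂ M] [AddCommGroup M'] [Module ℂ M']

lemma causal_list (X : ℕ → Fin N → Fin N → Module.End ℂ M') (W : Submodule ℂ M')
    (hW : ∀ n a b, ∀ x ∈ W, X (n + 1) a b x ∈ W) (f : ℕ → M') (n : ℕ) (hf : ∀ m, m < n → f m ∈ W) :
    ∀ (k : ℕ) (p : Fin k → Fin N × Fin N),
    (∀ m, m < n → (List.ofFn fun i => Yop X (p i).1 (p i).2).prod f m ∈ W) ∧
    (List.ofFn fun i => Yop X (p i).1 (p i).2).prod f n - (if ∀ i, (p i).1 = (p i).2 then f n else 0) ∈ W := by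
  have hX : ∀ (g : ℕ → M') (m : ℕ), (∀ m', m' < m → g m' ∈ W) → ∀ a b, Yop X a b g m - (if a = b then g m else 0) ∈ W := by
    intro g m hg a b
    cases m with
    | zero => rw [Yop_zero, sub_self]; exact W.zero_mem
    | succ m =>
      rw [Yop_succ, sub_sub_cancel_left]
      exact W.neg_mem (hW m a b _ (hg m (by omega)))
  intro k
  induction k with
  | zero => intro p; simpa using hf
  | succ k ih =>
    intro p
    obtain ⟨h1, h2⟩ := ih (fun i => p i.succ)
    rw [List.ofFn_succ, List.prod_cons, Module.End.mul_apply]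
    set g := (List.ofFn fun i : Fin k => Yop X (p i.succ).1 (p i.succ).2).prod f with hg
    refine ⟨fun m hm => ?_, ?_⟩
    · have := W.add_mem (hX g m (fun m' hm' => h1 m' (by omega)) (p 0).1 (p 0).2)
        (show (if (p 0).1 = (p 0).2 then g m else 0) ∈ W by
          split_ifs
          · exact h1 m hm
          · exact W.zero_mem)
      rwa [sub_add_cancel] at this
    · have h3 := hX g n h1 (p 0).1 (p 0).2
      simp only [Fin.forall_fin_succ]
      by_cases h0 : (p 0).1 = (p 0).2
      · simp only [h0, true_and, if_true] at h3 ⊢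
        have := W.add_mem h3 h2
        rwa [sub_add_sub_cancel] at this
      · simpa [h0] using h3

lemma causal (X : ℕ → Fin N → Fin N → Module.End ℂ M') (W : Submodule ℂ M')
    (hW : ∀ n a b, ∀ x ∈ W, X (n + 1) a b x ∈ W) (f : ℕ → M')
    (hf : ∀ n, rdet (Yop X) f n ∈ W) : ∀ n, f n ∈ W := by
  intro n
  induction n using Nat.strong_induction_on with
  | _ n ih =>
    have h := hf n
    have h2 : rdet (Yop X) f n - f n ∈ W := by
      have e : f n = ∑ σ : Equiv.Perm (Fin N), ((Equiv.Perm.sign σ : ℤˣ) : ℤ) • (if ∀ i, i = σ i then f n else 0) := by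
        rw [Finset.sum_eq_single_of_mem 1 (Finset.mem_univ _)]
        · simp
        · intro σ _ hσ
          rw [if_neg, smul_zero]
          intro h; exact hσ (Equiv.ext fun i => (h i).symm)
      rw [rdet, LinearMap.sum_apply, Finset.sum_apply]
      refine Eq.mpr (congrArg (fun y => _ - y ∈ W) e) ?_
      rw [← Finset.sum_sub_distrib]
      refine W.sum_mem fun σ _ => ?_
      rw [LinearMap.smul_apply, Pi.smul_apply, ← smul_sub]
      exact Submodule.smul_of_tower_mem _ _ (causal_list X W hW f n ih N (fun i => (i, σ i))).2
    have := W.sub_mem h h2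
    rwa [sub_sub_cancel] at this

lemma intertw (X : ℕ → Fin N → Fin N → Module.End ℂ M) (X' : ℕ → Fin N → Fin N → Module.End ℂ M') (ι : M →ₗ[ℂ] M')
    (h : ∀ n a b x, X' (n + 1) a b (ι x) = ι (X (n + 1) a b x)) (f : ℕ → M) :
    rdet (Yop X') (fun n => ι (f n)) = fun n => ι (rdet (Yop X) f n) := by
  have gen : ∀ (m : ℕ) (p : Fin m → Fin N × Fin N), (List.ofFn fun i => Yop X' (p i).1 (p i).2).prod (fun n => ι (f n)) =
      fun n => ι ((List.ofFn fun i => Yop X (p i).1 (p i).2).prod f n) := by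
    intro m
    induction m with
    | zero => intro p; simp
    | succ m ih =>
      intro p
      rw [List.ofFn_succ, List.ofFn_succ, List.prod_cons, List.prod_cons, Module.End.mul_apply, Module.End.mul_apply, ih]
      funext n
      cases n with
      | zero => rw [Yop_zero, Yop_zero]; split_ifs <;> simp
      | succ n => rw [Yop_succ, Yop_succ, h, map_sub]; split_ifs <;> simp
  funext n
  rw [rdet, rdet, LinearMap.sum_apply, LinearMap.sum_apply, Finset.sum_apply, Finset.sum_apply, map_sum]
  refine Finset.sum_congr rfl fun σ _ => ?_
  have := congrFun (gen N (fun i => (i, σ i))) n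
  simp only at this
  rw [LinearMap.smul_apply, LinearMap.smul_apply, Pi.smul_apply, Pi.smul_apply, this, map_zsmul]

theorem reduction [FiniteDimensional ℂ M] (hN : 0 < N) (z : Fin n → ℂ) (l : List (Site N (Module.End ℂ M)))
    (hz : ∀ s ∈ l, ∃ j, s.2 = z j) (Q : Matrix (Fin N) (Fin N) ℂ) (hQ : IsUnit Q.det)
    (l' : List (Site N (Module.End ℂ M'))) (hmu : ∀ s ∈ l', MU s) (hc : l'.Pairwise SComm)
    (ι : M →ₗ[ℂ] M') (hι : Function.Injective ι)
    (hinter : ∃ R : ℝ, ∀ u : ℝ, R ≤ u → ∀ a b x, XL Q u l' a b (ι x) = ι (XL Q u l a b x)) :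
    ∃ F : Fin (N * Module.finrank ℂ M) → ℂ → M, (∀ i, IsQE (F i)) ∧
      (∀ i u, Good N z u → DD (fun u => XL Q u l) (F i) u = 0) ∧ IndepPeriodic F := by
  refine core z _ Q hQ (XL_isRat Q z l hz) (Theta_inj Q hQ l) ?_
  obtain ⟨R, hR⟩ := hinter
  obtain ⟨R', hR'⟩ : ∃ R' : ℝ, ∀ s ∈ l', s.2.re ≤ R' := by
    clear hmu hc hR
    induction l' with
    | nil => exact ⟨0, by simp⟩
    | cons s l ih =>
      obtain ⟨R', h⟩ := ih
      refine ⟨max R' s.2.re, fun t ht => ?_⟩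
      rcases List.mem_cons.1 ht with rfl | ht
      · exact le_max_right _ _
      · exact (h t ht).trans (le_max_left _ _)
  obtain ⟨r, hr⟩ := ι.exists_leftInverse_of_injective (LinearMap.ker_eq_bot.2 hι)
  have hr' : ∀ x, r (ι x) = x := fun x => by rw [← LinearMap.comp_apply, hr]; rfl
  refine ⟨max R R', fun u0 hu0 v => ?_⟩
  obtain ⟨f', hf', hrec⟩ := impulse hN Q l' hmu hc (u0 : ℂ) (by
    intro s hs n h
    have h1 := hR' s hs
    have h2 := congrArg Complex.re h
    simp only [Complex.add_re, Complex.sub_re, Complex.ofReal_re, Complex.one_re, Complex.natCast_re, Complex.zero_re] at h2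
    have : R' ≤ u0 := (le_max_right _ _).trans hu0
    have : (0 : ℝ) ≤ n := Nat.cast_nonneg _
    linarith) (ι v)
  have hin : ∀ (n : ℕ) a b x, XL Q ((u0 : ℂ) + ((n + 1 : ℕ) : ℂ)) l' a b (ι x) = ι (XL Q ((u0 : ℂ) + ((n + 1 : ℕ) : ℂ)) l a b x) := by
    intro n a b x
    have := hR (u0 + (n + 1 : ℕ)) ((le_max_left _ _).trans (hu0.trans (by
      have : (0 : ℝ) ≤ (n + 1 : ℕ) := Nat.cast_nonneg _
      linarith))) a b x
    push_cast at this ⊢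
    exact this
  have hW : ∀ n, f' n ∈ LinearMap.range ι := by
    refine causal (fun n => XL Q ((u0 : ℂ) + n) l') (LinearMap.range ι) ?_ f' ?_
    · rintro n a b _ ⟨x, rfl⟩
      exact ⟨_, (hin n a b x).symm⟩
    · intro n
      rw [hf']
      by_cases h : n = 0
      · subst h; rw [Pi.single_eq_same]; exact ⟨v, rfl⟩
      · rw [Pi.single_eq_of_ne h]; exact Submodule.zero_mem _
  have hff : f' = fun n => ι (r (f' n)) := by
    funext n
    obtain ⟨x, hx⟩ := hW n
    rw [← hx, hr']
  refine ⟨fun n => r (f' n), ?_, hrec.linmap r⟩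
  have h3 := intertw (fun n => XL Q ((u0 : ℂ) + n) l) (fun n => XL Q ((u0 : ℂ) + n) l') ι hin (fun n => r (f' n))
  rw [← hff, hf'] at h3
  funext n
  apply hι
  rw [← congrFun h3 n]
  by_cases h : n = 0
  · subst h; simp
  · rw [Pi.single_eq_of_ne h, Pi.single_eq_of_ne h, map_zero]

end Transport
end XXXModel

namespace XXXModel

section Irr
variable {N : ℕ} {W : Type*} [AddCommGroup W] [Module ℂ W]

/-- the `gl_N` relations -/
def Gl (E : Fin N → Fin N → Module.End ℂ W) : Prop := ∀ a b c d,
  E a b * E c d - E c d * E a b = (if b = c then E a d else 0) - (if d = a then E c b else 0)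

lemma common_eig [FiniteDimensional ℂ W] {ι : Type*} (A : ι → Module.End ℂ W) (hA : ∀ i j, Commute (A i) (A j))
    (s : Finset ι) : ∀ p : Submodule ℂ W, p ≠ ⊥ → (∀ i, ∀ x ∈ p, A i x ∈ p) →
    ∃ p' ≤ p, p' ≠ ⊥ ∧ (∀ i, ∀ x ∈ p', A i x ∈ p') ∧ ∀ i ∈ s, ∃ μ : ℂ, ∀ x ∈ p', A i x = μ • x := by
  classical
  induction s using Finset.induction_on with
  | empty => intro p hp hi; exact ⟨p, le_rfl, hp, hi, by simp⟩
  | insert i s hi ih =>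
    intro p hp hinv
    obtain ⟨p1, h1, h2, h3, h4⟩ := ih p hp hinv
    haveI : Nontrivial p1 := Submodule.nontrivial_iff_ne_bot.2 h2
    obtain ⟨μ, hμ⟩ := Module.End.exists_eigenvalue ((A i).restrict (h3 i))
    obtain ⟨x, hx⟩ := hμ.exists_hasEigenvector
    refine ⟨p1 ⊓ (A i).eigenspace μ, inf_le_left.trans h1, ?_, ?_, ?_⟩
    · rw [Submodule.ne_bot_iff]
      refine ⟨x, ⟨x.2, ?_⟩, fun h => hx.2 (Subtype.ext h)⟩
      rw [SetLike.mem_coe, Module.End.mem_eigenspace_iff]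
      have := congrArg Subtype.val hx.apply_eq_smul
      simpa using this
    · intro j y hy
      refine ⟨h3 j y hy.1, ?_⟩
      have h5 := Module.End.mem_eigenspace_iff.1 hy.2
      rw [SetLike.mem_coe, Module.End.mem_eigenspace_iff, ← Module.End.mul_apply, (hA i j).eq, Module.End.mul_apply,
        h5, map_smul]
    · intro j hj
      rcases Finset.mem_insert.1 hj with rfl | hj
      · exact ⟨μ, fun y hy => Module.End.mem_eigenspace_iff.1 hy.2⟩
      · obtain ⟨ν, hν⟩ := h4 j hj
        exact ⟨ν, fun y hy => hν y hy.1⟩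

variable (E : Fin N → Fin N → Module.End ℂ W)

def HK (κ : Fin N → ℝ) : Module.End ℂ W := ∑ a, (κ a : ℂ) • E a a

variable {E}

lemma Gl.HK_mul (hE : Gl E) (κ : Fin N → ℝ) (a b : Fin N) :
    HK E κ * E a b = E a b * HK E κ + ((κ a - κ b : ℝ) : ℂ) • E a b := by
  rw [← sub_eq_iff_eq_add', HK, Finset.sum_mul, Finset.mul_sum, ← Finset.sum_sub_distrib]
  have : ∀ c, (κ c : ℂ) • E c c * E a b - E a b * (κ c : ℂ) • E c c =
     (if c = a then (κ c : ℂ) • E c b else 0) - (if b = c then (κ c : ℂ) • E a c else 0) := by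
    intro c
    rw [smul_mul_assoc, mul_smul_comm, ← smul_sub, hE, smul_sub]
    split_ifs <;> simp
  rw [Finset.sum_congr rfl fun c _ => this c, Finset.sum_sub_distrib, Finset.sum_ite_eq', Finset.sum_ite_eq]
  simp [sub_smul]

lemma Gl.HK_eig (hE : Gl E) (κ : Fin N → ℝ) (a b : Fin N) {h : ℂ} {x : W} (hx : HK E κ x = h • x) :
    HK E κ (E a b x) = (h + ((κ a - κ b : ℝ) : ℂ)) • E a b x := by
  rw [← Module.End.mul_apply, hE.HK_mul, LinearMap.add_apply, Module.End.mul_apply, hx, map_smul, LinearMap.smul_apply, add_smul]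

/-- highest weight cyclic data -/
structure HWC (E : Fin N → Fin N → Module.End ℂ W) (lam : Fin N → ℝ) (w : W) : Prop where
  gl : Gl E
  up : ∀ a b, a < b → E a b w = 0
  wt : ∀ a, E a a w = (lam a : ℂ) • w
  gen : ∀ P : Submodule ℂ W, (∀ a b, ∀ x ∈ P, E a b x ∈ P) → w ∈ P → ∀ x, x ∈ P

inductive LW (E : Fin N → Fin N → Module.End ℂ W) (w : W) : W → Prop
  | base : LW E w w
  | step (a b : Fin N) (x : W) (hab : b < a) (hx : LW E w x) : LW E w (E a b x)

lemma HWC.lowgen {lam : Fin N → ℝ} {w : W} (h : HWC E lam w) (P : Submodule ℂ W)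
    (hP : ∀ a b, b < a → ∀ x ∈ P, E a b x ∈ P) (hw : w ∈ P) : ∀ x, x ∈ P := by
  set L := Submodule.span ℂ {x | LW E w x} with hL
  have hlow : ∀ a b, b < a → ∀ x ∈ L, E a b x ∈ L := by
    intro a b hab x hx
    have : L ≤ L.comap (E a b) := Submodule.span_le.2 fun y hy => Submodule.subset_span (LW.step a b y hab hy)
    exact this hx
  have hall : ∀ y, LW E w y → ∀ c d, E c d y ∈ L := by
    intro y hy
    induction hy with
    | base =>
      intro c d
      rcases lt_trichotomy c d with hcd | rfl | hcd
      · rw [h.up _ _ hcd]; exact L.zero_mem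
      · rw [h.wt]; exact L.smul_mem _ (Submodule.subset_span LW.base)
      · exact Submodule.subset_span (LW.step c d w hcd LW.base)
    | step a b x hab hx ih =>
      intro c d
      have h1 := h.gl c d a b
      rw [sub_eq_iff_eq_add] at h1
      rw [← Module.End.mul_apply, h1, LinearMap.add_apply, LinearMap.sub_apply, Module.End.mul_apply]
      refine L.add_mem (L.sub_mem ?_ ?_) (hlow a b hab _ (ih c d))
      · split_ifs
        · exact ih _ _
        · exact L.zero_mem
      · split_ifs
        · exact ih _ _
        · exact L.zero_mem
  have hLP : L ≤ P := by
    refine Submodule.span_le.2 fun y hy => ?_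
    rw [Set.mem_setOf_eq] at hy
    induction hy with
    | base => exact hw
    | step a b x hab hx ih => exact hP a b hab x ih
  intro x
  refine hLP (h.gen L ?_ (Submodule.subset_span LW.base) x)
  intro a b y hy
  have : L ≤ L.comap (E a b) := Submodule.span_le.2 fun y hy => hall y hy a b
  exact this hy

lemma HWC.HKw {lam : Fin N → ℝ} {w : W} (h : HWC E lam w) (κ : Fin N → ℝ) :
    HK E κ w = ((∑ a, κ a * lam a : ℝ) : ℂ) • w := by
  rw [HK, LinearMap.sum_apply]
  push_cast
  rw [Finset.sum_smul]
  refine Finset.sum_congr rfl fun a _ => ?_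
  rw [LinearMap.smul_apply, h.wt, smul_smul]

lemma HWC.eig {lam : Fin N → ℝ} {w : W} (h : HWC E lam w) (κ : Fin N → ℝ) (hκ : StrictAnti κ)
    (x : W) (hx0 : x ≠ 0) (t : ℂ) (hx : HK E κ x = t • x) :
    (∃ c : ℂ, x = c • w) ∨ ∃ r : ℝ, t = r ∧ r < ∑ a, κ a * lam a := by
  set hw : ℝ := ∑ a, κ a * lam a with hhw
  set T : Submodule ℂ W := ⨆ r : {r : ℝ // r < hw}, (HK E κ).eigenspace ((r : ℝ) : ℂ) with hT
  have hmem : ∀ (r : ℝ), r < hw → ∀ y, HK E κ y = (r : ℂ) • y → y ∈ T := fun r hr y hy =>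
    (le_iSup (fun r : {r : ℝ // r < hw} => (HK E κ).eigenspace ((r : ℝ) : ℂ)) ⟨r, hr⟩) (Module.End.mem_eigenspace_iff.2 hy)
  have hTlow : ∀ a b, b < a → T ≤ T.comap (E a b) := by
    intro a b hab
    refine iSup_le fun r y hy => ?_
    rw [Module.End.mem_eigenspace_iff] at hy
    have := h.gl.HK_eig κ a b hy
    refine hmem (r + (κ a - κ b)) ?_ _ (by rw [this]; push_cast; rfl)
    have := hκ hab
    have := r.2
    linarith
  have htop : ∀ y, y ∈ Submodule.span ℂ {w} ⊔ T := by
    refine h.lowgen _ ?_ (Submodule.mem_sup_left (Submodule.mem_span_singleton_self w))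
    intro a b hab y hy
    have : Submodule.span ℂ {w} ⊔ T ≤ (Submodule.span ℂ {w} ⊔ T).comap (E a b) := by
      refine sup_le ?_ ((hTlow a b hab).trans (Submodule.comap_mono le_sup_right))
      rw [Submodule.span_singleton_le_iff_mem]
      refine Submodule.mem_sup_right (hmem (hw + (κ a - κ b)) ?_ _ ?_)
      · have := hκ hab; linarith
      · rw [h.gl.HK_eig κ a b (h.HKw κ), ← hhw, ← Complex.ofReal_add]
    exact this hy
  have hind := Module.End.eigenspaces_iSupIndep (HK E κ)
  by_cases ht : t = hw
  · left
    obtain ⟨y, hy, y', hy', hyy⟩ := Submodule.mem_sup.1 (htop x)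
    obtain ⟨c, rfl⟩ := Submodule.mem_span_singleton.1 hy
    refine ⟨c, ?_⟩
    have h1 : y' ∈ (HK E κ).eigenspace (hw : ℂ) := by
      rw [Module.End.mem_eigenspace_iff, ← sub_eq_iff_eq_add'.2 hyy.symm, map_sub, map_smul, hx, h.HKw, ht, smul_sub,
        smul_comm c]
    have h2 : T ≤ ⨆ j, ⨆ (_ : j ≠ (hw : ℂ)), (HK E κ).eigenspace j := by
      refine iSup_le fun r => ?_
      refine le_iSup₂_of_le ((r : ℝ) : ℂ) ?_ le_rfl
      intro he
      have := r.2
      rw [Complex.ofReal_inj.1 he] at this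
      exact lt_irrefl _ this
    have h3 := Submodule.disjoint_def.1 (hind (hw : ℂ)) y' h1 (h2 hy')
    rw [← hyy, h3, add_zero]
  · right
    by_contra hno
    push Not at hno
    apply hx0
    refine Submodule.disjoint_def.1 (hind t) x (Module.End.mem_eigenspace_iff.2 hx) ?_
    refine (sup_le ?_ ?_ : Submodule.span ℂ {w} ⊔ T ≤ _) (htop x)
    · rw [Submodule.span_singleton_le_iff_mem]
      exact (le_iSup₂_of_le (f := fun j (_ : j ≠ t) => (HK E κ).eigenspace j) (hw : ℂ) (fun he => ht he.symm) le_rfl)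
        (Module.End.mem_eigenspace_iff.2 (h.HKw κ))
    · refine iSup_le fun r => ?_
      refine le_iSup₂_of_le ((r : ℝ) : ℂ) ?_ le_rfl
      intro he
      exact absurd r.2 (not_lt.2 (hno r he.symm))

/-! Casimir -/
def Cas (E : Fin N → Fin N → Module.End ℂ W) : Module.End ℂ W := ∑ a, ∑ b, E a b * E b a

lemma Gl.cas_comm (hE : Gl E) (c d : Fin N) : E c d * Cas E = Cas E * E c d := by
  have key : ∀ a b, E c d * (E a b * E b a) - E a b * E b a * E c d =
      (if d = a then E c b * E b a else 0) - (if b = c then E a d * E b a else 0)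
      + ((if d = b then E a b * E c a else 0) - (if a = c then E a b * E b d else 0)) := by
    intro a b
    have h1 := hE c d a b
    have h2 := hE c d b a
    have : E c d * (E a b * E b a) - E a b * E b a * E c d =
      (E c d * E a b - E a b * E c d) * E b a + E a b * (E c d * E b a - E b a * E c d) := by noncomm_ring
    rw [this, h1, h2, sub_mul, mul_sub]
    simp only [ite_mul, zero_mul, mul_ite, mul_zero]
  rw [← sub_eq_zero, Cas, Finset.mul_sum, Finset.sum_mul, ← Finset.sum_sub_distrib]
  simp only [Finset.mul_sum, Finset.sum_mul]
  simp only [← Finset.sum_sub_distrib, key]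
  simp only [Finset.sum_add_distrib, Finset.sum_sub_distrib]
  have e1 : ∑ a, ∑ b, (if d = a then E c b * E b a else 0) = ∑ b, E c b * E b d := by
    rw [Finset.sum_comm]; simp
  have e2 : ∑ a, ∑ b, (if b = c then E a d * E b a else 0) = ∑ a, E a d * E c a := by simp
  have e3 : ∑ a, ∑ b, (if d = b then E a b * E c a else 0) = ∑ a, E a d * E c a := by simp
  have e4 : ∑ a, ∑ b, (if a = c then E a b * E b d else 0) = ∑ b, E c b * E b d := by
    rw [Finset.sum_comm]; simp
  rw [e1, e2, e3, e4]; abel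

def cval (μ : Fin N → ℝ) : ℝ := ∑ a, μ a * (μ a + ((N : ℝ) - 1 - 2 * (a : ℕ)))

lemma Gl.cas_hw (hE : Gl E) (μ : Fin N → ℝ) (x : W) (hup : ∀ a b, a < b → E a b x = 0)
    (hwt : ∀ a, E a a x = (μ a : ℂ) • x) : Cas E x = (cval μ : ℂ) • x := by
  have key : ∀ a b, (E a b * E b a) x = ((if a = b then μ a * μ a else 0 : ℝ) : ℂ) • x +
      ((if a < b then μ a else 0 : ℝ) : ℂ) • x - ((if a < b then μ b else 0 : ℝ) : ℂ) • x := by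
    intro a b
    rcases lt_trichotomy a b with hab | rfl | hab
    · have h1 := hE a b b a
      rw [sub_eq_iff_eq_add] at h1
      rw [h1]
      simp only [if_true, LinearMap.add_apply, LinearMap.sub_apply, Module.End.mul_apply, hup a b hab, hwt, hab, hab.ne, if_false]
      simp
    · simp only [Module.End.mul_apply, hwt, map_smul, if_true, lt_irrefl, if_false]
      simp only [Complex.ofReal_mul, smul_smul, Complex.ofReal_zero, zero_smul, add_zero, sub_zero]
    · simp only [Module.End.mul_apply, hup b a hab, hab.ne', hab.not_gt, if_false]
      simp
  rw [Cas, LinearMap.sum_apply]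
  simp only [LinearMap.sum_apply, key, Finset.sum_add_distrib, Finset.sum_sub_distrib, ← Finset.sum_smul, ← Complex.ofReal_sum]
  rw [← add_smul, ← sub_smul, ← Complex.ofReal_add, ← Complex.ofReal_sub]
  congr 2
  have e1 : ∀ a : Fin N, (∑ b : Fin N, if a < b then μ a else 0) = μ a * ((N : ℝ) - 1 - (a : ℕ)) := by
    intro a
    rw [← Finset.sum_filter, Finset.sum_const, nsmul_eq_mul, mul_comm]
    congr 1
    have : (Finset.univ.filter fun b => a < b) = Finset.Ioi a := by ext b; simp
    have ha := a.2
    rw [this, Fin.card_Ioi, Nat.cast_sub (show (a : ℕ) ≤ N - 1 by omega), Nat.cast_sub (show 1 ≤ N by omega)]; simp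
  have e2 : (∑ a : Fin N, ∑ b : Fin N, if a < b then μ b else 0) = ∑ b : Fin N, μ b * (b : ℕ) := by
    rw [Finset.sum_comm]
    refine Finset.sum_congr rfl fun b _ => ?_
    rw [← Finset.sum_filter, Finset.sum_const, nsmul_eq_mul, mul_comm]
    congr 1
    have : (Finset.univ.filter fun a => a < b) = Finset.Iio b := by ext b; simp
    rw [this, Fin.card_Iio]
  simp only [e1, e2, Finset.sum_ite_eq, Finset.mem_univ, if_true]
  rw [← Finset.sum_add_distrib, ← Finset.sum_sub_distrib, cval]
  exact Finset.sum_congr rfl fun a _ => by ring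

attribute [local instance] LieRing.ofAssociativeRing

lemma Gl.dominant [FiniteDimensional ℂ W] (hE : Gl E) (μ : Fin N → ℝ) (x : W) (hx : x ≠ 0) (hup : ∀ a b, a < b → E a b x = 0)
    (hwt : ∀ a, E a a x = (μ a : ℂ) • x) (a b : Fin N) (hab : a < b) : μ b ≤ μ a := by
  have hval : (E a a - E b b) x = ((μ a - μ b : ℝ) : ℂ) • x := by
    rw [LinearMap.sub_apply, hwt, hwt]; push_cast; rw [sub_smul]
  by_cases h0 : E a a - E b b = 0
  · rw [h0, LinearMap.zero_apply, eq_comm, smul_eq_zero] at hval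
    have := hval.resolve_right hx
    have : μ a - μ b = 0 := by exact_mod_cast this
    linarith
  have t : IsSl2Triple (E a a - E b b) (E a b) (E b a) := by
    refine ⟨h0, ?_, ?_, ?_⟩
    · rw [LieRing.of_associative_ring_bracket, hE]; simp
    · rw [LieRing.of_associative_ring_bracket]
      have h1 := hE a a a b
      have h2 := hE b b a b
      have : (E a a - E b b) * E a b - E a b * (E a a - E b b) =
        (E a a * E a b - E a b * E a a) - (E b b * E a b - E a b * E b b) := by noncomm_ring
      rw [this, h1, h2]; simp [hab.ne, hab.ne', two_smul]
    · rw [LieRing.of_associative_ring_bracket]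
      have h1 := hE a a b a
      have h2 := hE b b b a
      have : (E a a - E b b) * E b a - E b a * (E a a - E b b) =
        (E a a * E b a - E b a * E a a) - (E b b * E b a - E b a * E b b) := by noncomm_ring
      rw [this, h1, h2]; simp [hab.ne, hab.ne', two_smul]; abel
  have P : t.HasPrimitiveVectorWith x ((μ a - μ b : ℝ) : ℂ) := ⟨hx, hval, hup a b hab⟩
  obtain ⟨n, hn⟩ := P.exists_nat
  have : μ a - μ b = n := by exact_mod_cast hn
  have h3 : (0 : ℝ) ≤ n := Nat.cast_nonneg n
  linarith

theorem HWC.irr [FiniteDimensional ℂ W] {lam : Fin N → ℝ} {w : W} (h : HWC E lam w) (hw0 : w ≠ 0)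
    (P : Submodule ℂ W) (hP : ∀ a b, ∀ x ∈ P, E a b x ∈ P) (hP0 : P ≠ ⊥) : w ∈ P := by
  -- highest weight vector in P
  have hcomm : ∀ a b, Commute (E a a) (E b b) := by
    intro a b
    have := h.gl a a b b
    rw [Commute, SemiconjBy, ← sub_eq_zero, this]
    by_cases hab : a = b
    · subst hab; simp
    · simp [hab, Ne.symm hab]
  set κ0 : Fin N → ℝ := fun a => -((a : ℕ) : ℝ) with hκ0
  have hkapd : StrictAnti κ0 := by
    intro a b hab
    simp only [hκ0, neg_lt_neg_iff]; exact_mod_cast hab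
  have hPH : ∀ x ∈ P, HK E κ0 x ∈ P := by
    intro x hx
    rw [HK, LinearMap.sum_apply]
    exact P.sum_mem fun a _ => P.smul_mem _ (hP a a x hx)
  haveI : Nontrivial P := Submodule.nontrivial_iff_ne_bot.2 hP0
  set HP : Module.End ℂ P := (HK E κ0).restrict hPH with hHP
  obtain ⟨t0, ht0⟩ := Module.End.exists_eigenvalue HP
  have hfin : (Set.Finite {t | Module.End.HasEigenvalue HP t}) := by
    have := Module.End.finite_hasEigenvalue HP
    exact this
  obtain ⟨t, ht, hmax⟩ := Set.exists_max_image _ (fun t : ℂ => t.re) hfin ⟨t0, ht0⟩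
  set G : Submodule ℂ W := P ⊓ (HK E κ0).eigenspace t with hG
  have hG0 : G ≠ ⊥ := by
    obtain ⟨x, hx⟩ := ht.exists_hasEigenvector
    rw [Submodule.ne_bot_iff]
    refine ⟨x, ⟨x.2, ?_⟩, fun h => hx.2 (Subtype.ext h)⟩
    rw [SetLike.mem_coe, Module.End.mem_eigenspace_iff]
    exact congrArg Subtype.val hx.apply_eq_smul
  have hGinv : ∀ a, ∀ x ∈ G, E a a x ∈ G := by
    intro a x hx
    refine ⟨hP a a x hx.1, ?_⟩
    have := h.gl.HK_eig κ0 a a (Module.End.mem_eigenspace_iff.1 hx.2)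
    rw [SetLike.mem_coe, Module.End.mem_eigenspace_iff, this]; simp
  have hGup : ∀ a b, a < b → ∀ x ∈ G, E a b x = 0 := by
    intro a b hab x hx
    by_contra hne
    have h1 := h.gl.HK_eig κ0 a b (Module.End.mem_eigenspace_iff.1 hx.2)
    have h2 : Module.End.HasEigenvalue HP (t + ((κ0 a - κ0 b : ℝ) : ℂ)) := by
      refine Module.End.hasEigenvalue_of_hasEigenvector (x := ⟨E a b x, hP a b x hx.1⟩) ?_
      refine ⟨Module.End.mem_eigenspace_iff.2 (Subtype.ext h1), fun h => hne (congrArg Subtype.val h)⟩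
    have h3 := hmax _ h2
    rw [Complex.add_re, Complex.ofReal_re] at h3
    have := hkapd hab
    linarith
  obtain ⟨G', hG'G, hG'0, -, hG'⟩ := common_eig (fun a => E a a) hcomm Finset.univ G hG0 hGinv
  obtain ⟨x, hxG', hx0⟩ := (Submodule.ne_bot_iff _).1 hG'0
  choose ν hν using fun a => hG' a (Finset.mem_univ a)
  have hxG := hG'G hxG'
  have hup : ∀ a b, a < b → E a b x = 0 := fun a b hab => hGup a b hab x hxG
  have hwt : ∀ a, E a a x = ν a • x := fun a => hν a x hxG'
  suffices hc : ∃ c : ℂ, x = c • w by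
    obtain ⟨c, hc⟩ := hc
    have hc0 : c ≠ 0 := by rintro rfl; exact hx0 (by rw [hc, zero_smul])
    have := P.smul_mem c⁻¹ hxG.1
    rwa [hc, smul_smul, inv_mul_cancel₀ hc0, one_smul] at this
  by_contra hc
  have hHK : ∀ κ : Fin N → ℝ, HK E κ x = (∑ a, (κ a : ℂ) * ν a) • x := by
    intro κ
    rw [HK, LinearMap.sum_apply, Finset.sum_smul]
    refine Finset.sum_congr rfl fun a _ => ?_
    rw [LinearMap.smul_apply, hwt, smul_smul]
  have hreal : ∀ a, (ν a).im = 0 := by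
    intro a
    have hκ1 : StrictAnti (fun b : Fin N => κ0 b + (if b = a then (1/2 : ℝ) else 0)) := by
      intro b c hbc
      have h1 : ((b : ℕ) : ℝ) + 1 ≤ (c : ℕ) := by exact_mod_cast hbc
      simp only [hκ0]
      split_ifs <;> linarith
    have h1 := (h.eig _ hkapd x hx0 _ (hHK κ0)).resolve_left hc
    have h2 := (h.eig _ hκ1 x hx0 _ (hHK _)).resolve_left hc
    obtain ⟨r1, hr1, -⟩ := h1
    obtain ⟨r2, hr2, -⟩ := h2
    have h3 : ∑ b, ((κ0 b + (if b = a then (1/2 : ℝ) else 0) : ℝ) : ℂ) * ν b = ∑ b, (κ0 b : ℂ) * ν b + (1/2) * ν a := by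
      push_cast
      simp only [add_mul, Finset.sum_add_distrib]
      congr 1
      rw [Finset.sum_eq_single_of_mem a (Finset.mem_univ _)]
      · simp
      · intro b _ hb; simp [hb]
    rw [h3, hr1] at hr2
    have := congrArg Complex.im hr2
    simpa using this
  set μ : Fin N → ℝ := fun a => (ν a).re with hμ
  have hwt' : ∀ a, E a a x = (μ a : ℂ) • x := by
    intro a
    have : (μ a : ℂ) = ν a := Complex.ext (by simp [hμ]) (by simp [hreal a])
    rw [this]; exact hwt a
  have hdx := h.gl.dominant μ x hx0 hup hwt'
  have hdw := h.gl.dominant lam w hw0 h.up h.wt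
  have hcas : ∀ y, Cas E y = (cval lam : ℂ) • y := by
    intro y
    have := h.gen ((Cas E).eigenspace (cval lam : ℂ)) ?_ ?_ y
    · exact Module.End.mem_eigenspace_iff.1 this
    · intro a b y hy
      rw [Module.End.mem_eigenspace_iff] at hy ⊢
      rw [← Module.End.mul_apply, ← h.gl.cas_comm, Module.End.mul_apply, hy, map_smul]
    · rw [Module.End.mem_eigenspace_iff]; exact h.gl.cas_hw lam w h.up h.wt
  have hcx := h.gl.cas_hw μ x hup hwt'
  rw [hcas, ← sub_eq_zero, ← sub_smul, smul_eq_zero] at hcx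
  have hceq : cval lam = cval μ := by
    have := sub_eq_zero.1 (hcx.resolve_right hx0)
    exact_mod_cast this
  set κ : Fin N → ℝ := fun a => lam a + μ a + ((N : ℝ) - 1 - 2 * (a : ℕ)) with hκ
  have hκd : StrictAnti κ := by
    intro a b hab
    have h1 := hdx a b hab
    have h2 := hdw a b hab
    have h3 : ((a : ℕ) : ℝ) < (b : ℕ) := by exact_mod_cast hab
    simp only [hκ]; linarith
  obtain ⟨r, hr, hlt⟩ := (h.eig κ hκd x hx0 _ (hHK κ)).resolve_left hc
  have hr2 : r = ∑ a, κ a * μ a := by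
    have : ((∑ a, κ a * μ a : ℝ) : ℂ) = r := by
      rw [← hr]; push_cast
      refine Finset.sum_congr rfl fun a _ => ?_
      congr 1
      exact Complex.ext (by simp [hμ]) (by simp [hreal a])
    exact_mod_cast this.symm
  have : ∑ a, κ a * lam a - ∑ a, κ a * μ a = cval lam - cval μ := by
    rw [cval, cval, ← Finset.sum_sub_distrib, ← Finset.sum_sub_distrib]
    exact Finset.sum_congr rfl fun a _ => by simp only [hκ]; ring
  linarith
end Irr
end XXXModel

namespace XXXModel

section JM
variable {N : ℕ} {A : Type*} [Ring A]

/-- partial sums of the site operators -/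
def SS (e : ℕ → Fin N → Fin N → A) (m : ℕ) (a b : Fin N) : A := ∑ i ∈ Finset.range m, e i a b

/-- Jucys–Murphy elements -/
def JX (e : ℕ → Fin N → Fin N → A) (j : ℕ) : A := ∑ a, ∑ b, SS e j a b * e j b a

/-- a commuting family of matrix unit systems -/
structure Sites (e : ℕ → Fin N → Fin N → A) : Prop where
  mu : ∀ i a b c d, e i a b * e i c d = if b = c then e i a d else 0
  comm : ∀ i j, i ≠ j → ∀ a b c d, Commute (e i a b) (e j c d)

variable {e : ℕ → Fin N → Fin N → A}

lemma SS_succ (m : ℕ) (a b : Fin N) : SS e (m + 1) a b = SS e m a b + e m a b := Finset.sum_range_succ _ _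

lemma Sites.SS_comm (h : Sites e) {m j : ℕ} (hm : m ≤ j) (a b c d : Fin N) : Commute (SS e m a b) (e j c d) :=
  Commute.sum_left _ _ _ fun i hi => h.comm i j (by have := Finset.mem_range.1 hi; omega) a b c d

lemma Sites.gl1 (h : Sites e) (i : ℕ) (a b c d : Fin N) : e i a b * e i c d - e i c d * e i a b =
    (if b = c then e i a d else 0) - (if d = a then e i c b else 0) := by
  rw [h.mu, h.mu]

lemma Sites.gl (h : Sites e) (m : ℕ) (a b c d : Fin N) : SS e m a b * SS e m c d - SS e m c d * SS e m a b =
    (if b = c then SS e m a d else 0) - (if d = a then SS e m c b else 0) := by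
  induction m with
  | zero => simp [SS]
  | succ m ih =>
    simp only [SS_succ]
    have h1 := h.gl1 m a b c d
    have h2 := (h.SS_comm (le_refl m) a b c d).eq
    have h3 := (h.SS_comm (le_refl m) c d a b).eq
    have : (SS e m a b + e m a b) * (SS e m c d + e m c d) - (SS e m c d + e m c d) * (SS e m a b + e m a b) =
       (SS e m a b * SS e m c d - SS e m c d * SS e m a b) + (e m a b * e m c d - e m c d * e m a b)
       + (SS e m a b * e m c d - e m c d * SS e m a b) - (SS e m c d * e m a b - e m a b * SS e m c d) := by noncomm_ring
    rw [this, ih, h1, h2, h3]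
    split_ifs <;> abel

lemma Sites.JX_e (h : Sites e) {j m : ℕ} (hm : j < m) (c d : Fin N) : Commute (JX e j) (e m c d) :=
  Commute.sum_left _ _ _ fun a _ => Commute.sum_left _ _ _ fun b _ =>
    (h.SS_comm hm.le a b c d).mul_left (h.comm j m hm.ne _ _ _ _)

lemma Sites.JX_SS (h : Sites e) {j m : ℕ} (hm : j < m) (c d : Fin N) : Commute (JX e j) (SS e m c d) := by
  induction m, hm using Nat.le_induction with
  | base =>
    have key : ∀ a b, SS e j a b * e j b a * SS e (j + 1) c d - SS e (j + 1) c d * (SS e j a b * e j b a) =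
        ((if b = c then SS e j a d * e j b a else 0) - (if d = a then SS e j c b * e j b a else 0)) +
        ((if a = c then SS e j a b * e j b d else 0) - (if d = b then SS e j a b * e j c a else 0)) := by
      intro a b
      have h1 := h.gl j a b c d
      have h2 := h.gl1 j b a c d
      have h3 := (h.SS_comm (le_refl j) c d b a).eq
      have h4 := (h.SS_comm (le_refl j) a b c d).eq
      rw [SS_succ]
      have e1 : SS e j a b * e j b a * (SS e j c d + e j c d) - (SS e j c d + e j c d) * (SS e j a b * e j b a) =
        (SS e j a b * SS e j c d - SS e j c d * SS e j a b) * e j b a + SS e j a b * (e j b a * e j c d - e j c d * e j b a)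
        - SS e j a b * (SS e j c d * e j b a - e j b a * SS e j c d) + (SS e j a b * e j c d - e j c d * SS e j a b) * e j b a := by
        noncomm_ring
      rw [e1, h1, h2, h3, h4, sub_self, sub_self, mul_zero, zero_mul, sub_zero, add_zero, sub_mul, mul_sub]
      simp only [ite_mul, zero_mul, mul_ite, mul_zero]
    rw [Commute, SemiconjBy, ← sub_eq_zero, JX, Finset.mul_sum, Finset.sum_mul, ← Finset.sum_sub_distrib]
    simp only [Finset.mul_sum, Finset.sum_mul]
    simp only [← Finset.sum_sub_distrib, key]
    simp only [Finset.sum_add_distrib, Finset.sum_sub_distrib]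
    have e1 : ∑ a, ∑ b, (if b = c then SS e j a d * e j b a else 0) = ∑ a, SS e j a d * e j c a := by simp
    have e2 : ∑ a, ∑ b, (if d = a then SS e j c b * e j b a else 0) = ∑ b, SS e j c b * e j b d := by
      rw [Finset.sum_comm]; simp
    have e3 : ∑ a, ∑ b, (if a = c then SS e j a b * e j b d else 0) = ∑ b, SS e j c b * e j b d := by
      rw [Finset.sum_comm]; simp
    have e4 : ∑ a, ∑ b, (if d = b then SS e j a b * e j c a else 0) = ∑ a, SS e j a d * e j c a := by simp
    rw [e1, e2, e3, e4]; abel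
  | succ m hm ih =>
    rw [SS_succ]
    exact ih.add_right (h.JX_e hm c d)

lemma Sites.JX_comm (h : Sites e) (j k : ℕ) : Commute (JX e j) (JX e k) := by
  have key : ∀ j k, j < k → Commute (JX e j) (JX e k) := fun j k hjk =>
    Commute.sum_right _ _ _ fun a _ => Commute.sum_right _ _ _ fun b _ =>
      (h.JX_SS hjk a b).mul_right (h.JX_e hjk b a)
  rcases lt_trichotomy j k with hjk | rfl | hjk
  · exact key j k hjk
  · exact Commute.refl _
  · exact (key k j hjk).symm

lemma Sites.e_JX (h : Sites e) (k : ℕ) (a b : Fin N) : ∑ c, SS e k c a * e k b c = e k b a * JX e k := by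
  rw [JX, Finset.mul_sum]
  refine Finset.sum_congr rfl fun c _ => ?_
  rw [Finset.mul_sum]
  have : ∀ d, e k b a * (SS e k c d * e k d c) = if a = d then SS e k c d * e k b c else 0 := by
    intro d
    rw [← mul_assoc, ← (h.SS_comm (le_refl k) c d b a).eq, mul_assoc, h.mu, mul_ite, mul_zero]
  simp only [this]; simp
end JM

section Fusion
variable {N : ℕ} {U : Type*} [AddCommGroup U] [Module ℂ U]

def fuse (e : ℕ → Fin N → Fin N → Module.End ℂ U) (z : ℂ) (c : ℕ → ℂ) : ℕ → List (Site N (Module.End ℂ U))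
  | 0 => []
  | k + 1 => (e k, z - c k) :: fuse e z c k

lemma mem_fuse {e : ℕ → Fin N → Fin N → Module.End ℂ U} {z : ℂ} {c : ℕ → ℂ} {k : ℕ} {s : Site N (Module.End ℂ U)}
    (hs : s ∈ fuse e z c k) : ∃ j < k, s = (e j, z - c j) := by
  induction k with
  | zero => simp [fuse] at hs
  | succ k ih =>
    rw [fuse, List.mem_cons] at hs
    rcases hs with hs | hs
    · exact ⟨k, by omega, hs⟩
    · obtain ⟨j, hj, h⟩ := ih hs
      exact ⟨j, by omega, h⟩

lemma fuse_pairwise {e : ℕ → Fin N → Fin N → Module.End ℂ U} (h : Sites e) (z : ℂ) (c : ℕ → ℂ) (k : ℕ) :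
    (fuse e z c k).Pairwise SComm := by
  induction k with
  | zero => exact List.Pairwise.nil
  | succ k ih =>
    refine List.Pairwise.cons ?_ ih
    intro s hs
    obtain ⟨j, hj, rfl⟩ := mem_fuse hs
    intro a b c d
    exact h.comm k j (by omega) a b c d

lemma fusion {e : ℕ → Fin N → Fin N → Module.End ℂ U} (h : Sites e) (Q : Matrix (Fin N) (Fin N) ℂ)
    (z : ℂ) (c : ℕ → ℂ) (u : ℂ) (hu : u - z ≠ 0) (l0 : List (Site N (Module.End ℂ U))) (k : ℕ) :
    (∀ j < k, u - z + c j ≠ 0) → ∀ (a b : Fin N) (v : U), (∀ j < k, JX e j v = c j • v) →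
    XL Q u (fuse e z c k ++ l0) a b v = ∑ d, XL Q u l0 a d ((if d = b then v else 0) + (u - z)⁻¹ • SS e k b d v) := by
  induction k with
  | zero =>
    intro _ a b v _
    simp only [fuse, SS, List.nil_append, Finset.range_zero, Finset.sum_empty, LinearMap.zero_apply, smul_zero, add_zero]
    rw [Finset.sum_eq_single_of_mem b (Finset.mem_univ _)]
    · simp
    · intro f _ hf; simp [hf]
  | succ k ih =>
    intro hc a b v hv
    have h1 : ∀ d, ∀ j < k, JX e j (Lsite (e k, z - c k) u d b v) = c j • Lsite (e k, z - c k) u d b v := by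
      intro d j hj
      have : Commute (JX e j) (Lsite (e k, z - c k) u d b) := by
        refine Commute.add_right ?_ ((h.JX_e hj b d).smul_right _)
        split_ifs
        · exact Commute.one_right _
        · exact Commute.zero_right _
      rw [← Module.End.mul_apply, this.eq, Module.End.mul_apply, hv j (by omega), map_smul]
    have h2 : XL Q u (fuse e z c (k + 1) ++ l0) a b v =
        ∑ d, XL Q u (fuse e z c k ++ l0) a d (Lsite (e k, z - c k) u d b v) := by
      rw [fuse, List.cons_append]
      show (mmul (XL Q u (fuse e z c k ++ l0)) (Lsite (e k, z - c k) u) a b) v = _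
      rw [mmul, LinearMap.sum_apply]; rfl
    rw [h2]
    simp only [fun d => ih (fun j hj => hc j (by omega)) a d _ (h1 d)]
    rw [Finset.sum_comm]
    refine Finset.sum_congr rfl fun d _ => ?_
    rw [← map_sum]
    congr 1
    have hck := hc k (by omega)
    have h3 : ∑ f, SS e k f d (e k b f v) = c k • e k b d v := by
      have := congrArg (fun T : Module.End ℂ U => T v) (h.e_JX k d b)
      simp only [LinearMap.sum_apply, Module.End.mul_apply, hv k (by omega), map_smul] at this
      exact this
    have h4 : ∀ f, Lsite (e k, z - c k) u f b v = (if f = b then v else 0) + (u - z + c k)⁻¹ • e k b f v := by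
      intro f
      rw [Lsite, LinearMap.add_apply, LinearMap.smul_apply, show u - (z - c k) = u - z + c k by ring]
      split_ifs <;> simp
    simp only [h4, Finset.sum_add_distrib, map_add, smul_add, map_smul, ← Finset.smul_sum, h3]
    simp only [Finset.sum_ite_eq, Finset.mem_univ, if_true, SS_succ, LinearMap.add_apply, smul_add]
    have h5 : ∑ f, SS e k f d (if f = b then v else 0) = SS e k b d v := by
      rw [Finset.sum_eq_single_of_mem b (Finset.mem_univ _)]
      · simp
      · intro f _ hf; simp [hf]
    rw [h5]
    have h6 : (u - z + c k)⁻¹ • e k b d v + (u - z)⁻¹ • (u - z + c k)⁻¹ • c k • e k b d v = (u - z)⁻¹ • e k b d v := by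
      rw [smul_smul, smul_smul, ← add_smul]
      congr 1
      field_simp
    rw [← h6]; abel
end Fusion
end XXXModel

namespace XXXModel

section Real
variable {N : ℕ} {B : Type} [Fintype B] [DecidableEq B]

/-- matrix unit acting at the place `i` of the tensor power -/
def ee (i : B) (a b : Fin N) : Module.End ℂ ((B → Fin N) → ℂ) where
  toFun f := fun t => if t i = a then f (Function.update t i b) else 0
  map_add' f g := by ext t; simp only [Pi.add_apply]; split_ifs <;> simp
  map_smul' c f := by ext t; simp only [Pi.smul_apply, RingHom.id_apply]; split_ifs <;> simp

lemma ee_apply (i : B) (a b : Fin N) (f : (B → Fin N) → ℂ) (t) :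
    ee i a b f t = if t i = a then f (Function.update t i b) else 0 := rfl

lemma ee_mu (i : B) (a b c d : Fin N) : (ee i a b : Module.End ℂ ((B → Fin N) → ℂ)) * ee i c d = if b = c then ee i a d else 0 := by
  refine LinearMap.ext fun f => funext fun t => ?_
  rw [Module.End.mul_apply, ee_apply, ee_apply]
  simp only [Function.update_self, Function.update_idem]
  by_cases h : b = c
  · simp only [h, if_true]; rw [ee_apply]
  · simp [h]

lemma ee_comm (i j : B) (hij : i ≠ j) (a b c d : Fin N) : Commute (ee i a b : Module.End ℂ ((B → Fin N) → ℂ)) (ee j c d) := by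
  refine LinearMap.ext fun f => funext fun t => ?_
  simp only [Module.End.mul_apply, ee_apply, Function.update_of_ne hij, Function.update_of_ne hij.symm]
  rw [Function.update_comm hij]
  split_ifs <;> rfl

/-- sites indexed by natural numbers -/
noncomputable def en (N : ℕ) (B : Type) [Fintype B] [DecidableEq B] (i : ℕ) (a b : Fin N) : Module.End ℂ ((B → Fin N) → ℂ) :=
  if h : i < Fintype.card B then ee ((Fintype.equivFin B).symm ⟨i, h⟩) a b else 0

lemma en_sites : Sites (en N B) where
  mu i a b c d := by
    unfold en
    split_ifs with h1 h2
    · rw [ee_mu, if_pos h2]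
    · rw [ee_mu, if_neg h2]
    · rw [mul_zero]
    · rw [mul_zero]
  comm i j hij a b c d := by
    unfold en
    split_ifs with h1 h2
    · refine ee_comm _ _ ?_ a b c d
      intro h
      have := (Fintype.equivFin B).symm.injective h
      exact hij (Fin.mk.inj this)
    · exact Commute.zero_right _
    · exact Commute.zero_left _
    · exact Commute.zero_left _

lemma SS_en (a b : Fin N) : SS (en N B) (Fintype.card B) a b = ∑ i : B, ee i a b := by
  rw [SS, Finset.sum_range, ← Equiv.sum_comp (Fintype.equivFin B).symm]
  refine Finset.sum_congr rfl fun i _ => ?_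
  rw [en, dif_pos i.2]

/-- column determinant -/
noncomputable def colM (N h : ℕ) (s : Fin h → Fin N) : Matrix (Fin h) (Fin h) ℂ := fun i j => if (s i : ℕ) = j then 1 else 0

lemma col_id (h : ℕ) (s : Fin h → Fin N) (a b : Fin N) (hab : a ≤ b) :
    ∑ i, (if s i = a then (colM N h (Function.update s i b)).det else 0) =
      if a = b ∧ (a : ℕ) < h then (colM N h s).det else 0 := by
  have hupd : ∀ i, colM N h (Function.update s i b) = (colM N h s).updateRow i (fun j => if (b : ℕ) = j then 1 else 0) := by
    intro i
    ext i' j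
    by_cases hi : i' = i
    · subst hi; simp [colM]
    · simp [colM, hi, Matrix.updateRow_ne]
  by_cases hb : (b : ℕ) < h
  · have ha : (a : ℕ) < h := lt_of_le_of_lt hab hb
    have h1 : ∀ i, (if s i = a then (colM N h (Function.update s i b)).det else 0) =
        (colM N h s).adjugate ⟨b, hb⟩ i * colM N h s i ⟨a, ha⟩ := by
      intro i
      rw [Matrix.adjugate_apply, hupd]
      have h2 : (fun j : Fin h => if (b : ℕ) = j then (1 : ℂ) else 0) = Pi.single (⟨b, hb⟩ : Fin h) 1 := by
        ext j
        rw [Pi.single_apply]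
        simp only [Fin.ext_iff, eq_comm]
      rw [h2]
      have h3 : colM N h s i ⟨a, ha⟩ = if s i = a then 1 else 0 := by
        simp only [colM, Fin.ext_iff]
      rw [h3, mul_ite, mul_one, mul_zero]
    rw [Finset.sum_congr rfl fun i _ => h1 i, ← Matrix.mul_apply, Matrix.adjugate_mul, Matrix.smul_apply, Matrix.one_apply]
    simp only [Fin.ext_iff, ha, and_true, smul_eq_mul, mul_ite, mul_one, mul_zero, eq_comm]
  · have h1 : ∀ i, (if s i = a then (colM N h (Function.update s i b)).det else 0) = 0 := by
      intro i
      rw [hupd, Matrix.det_eq_zero_of_row_eq_zero i, ite_self]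
      intro j
      have : (b : ℕ) ≠ j := by have := j.2; omega
      simp [this]
    rw [Finset.sum_congr rfl fun i _ => h1 i, Finset.sum_const_zero, if_neg]
    rintro ⟨rfl, h2⟩
    exact hb h2

variable {m : ℕ} (h : Fin m → ℕ)

noncomputable def hwf (N : ℕ) (t : (Σ c : Fin m, Fin (h c)) → Fin N) : ℂ := ∏ c, (colM N (h c) fun i => t ⟨c, i⟩).det

lemma hwf_act (a b : Fin N) (hab : a ≤ b) :
    (∑ i : (Σ c : Fin m, Fin (h c)), ee i a b) (hwf h N) =
      ((if a = b then (Finset.univ.filter fun c => (a : ℕ) < h c).card else 0 : ℕ) : ℂ) • hwf h N := by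
  refine funext fun t => ?_
  rw [LinearMap.sum_apply, Finset.sum_apply, Fintype.sum_sigma]
  have key : ∀ c, ∑ i, (ee (⟨c, i⟩ : Σ c : Fin m, Fin (h c)) a b (hwf h N)) t =
      if a = b ∧ (a : ℕ) < h c then hwf h N t else 0 := by
    intro c
    have h1 : ∀ i, (ee (⟨c, i⟩ : Σ c : Fin m, Fin (h c)) a b (hwf h N)) t =
        (if t ⟨c, i⟩ = a then (colM N (h c) (Function.update (fun i => t ⟨c, i⟩) i b)).det else 0) *
          ∏ c' ∈ Finset.univ.erase c, (colM N (h c') fun i => t ⟨c', i⟩).det := by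
      intro i
      rw [ee_apply]
      split_ifs
      · rw [hwf, ← Finset.mul_prod_erase _ _ (Finset.mem_univ c)]
        congr 1
        · congr 2
          ext j
          by_cases hj : j = i
          · subst hj; simp
          · rw [Function.update_of_ne hj, Function.update_of_ne]
            intro he; apply hj
            simpa using he
        · refine Finset.prod_congr rfl fun c' hc' => ?_
          congr 2
          ext j
          rw [Function.update_of_ne]
          intro he
          exact (Finset.mem_erase.1 hc').1 (congrArg Sigma.fst he)
      · rw [zero_mul]
    rw [Finset.sum_congr rfl fun i _ => h1 i, ← Finset.sum_mul, col_id _ _ _ _ hab, ite_mul, zero_mul]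
    congr 1
    exact Finset.mul_prod_erase _ (fun c => (colM N (h c) fun i => t ⟨c, i⟩).det) (Finset.mem_univ c)
  rw [Finset.sum_congr rfl fun c _ => key c, Pi.smul_apply, smul_eq_mul]
  by_cases hE : a = b
  · simp only [hE, true_and, if_true]
    rw [← Finset.sum_filter, Finset.sum_const, nsmul_eq_mul]
  · simp [hE]

lemma hwf_ne (hh : ∀ c, h c ≤ N) : hwf h N ≠ 0 := by
  intro h0
  have h1 := congrFun h0 (fun x => ⟨x.2, lt_of_lt_of_le x.2.2 (hh x.1)⟩)
  rw [hwf] at h1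
  have : ∀ c, (colM N (h c) fun i => ⟨i, lt_of_lt_of_le i.2 (hh c)⟩) = 1 := by
    intro c
    ext i j
    simp only [colM, Matrix.one_apply, Fin.ext_iff]
  simp only [this, Matrix.det_one, Finset.prod_const_one, Pi.zero_apply] at h1
  exact one_ne_zero h1

end Real

/-- a highest weight vector of the given weight in a tensor power of the vector representation -/
lemma exists_hw {N : ℕ} (hN : 0 < N) (Λ : Fin N → ℤ) (hdom : ∀ a b : Fin N, a ≤ b → Λ b ≤ Λ a) (hpoly : ∀ a, 0 ≤ Λ a) :
    ∃ (B : Type) (_ : Fintype B) (_ : DecidableEq B) (f : (B → Fin N) → ℂ), f ≠ 0 ∧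
      (∀ a b, a < b → SS (en N B) (Fintype.card B) a b f = 0) ∧
      (∀ a, SS (en N B) (Fintype.card B) a a f = (Λ a : ℂ) • f) := by
  classical
  let m : ℕ := (Λ ⟨0, hN⟩).toNat
  let h : Fin m → ℕ := fun c => (Finset.univ.filter fun a : Fin N => ((c : ℕ) : ℤ) < Λ a).sup fun a => (a : ℕ) + 1
  have hlt : ∀ (c : Fin m) (a : Fin N), (a : ℕ) < h c ↔ ((c : ℕ) : ℤ) < Λ a := by
    intro c a
    rw [Finset.lt_sup_iff]
    constructor
    · rintro ⟨b, hb, hab⟩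
      rw [Finset.mem_filter] at hb
      exact lt_of_lt_of_le hb.2 (hdom a b (by rw [Fin.le_def]; omega))
    · intro ha
      exact ⟨a, by simpa using ha, by omega⟩
  have hle : ∀ c, h c ≤ N := fun c => Finset.sup_le fun a _ => a.2
  refine ⟨Σ c : Fin m, Fin (h c), inferInstance, inferInstance, hwf h N, hwf_ne h hle, ?_, ?_⟩
  · intro a b hab
    rw [SS_en, hwf_act h a b hab.le, if_neg hab.ne, Nat.cast_zero, zero_smul]
  · intro a
    rw [SS_en, hwf_act h a a le_rfl, if_pos rfl]
    congr 1
    simp only [hlt]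
    have h1 : Λ a ≤ Λ ⟨0, hN⟩ := hdom _ _ (by rw [Fin.le_def]; exact Nat.zero_le _)
    have h2 : (Finset.univ.filter fun c : Fin m => ((c : ℕ) : ℤ) < Λ a).card = (Λ a).toNat := by
      have : ∀ c : Fin m, ((c : ℕ) : ℤ) < Λ a ↔ (c : ℕ) < (Λ a).toNat := fun c => by omega
      simp only [this]
      rw [Fin.card_filter_val_lt]
      exact min_eq_right (by omega)
    rw [h2]
    have h3 := Int.toNat_of_nonneg (hpoly a)
    exact_mod_cast congrArg (Int.cast : ℤ → ℂ) h3
end XXXModel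

namespace XXXModel

/-- two highest weight vectors of the same weight: the cyclic module maps injectively -/
lemma hw_map {N : ℕ} {V U : Type*} [AddCommGroup V] [Module ℂ V] [FiniteDimensional ℂ V]
    [AddCommGroup U] [Module ℂ U] [FiniteDimensional ℂ U]
    (E : Fin N → Fin N → Module.End ℂ V) (hE : Gl E) (G : Fin N → Fin N → Module.End ℂ U) (hG : Gl G)
    (lam : Fin N → ℝ) (v : V) (hv0 : v ≠ 0) (hvu : ∀ a b, a < b → E a b v = 0) (hvw : ∀ a, E a a v = (lam a : ℂ) • v)
    (hgen : ∀ W : Submodule ℂ V, (∀ a b, ∀ x ∈ W, E a b x ∈ W) → v ∈ W → ∀ x, x ∈ W)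
    (w : U) (hw0 : w ≠ 0) (hwu : ∀ a b, a < b → G a b w = 0) (hww : ∀ a, G a a w = (lam a : ℂ) • w) :
    ∃ ι : V →ₗ[ℂ] U, Function.Injective ι ∧ (∀ a b x, G a b (ι x) = ι (E a b x)) ∧ ι v = w := by
  let F : Fin N → Fin N → Module.End ℂ (V × U) := fun a b => (E a b).prodMap (G a b)
  have hF : ∀ a b (p : V × U), F a b p = (E a b p.1, G a b p.2) := fun a b p => rfl
  let W : Submodule ℂ (V × U) := sInf {P | (∀ a b, ∀ x ∈ P, F a b x ∈ P) ∧ (v, w) ∈ P}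
  have hWinv : ∀ a b, ∀ x ∈ W, F a b x ∈ W := by
    intro a b x hx
    rw [Submodule.mem_sInf] at hx ⊢
    intro P hP
    exact hP.1 a b x (hx P hP)
  have hWmem : (v, w) ∈ W := by
    rw [Submodule.mem_sInf]; intro P hP; exact hP.2
  have hWle : ∀ P : Submodule ℂ (V × U), (∀ a b, ∀ x ∈ P, F a b x ∈ P) → (v, w) ∈ P → W ≤ P :=
    fun P h1 h2 => sInf_le ⟨h1, h2⟩
  let T : Fin N → Fin N → Module.End ℂ W := fun a b => (F a b).restrict (hWinv a b)
  have hT : ∀ a b (x : W), ((T a b x : W) : V × U) = (E a b x.1.1, G a b x.1.2) := fun a b x => rfl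
  have hTgl : Gl T := by
    intro a b c d
    refine LinearMap.ext fun x => Subtype.ext ?_
    have h1 := congrArg (fun A : Module.End ℂ V => A x.1.1) (hE a b c d)
    have h2 := congrArg (fun A : Module.End ℂ U => A x.1.2) (hG a b c d)
    simp only [LinearMap.sub_apply, Module.End.mul_apply] at h1 h2
    refine Prod.ext ?_ ?_
    · show (E a b (E c d x.1.1) - E c d (E a b x.1.1)) = _
      rw [h1]
      split_ifs <;> simp [hT]
    · show (G a b (G c d x.1.2) - G c d (G a b x.1.2)) = _
      rw [h2]
      split_ifs <;> simp [hT]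
  let w0 : W := ⟨(v, w), hWmem⟩
  have hw00 : w0 ≠ 0 := fun h => hv0 (congrArg (fun x : W => x.1.1) h)
  have hHWC : HWC T lam w0 := by
    refine ⟨hTgl, ?_, ?_, ?_⟩
    · intro a b hab
      exact Subtype.ext (Prod.ext (hvu a b hab) (hwu a b hab))
    · intro a
      exact Subtype.ext (Prod.ext (hvw a) (hww a))
    · intro P hP hwP x
      have h1 := hWle (P.map W.subtype) ?_ ⟨w0, hwP, rfl⟩
      · obtain ⟨y, hy, hyx⟩ := h1 x.2
        have : y = x := Subtype.ext hyx
        exact this ▸ hy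
      · rintro a b _ ⟨y, hy, rfl⟩
        exact ⟨T a b y, hP a b y hy, rfl⟩
  let p1 : W →ₗ[ℂ] V := LinearMap.fst ℂ V U ∘ₗ W.subtype
  let p2 : W →ₗ[ℂ] U := LinearMap.snd ℂ V U ∘ₗ W.subtype
  have hp1 : LinearMap.ker p1 = ⊥ := by
    by_contra hne
    have := hHWC.irr hw00 (LinearMap.ker p1) ?_ hne
    · exact hv0 this
    · intro a b x hx
      have hx' : x.1.1 = 0 := hx
      show E a b x.1.1 = 0
      rw [hx', map_zero]
  have hp2 : LinearMap.ker p2 = ⊥ := by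
    by_contra hne
    have := hHWC.irr hw00 (LinearMap.ker p2) ?_ hne
    · exact hw0 this
    · intro a b x hx
      have hx' : x.1.2 = 0 := hx
      show G a b x.1.2 = 0
      rw [hx', map_zero]
  have hsurj : Function.Surjective p1 := by
    intro x
    refine hgen (LinearMap.range p1) ?_ ⟨w0, rfl⟩ x
    rintro a b _ ⟨y, rfl⟩
    exact ⟨T a b y, rfl⟩
  let eq := LinearEquiv.ofBijective p1 ⟨LinearMap.ker_eq_bot.1 hp1, hsurj⟩
  have heq : ∀ y, eq.symm (p1 y) = y := fun y => eq.symm_apply_apply y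
  refine ⟨p2 ∘ₗ eq.symm.toLinearMap, ?_, ?_, ?_⟩
  · exact (LinearMap.ker_eq_bot.1 hp2).comp eq.symm.injective
  · intro a b x
    obtain ⟨y, rfl⟩ := hsurj x
    have h1 : E a b (p1 y) = p1 (T a b y) := rfl
    rw [h1]
    simp only [LinearMap.comp_apply, LinearEquiv.coe_coe, heq]
    rfl
  · have h1 : v = p1 w0 := rfl
    simp only [LinearMap.comp_apply, LinearEquiv.coe_coe]
    rw [h1, heq]
    rfl

lemma embed {N : ℕ} (hN : 0 < N) {V : Type*} [AddCommGroup V] [Module ℂ V] [FiniteDimensional ℂ V]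
    (E : Fin N → Fin N → Module.End ℂ V) (hE : Gl E) (Λ : Fin N → ℤ)
    (hdom : ∀ a b : Fin N, a ≤ b → Λ b ≤ Λ a) (hpoly : ∀ a, 0 ≤ Λ a)
    (v : V) (hv0 : v ≠ 0) (hvu : ∀ a b, a < b → E a b v = 0) (hvw : ∀ a, E a a v = (Λ a : ℂ) • v)
    (hgen : ∀ W : Submodule ℂ V, (∀ a b, ∀ x ∈ W, E a b x ∈ W) → v ∈ W → ∀ x, x ∈ W) :
    ∃ (B : Type) (_ : Fintype B) (_ : DecidableEq B) (ι : V →ₗ[ℂ] ((B → Fin N) → ℂ)) (c : ℕ → ℂ),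
      Function.Injective ι ∧ (∀ a b x, SS (en N B) (Fintype.card B) a b (ι x) = ι (E a b x)) ∧
      ∀ j < Fintype.card B, ∀ x, JX (en N B) j (ι x) = c j • ι x := by
  obtain ⟨B, i1, i2, f, hf0, hfu, hfw⟩ := exists_hw hN Λ hdom hpoly
  have hs : Sites (en N B) := en_sites
  let k := Fintype.card B
  let P : Submodule ℂ ((B → Fin N) → ℂ) :=
    (⨅ a : Fin N, ⨅ b : Fin N, ⨅ _ : a < b, LinearMap.ker (SS (en N B) k a b)) ⊓
      ⨅ a : Fin N, Module.End.eigenspace (SS (en N B) k a a) (Λ a : ℂ)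
  have hPmem : ∀ x, x ∈ P ↔ (∀ a b, a < b → SS (en N B) k a b x = 0) ∧ ∀ a, SS (en N B) k a a x = (Λ a : ℂ) • x := by
    intro x
    simp only [P, Submodule.mem_inf, Submodule.mem_iInf, LinearMap.mem_ker, Module.End.mem_eigenspace_iff]
  have hP0 : P ≠ ⊥ := (Submodule.ne_bot_iff _).2 ⟨f, (hPmem f).2 ⟨hfu, hfw⟩, hf0⟩
  have hPinv : ∀ j : Fin k, ∀ x ∈ P, JX (en N B) j x ∈ P := by
    intro j x hx
    rw [hPmem] at hx ⊢
    refine ⟨fun a b hab => ?_, fun a => ?_⟩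
    · rw [← Module.End.mul_apply, ← (hs.JX_SS j.2 a b).eq, Module.End.mul_apply, hx.1 a b hab, map_zero]
    · rw [← Module.End.mul_apply, ← (hs.JX_SS j.2 a a).eq, Module.End.mul_apply, hx.2 a, map_smul]
  obtain ⟨P', hle, hne, -, hP'⟩ := common_eig (fun j : Fin k => JX (en N B) j) (fun i j => hs.JX_comm i j)
    Finset.univ P hP0 hPinv
  obtain ⟨w, hw, hw0⟩ := (Submodule.ne_bot_iff _).1 hne
  choose μ hμ using fun j => hP' j (Finset.mem_univ j)
  have hwP := (hPmem w).1 (hle hw)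
  obtain ⟨ι, hι, heq, hιv⟩ := hw_map E hE (SS (en N B) k) (fun a b c d => hs.gl k a b c d) (fun a => (Λ a : ℝ)) v hv0 hvu
    (fun a => by rw [hvw]; simp) hgen w hw0 hwP.1 (fun a => by rw [hwP.2]; simp)
  refine ⟨B, i1, i2, ι, fun j => if h : j < k then μ ⟨j, h⟩ else 0, hι, heq, ?_⟩
  intro j hj x
  have := hgen ((Module.End.eigenspace (JX (en N B) j) (μ ⟨j, hj⟩)).comap ι) ?_ ?_ x
  · rw [Submodule.mem_comap, Module.End.mem_eigenspace_iff] at this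
    rw [this]; simp only [k, hj, dif_pos]
  · intro a b y hy
    rw [Submodule.mem_comap, Module.End.mem_eigenspace_iff] at hy ⊢
    rw [← heq, ← Module.End.mul_apply, (hs.JX_SS hj a b).eq, Module.End.mul_apply, hy, map_smul]
  · rw [Submodule.mem_comap, Module.End.mem_eigenspace_iff, hιv]
    exact hμ ⟨j, hj⟩ w hw
end XXXModel

namespace XXXModel

section Tens
variable {n N : ℕ} {V : Fin n → Type*} [∀ i, AddCommGroup (V i)] [∀ i, Module ℂ (V i)]
  {U : Fin n → Type*} [∀ i, AddCommGroup (U i)] [∀ i, Module ℂ (U i)]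

lemma map_upd (f : ∀ i, V i →ₗ[ℂ] U i) (i : Fin n) (A : Module.End ℂ (U i)) :
    PiTensorProduct.map (Function.update (fun i => (LinearMap.id : U i →ₗ[ℂ] U i)) i A) ∘ₗ PiTensorProduct.map f =
      PiTensorProduct.map (Function.update f i (A ∘ₗ f i)) := by
  rw [← PiTensorProduct.map_comp]
  congr 1
  funext j
  by_cases h : j = i
  · subst h; simp
  · simp [Function.update_of_ne h]

lemma map_upd' (f : ∀ i, V i →ₗ[ℂ] U i) (i : Fin n) (A : Module.End ℂ (V i)) :
    PiTensorProduct.map f ∘ₗ PiTensorProduct.map (Function.update (fun i => (LinearMap.id : V i →ₗ[ℂ] V i)) i A) =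
      PiTensorProduct.map (Function.update f i (f i ∘ₗ A)) := by
  rw [← PiTensorProduct.map_comp]
  congr 1
  funext j
  by_cases h : j = i
  · subst h; simp
  · simp [Function.update_of_ne h]

/-- operator acting in the `i`-th factor -/
noncomputable def tm (U : Fin n → Type*) [∀ i, AddCommGroup (U i)] [∀ i, Module ℂ (U i)] (i : Fin n) :
    Module.End ℂ (U i) →+* Module.End ℂ (PiTensorProduct ℂ U) where
  toFun A := PiTensorProduct.map (Function.update (fun i => (LinearMap.id : U i →ₗ[ℂ] U i)) i A)
  map_one' := by
    have : Function.update (fun i => (LinearMap.id : U i →ₗ[ℂ] U i)) i 1 = fun i => (LinearMap.id : U i →ₗ[ℂ] U i) :=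
      Function.update_eq_self i _
    rw [this, PiTensorProduct.map_id]; rfl
  map_mul' A C := by
    have := map_upd (Function.update (fun i => (LinearMap.id : U i →ₗ[ℂ] U i)) i C) i A
    rw [Function.update_self, Function.update_idem] at this
    exact this.symm
  map_zero' := by
    have := PiTensorProduct.map_update_smul (fun i => (LinearMap.id : U i →ₗ[ℂ] U i)) i (0 : ℂ) 0
    simpa using this
  map_add' A C := PiTensorProduct.map_update_add _ i A C

lemma tm_comm (i j : Fin n) (hij : i ≠ j) (A : Module.End ℂ (U i)) (C : Module.End ℂ (U j)) :
    Commute (tm U i A) (tm U j C) := by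
  have h1 := map_upd (Function.update (fun i => (LinearMap.id : U i →ₗ[ℂ] U i)) j C) i A
  have h2 := map_upd (Function.update (fun i => (LinearMap.id : U i →ₗ[ℂ] U i)) i A) j C
  rw [Function.update_of_ne hij, LinearMap.comp_id] at h1
  rw [Function.update_of_ne hij.symm, LinearMap.comp_id] at h2
  refine h1.trans (Eq.trans ?_ h2.symm)
  rw [Function.update_comm hij]

lemma tm_map (f : ∀ i, V i →ₗ[ℂ] U i) (i : Fin n) (A : Module.End ℂ (U i)) (C : Module.End ℂ (V i))
    (h : A ∘ₗ f i = f i ∘ₗ C) (x) : tm U i A (PiTensorProduct.map f x) = PiTensorProduct.map f (tm V i C x) := by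
  have h1 := congrArg (fun T => T x) (map_upd f i A)
  have h2 := congrArg (fun T => T x) (map_upd' f i C)
  rw [h] at h1
  exact h1.trans h2.symm

lemma tm_scal (f : ∀ i, V i →ₗ[ℂ] U i) (i : Fin n) (A : Module.End ℂ (U i)) (c : ℂ)
    (h : A ∘ₗ f i = c • f i) (x) : tm U i A (PiTensorProduct.map f x) = c • PiTensorProduct.map f x := by
  have h1 := congrArg (fun T => T x) (map_upd f i A)
  rw [h, PiTensorProduct.map_update_smul, Function.update_eq_self] at h1
  exact h1

lemma tm_SS (i : Fin n) (e : ℕ → Fin N → Fin N → Module.End ℂ (U i)) (m : ℕ) (a b : Fin N) :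
    SS (fun j a b => tm U i (e j a b)) m a b = tm U i (SS e m a b) := by
  rw [SS, SS, map_sum]

lemma tm_JX (i : Fin n) (e : ℕ → Fin N → Fin N → Module.End ℂ (U i)) (j : ℕ) :
    JX (fun j a b => tm U i (e j a b)) j = tm U i (JX e j) := by
  simp only [JX, map_sum, map_mul, tm_SS]

lemma tm_sites (i : Fin n) (e : ℕ → Fin N → Fin N → Module.End ℂ (U i)) (h : Sites e) :
    Sites (fun j a b => tm U i (e j a b)) where
  mu j a b c d := by
    rw [← map_mul, h.mu]; split_ifs
    · rfl
    · rw [map_zero]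
  comm j k hjk a b c d := (h.comm j k hjk a b c d).map (tm U i)

lemma map_inj (f : ∀ i, V i →ₗ[ℂ] U i) (hf : ∀ i, Function.Injective (f i)) :
    Function.Injective (PiTensorProduct.map f) := by
  choose g hg using fun i => LinearMap.exists_leftInverse_of_injective (f i) (LinearMap.ker_eq_bot.2 (hf i))
  have h1 : PiTensorProduct.map g ∘ₗ PiTensorProduct.map f = LinearMap.id := by
    rw [← PiTensorProduct.map_comp, ← PiTensorProduct.map_id]
    congr 1
    funext i
    exact hg i
  intro x y hxy
  have h2 := congrArg (PiTensorProduct.map g) hxy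
  have h3 : ∀ x, PiTensorProduct.map g (PiTensorProduct.map f x) = x := fun x => congrArg (fun T => T x) h1
  rwa [h3, h3] at h2
end Tens

section Glue
variable {N : ℕ} {M M' : Type*} [AddCommGroup M] [Module ℂ M] [AddCommGroup M'] [Module ℂ M']

lemma glue {I : Type*} (Q : Matrix (Fin N) (Fin N) ℂ) (z : I → ℂ) (E : I → Fin N → Fin N → Module.End ℂ M)
    (e : I → ℕ → Fin N → Fin N → Module.End ℂ M') (hs : ∀ i, Sites (e i)) (c : I → ℕ → ℂ) (k : I → ℕ)
    (ι : M →ₗ[ℂ] M') (hS : ∀ i a b x, SS (e i) (k i) a b (ι x) = ι (E i a b x))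
    (hJ : ∀ i, ∀ j < k i, ∀ x, JX (e i) j (ι x) = c i j • ι x)
    (u : ℂ) (hu : ∀ i, u - z i ≠ 0) (hc : ∀ i, ∀ j < k i, u - z i + c i j ≠ 0) (L : List I) (a b : Fin N) (x : M) :
    XL Q u (L.flatMap fun i => fuse (e i) (z i) (c i) (k i)) a b (ι x) =
      ι (XL Q u (L.map fun i => ((E i, z i) : Site N (Module.End ℂ M))) a b x) := by
  induction L generalizing a b x with
  | nil =>
    show algebraMap ℂ (Module.End ℂ M') (Q a b) (ι x) = ι (algebraMap ℂ (Module.End ℂ M) (Q a b) x)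
    rw [Module.algebraMap_end_apply, Module.algebraMap_end_apply, map_smul]
  | cons i L ih =>
    rw [List.flatMap_cons, List.map_cons]
    rw [fusion (hs i) Q (z i) (c i) u (hu i) _ (k i) (hc i) a b (ι x) fun j hj => hJ i j hj x]
    show _ = ι ((mmul (XL Q u (L.map fun i => ((E i, z i) : Site N (Module.End ℂ M)))) (Lsite (E i, z i) u) a b) x)
    rw [mmul, LinearMap.sum_apply, map_sum]
    refine Finset.sum_congr rfl fun d _ => ?_
    have h1 : (if d = b then ι x else 0) + (u - z i)⁻¹ • SS (e i) (k i) b d (ι x) = ι (Lsite (E i, z i) u d b x) := by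
      rw [hS, Lsite, LinearMap.add_apply, LinearMap.smul_apply, map_add, map_smul]
      split_ifs <;> simp
    rw [h1, ih]; rfl

lemma XL_prod (Q : Fin N → Fin N → ℂ) (u : ℂ) (l : List (Site N (Module.End ℂ M))) (a b : Fin N) :
    XL Q u l a b = ∑ c, Q a c • (((l.map fun s => Matrix.of (Lsite s u)).reverse).prod c b) := by
  induction l generalizing b with
  | nil =>
    show algebraMap ℂ (Module.End ℂ M) (Q a b) = _
    rw [List.map_nil, List.reverse_nil, List.prod_nil, Finset.sum_eq_single_of_mem b (Finset.mem_univ _)]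
    · rw [Matrix.one_apply_eq, Algebra.algebraMap_eq_smul_one]
    · intro c _ hc; rw [Matrix.one_apply_ne hc, smul_zero]
  | cons s l ih =>
    show ∑ d, XL Q u l a d * Lsite s u d b = _
    rw [List.map_cons, List.reverse_cons, List.prod_append, List.prod_singleton]
    simp only [Matrix.mul_apply, Finset.smul_sum]
    rw [Finset.sum_comm]
    refine Finset.sum_congr rfl fun d _ => ?_
    rw [ih, Finset.sum_mul]
    refine Finset.sum_congr rfl fun c _ => ?_
    rw [smul_mul_assoc, Matrix.of_apply]
end Glue

section Fin
variable {N n : ℕ}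
    (V : Fin n → Type*) [∀ i, AddCommGroup (V i)] [∀ i, Module ℂ (V i)]
    (M : Type*) [AddCommGroup M] [Module ℂ M]
    (E : ∀ i : Fin n, Fin N → Fin N → (V i →ₗ[ℂ] V i))
    (φ : M ≃ₗ[ℂ] PiTensorProduct ℂ V)
    (z : Fin n → ℂ)
    (Q : Matrix (Fin N) (Fin N) ℂ)

lemma Dop_eq : Dop V M E φ z Q = DD (fun u => XL Q u ((List.finRange n).map fun i =>
    ((EE V M E φ i, z i) : Site N (Module.End ℂ M)))) := by
  have hT : ∀ u a b, XL Q u ((List.finRange n).map fun i => ((EE V M E φ i, z i) : Site N (Module.End ℂ M))) a b =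
      ∑ c, Q a c • Tmat V M E φ z u c b := by
    intro u a b
    refine (XL_prod (fun a b => Q a b) u _ a b).trans ?_
    rw [Tmat, List.map_map, List.ofFn_eq_map]
    rfl
  have hX : ∀ a b, Xop V M E φ z Q a b = XXop (fun u => XL Q u ((List.finRange n).map
      fun i => ((EE V M E φ i, z i) : Site N (Module.End ℂ M)))) a b := by
    intro a b
    funext f u
    simp only [Xop, XXop, hT, LinearMap.sum_apply, LinearMap.smul_apply]
  funext f u
  simp only [Dop, DD, hX]

lemma final_aux [FiniteDimensional ℂ M] (hN : 0 < N) (hQ : IsUnit Q.det)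
    (U : Fin n → Type*) [∀ i, AddCommGroup (U i)] [∀ i, Module ℂ (U i)]
    (f : ∀ i, V i →ₗ[ℂ] U i) (hf : ∀ i, Function.Injective (f i))
    (e0 : ∀ i, ℕ → Fin N → Fin N → Module.End ℂ (U i)) (hs0 : ∀ i, Sites (e0 i)) (k : Fin n → ℕ) (c : Fin n → ℕ → ℂ)
    (hS : ∀ i a b x, SS (e0 i) (k i) a b (f i x) = f i (E i a b x))
    (hJ : ∀ i, ∀ j < k i, ∀ x, JX (e0 i) j (f i x) = c i j • f i x) :
    ∃ F : Fin (N * Module.finrank ℂ M) → ℂ → M,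
      (∀ i, IsQE (F i)) ∧
      (∀ i u, Good N z u → Dop V M E φ z Q (F i) u = 0) ∧
      IndepPeriodic F := by
  obtain ⟨e, he⟩ : ∃ e : Fin n → ℕ → Fin N → Fin N → Module.End ℂ (PiTensorProduct ℂ U),
    e = fun i j a b => tm U i (e0 i j a b) := ⟨_, rfl⟩
  have hs : ∀ i, Sites (e i) := fun i => by rw [he]; exact tm_sites i (e0 i) (hs0 i)
  obtain ⟨ιι, hι⟩ : ∃ ιι : M →ₗ[ℂ] PiTensorProduct ℂ U, ∀ x, ιι x = PiTensorProduct.map f (φ x) :=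
    ⟨PiTensorProduct.map f ∘ₗ φ.toLinearMap, fun x => rfl⟩
  have hιι : Function.Injective ιι := by
    intro x y hxy
    rw [hι, hι] at hxy
    exact φ.injective (map_inj f hf hxy)
  have hEE : ∀ i a b x, φ (EE V M E φ i a b x) = tm V i (E i a b) (φ x) := fun i a b x => φ.apply_symm_apply _
  have hSS : ∀ i a b x, SS (e i) (k i) a b (ιι x) = ιι (EE V M E φ i a b x) := by
    intro i a b x
    rw [hι, hι, hEE, he, tm_SS]
    exact tm_map f i _ _ (LinearMap.ext fun y => hS i a b y) _
  have hJJ : ∀ i, ∀ j < k i, ∀ x, JX (e i) j (ιι x) = c i j • ιι x := by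
    intro i j hj x
    rw [hι, he, tm_JX]
    exact tm_scal f i _ _ (LinearMap.ext fun y => hJ i j hj y) _
  have hcc : ∀ i i', i ≠ i' → ∀ j j' a b c d, Commute (e i j a b) (e i' j' c d) := by
    intro i i' hii j j' a b c d
    rw [he]
    exact tm_comm i i' hii _ _
  rw [Dop_eq]
  refine reduction (n := n) hN z
    ((List.finRange n).map fun i => ((EE V M E φ i, z i) : Site N (Module.End ℂ M))) ?_ Q hQ
    ((List.finRange n).flatMap fun i => fuse (e i) (z i) (c i) (k i)) ?_ ?_ ιι hιι ?_
  · intro s hs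
    obtain ⟨i, -, rfl⟩ := List.mem_map.1 hs
    exact ⟨i, rfl⟩
  · intro s hs'
    obtain ⟨i, -, hi⟩ := List.mem_flatMap.1 hs'
    obtain ⟨j, -, rfl⟩ := mem_fuse hi
    exact (hs i).mu j
  · rw [List.pairwise_flatMap]
    refine ⟨fun i _ => fuse_pairwise (hs i) _ _ _, ?_⟩
    refine (List.nodup_finRange n).imp ?_
    intro i i' hii s hs1 t ht a b c' d
    obtain ⟨j, -, rfl⟩ := mem_fuse hs1
    obtain ⟨j', -, rfl⟩ := mem_fuse ht
    exact hcc i i' hii j j' a b c' d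
  · have hne : ∀ w : ℂ, ∀ᶠ u : ℝ in Filter.atTop, (u : ℂ) ≠ w := by
      intro w
      filter_upwards [Filter.eventually_gt_atTop w.re] with u hu h
      rw [← h, Complex.ofReal_re] at hu
      exact lt_irrefl _ hu
    have hev : ∀ᶠ u : ℝ in Filter.atTop, (∀ i, (u : ℂ) ≠ z i) ∧ ∀ i, ∀ j : Fin (k i), (u : ℂ) ≠ z i - c i j :=
      (Filter.eventually_all.2 fun i => hne _).and
        (Filter.eventually_all.2 fun i => Filter.eventually_all.2 fun j => hne _)
    obtain ⟨R, hR⟩ := Filter.eventually_atTop.1 hev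
    refine ⟨R, fun u hu a b x => ?_⟩
    obtain ⟨h1, h2⟩ := hR u hu
    exact glue Q z (fun i => EE V M E φ i) e hs c k ιι hSS hJJ u (fun i => sub_ne_zero.2 (h1 i))
      (fun i j hj h => h2 i ⟨j, hj⟩ (by linear_combination h)) _ a b x
end Fin

theorem final
    {N n : ℕ} (hN : 2 ≤ N)
    (V : Fin n → Type*) [∀ i, AddCommGroup (V i)] [∀ i, Module ℂ (V i)]
    [∀ i, FiniteDimensional ℂ (V i)]
    (M : Type*) [AddCommGroup M] [Module ℂ M] [FiniteDimensional ℂ M]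
    (Λ : Fin n → Fin N → ℤ)
    (hdom : ∀ i, ∀ a b : Fin N, a ≤ b → Λ i b ≤ Λ i a)
    (hpoly : ∀ i a, 0 ≤ Λ i a)
    (E : ∀ i : Fin n, Fin N → Fin N → (V i →ₗ[ℂ] V i))
    (hrel : GlRel V E)
    (hhw : IsHW V E Λ)
    (φ : M ≃ₗ[ℂ] PiTensorProduct ℂ V)
    (z : Fin n → ℂ)
    (Q : Matrix (Fin N) (Fin N) ℂ) (hQ : IsUnit Q.det) :
    ∃ F : Fin (N * Module.finrank ℂ M) → ℂ → M,
      (∀ i, IsQE (F i)) ∧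
      (∀ i u, Good N z u → Dop V M E φ z Q (F i) u = 0) ∧
      IndepPeriodic F := by
  have hgl : ∀ i, Gl (W := V i) (E i) := by
    intro i a b c d
    have := hrel i a b c d
    simp only [ite_smul, one_smul, zero_smul] at this
    exact this
  choose v hv0 hvu hvw hgen using hhw
  choose B i1 i2 ι c hι hS hJ using fun i => embed (by omega) (E i) (hgl i) (Λ i) (hdom i) (hpoly i) (v i) (hv0 i)
    (hvu i) (hvw i) (hgen i)
  exact final_aux V M E φ z Q (by omega) hQ (fun i => (B i → Fin N) → ℂ) ι hι (fun i => en N (B i))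
    (fun i => en_sites) (fun i => Fintype.card (B i)) c hS hJ
end XXXModel

namespace XXXModel

/-- For any invertible complex `N×N` matrix `Q` and any complex numbers
`z_1, …, z_n` (not necessarily distinct), the kernel of the universal difference operator
`D_{Q,M}(u,τ)` acting on `M`-valued functions, where `M = M_{Λ^{(1)}} ⊗ ⋯ ⊗ M_{Λ^{(n)}}` is a
tensor product of polynomial irreducible finite-dimensional `gl_N`-modules, is generated by
quasi-exponentials: there are `N·dim M` quasi-exponentials lying in the kernel which are
linearly independent over the field of one-periodic meromorphic functions. -/
theorem statement_1
    {N n : ℕ} (hN : 2 ≤ N) (hn : 1 ≤ n)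
    (V : Fin n → Type*) [∀ i, AddCommGroup (V i)] [∀ i, Module ℂ (V i)]
    [∀ i, FiniteDimensional ℂ (V i)]
    (M : Type*) [AddCommGroup M] [Module ℂ M] [FiniteDimensional ℂ M]
    (Λ : Fin n → Fin N → ℤ)
    (hdom : ∀ i, ∀ a b : Fin N, a ≤ b → Λ i b ≤ Λ i a)
    (hpoly : ∀ i a, 0 ≤ Λ i a)
    (E : ∀ i : Fin n, Fin N → Fin N → (V i →ₗ[ℂ] V i))
    (hrel : GlRel V E)
    (hhw : IsHW V E Λ)
    (φ : M ≃ₗ[ℂ] PiTensorProduct ℂ V)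
    (z : Fin n → ℂ)
    (Q : Matrix (Fin N) (Fin N) ℂ) (hQ : IsUnit Q.det) :
    ∃ F : Fin (N * Module.finrank ℂ M) → ℂ → M,
      (∀ i, IsQE (F i)) ∧
      (∀ i u, Good N z u → Dop V M E φ z Q (F i) u = 0) ∧
      IndepPeriodic F :=
  final hN V M Λ hdom hpoly E hrel hhw φ z Q hQ

end XXXModel
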